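/- arXiv:2202.08083 — 6 statements merged into one kernel-verified Lean document; each statement's English description precedes it below -/
import Mathlib

section
/- Let u be a Schwartz function on ℝ⁴ whose Fourier transform 𝓕u is supported in a compact subset of ℝ⁴ ∖ {0}. Then for every λ > 0 and every x ∈ ℝ⁴, lim_{ε↓0} (ε/(2π³)) ∫_{ℝ⁴} e^{i x·ξ} 𝓕u(ξ) / ((|ξ|² − λ²)² + ε²) dξ = (λ²/(4π²)) ∫_{S³} e^{iλ ω·x} 𝓕u(λω) dσ(ω), where S³ is the unit sphere in ℝ⁴ and σ its surface measure. -/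
open MeasureTheory Complex Filter Topology
open scoped ENNReal RealInnerProductSpace

noncomputable section

abbrev R4 := EuclideanSpace ℝ (Fin 4)

/-- The Fourier transform with the normalization `(2π)^{-2} ∫ e^{-i x·ξ} u(x) dx`. -/
def FT (u : R4 → ℂ) (ξ : R4) : ℂ :=
  (((2 * Real.pi) ^ 2)⁻¹ : ℝ) * ∫ x : R4, Complex.exp (-Complex.I * (⟪x, ξ⟫ : ℝ)) * u x

lemma polar4 {f : R4 → ℂ} (hf : Integrable f) :
    ∫ x, f x = ∫ r in Set.Ioi (0 : ℝ), (r ^ 3 : ℝ) •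
      ∫ ω : Metric.sphere (0 : R4) 1, f (r • (ω : R4)) ∂(Measure.toSphere (volume : Measure R4)) := by
  have hmp := (volume : Measure R4).measurePreserving_homeomorphUnitSphereProd
  have hdim : Module.finrank ℝ R4 - 1 = 3 := by simp
  rw [hdim] at hmp
  let P : Metric.sphere (0 : R4) 1 × Set.Ioi (0 : ℝ) → ℂ := fun y => f ((y.2 : ℝ) • (y.1 : R4))
  have hP : ∀ x : ({(0 : R4)}ᶜ : Set R4), P (homeomorphUnitSphereProd R4 x) = f x := by
    intro x
    have hx : ‖(x : R4)‖ ≠ 0 := norm_ne_zero_iff.2 x.2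
    simp only [P, homeomorphUnitSphereProd_apply_snd_coe, homeomorphUnitSphereProd_apply_fst_coe]
    rw [smul_smul, mul_inv_cancel₀ hx, one_smul]
  have hPint : Integrable P ((volume : Measure R4).toSphere.prod (Measure.volumeIoiPow 3)) := by
    rw [← hmp.integrable_comp_emb (Homeomorph.measurableEmbedding _)]
    have : (P ∘ homeomorphUnitSphereProd R4) = fun x : ({(0 : R4)}ᶜ : Set R4) => f x := funext hP
    rw [this]
    have h2 := (integrableOn_iff_comap_subtypeVal (μ := (volume : Measure R4)) (f := f)
      (measurableSet_singleton (0 : R4)).compl).1 hf.integrableOn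
    exact h2
  calc
    ∫ x, f x = ∫ x : ({(0 : R4)}ᶜ : Set R4), f x ∂((volume : Measure R4).comap (↑)) := by
      rw [integral_subtype_comap (measurableSet_singleton _).compl f, restrict_compl_singleton]
    _ = ∫ y, P y ∂((volume : Measure R4).toSphere.prod (Measure.volumeIoiPow 3)) := by
      rw [← hmp.integral_comp (Homeomorph.measurableEmbedding _)]
      simp only [hP]
    _ = ∫ r : Set.Ioi (0 : ℝ), (∫ ω, P (ω, r) ∂(volume : Measure R4).toSphere)
          ∂(Measure.volumeIoiPow 3) := integral_prod_symm _ hPint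
    _ = _ := by
      simp only [Measure.volumeIoiPow, ENNReal.ofReal]
      rw [integral_withDensity_eq_integral_smul]
      · rw [← integral_subtype_comap measurableSet_Ioi]
        refine integral_congr_ae (Eventually.of_forall ?_)
        rintro ⟨r, hr⟩
        have hr' : (0 : ℝ) ≤ r ^ 3 := pow_nonneg (le_of_lt hr) _
        simp only [P, NNReal.smul_def, Real.coe_toNNReal _ hr']
      · exact (measurable_subtype_coe.pow_const _).real_toNNReal

lemma FT_continuous (u : SchwartzMap R4 ℂ) : Continuous (FT u) := by
  unfold FT
  refine continuous_const.mul ?_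
  have hu : Continuous u := u.continuous
  refine continuous_of_dominated (bound := fun x => ‖u x‖) (fun ξ => ?_) (fun ξ => ?_)
    u.integrable.norm ?_
  · exact Continuous.aestronglyMeasurable (by fun_prop)
  · refine Eventually.of_forall fun x => ?_
    rw [norm_mul, Complex.norm_exp]
    simp
  · exact Eventually.of_forall fun x => by fun_prop

/-- Approximate identity given by the Poisson kernel. -/
lemma poisson_limit {h : ℝ → ℂ} (hc : Continuous h) {C : ℝ} (hC : ∀ s, ‖h s‖ ≤ C) (a : ℝ) :
    Tendsto (fun ε : ℝ => (ε : ℂ) * ∫ s : ℝ, h s / (((s - a) ^ 2 + ε ^ 2 : ℝ) : ℂ))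
      (nhdsWithin (0 : ℝ) (Set.Ioi 0)) (nhds ((Real.pi : ℂ) * h a)) := by
  have h1 : Tendsto (fun ε : ℝ => ∫ t : ℝ, h (ε * t + a) * (((1 + t ^ 2)⁻¹ : ℝ) : ℂ))
      (nhdsWithin (0 : ℝ) (Set.Ioi 0)) (nhds (∫ t : ℝ, h a * (((1 + t ^ 2)⁻¹ : ℝ) : ℂ))) := by
    have hcc : Continuous fun t : ℝ => (((1 + t ^ 2)⁻¹ : ℝ) : ℂ) := by
      refine Complex.continuous_ofReal.comp (Continuous.inv₀ (by fun_prop) fun t => ?_)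
      positivity
    refine tendsto_integral_filter_of_dominated_convergence
      (fun t => C * (1 + t ^ 2)⁻¹) ?_ ?_ (integrable_inv_one_add_sq.const_mul C) ?_
    · refine Eventually.of_forall fun ε => Continuous.aestronglyMeasurable ?_
      exact (hc.comp (by fun_prop)).mul hcc
    · refine Eventually.of_forall fun ε => Eventually.of_forall fun t => ?_
      have : (0 : ℝ) ≤ (1 + t ^ 2)⁻¹ := by positivity
      rw [norm_mul, Complex.norm_real, Real.norm_of_nonneg this]
      exact mul_le_mul_of_nonneg_right (hC _) this
    · refine Eventually.of_forall fun t => ?_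
      have : Continuous fun ε : ℝ => h (ε * t + a) * (((1 + t ^ 2)⁻¹ : ℝ) : ℂ) :=
        (hc.comp (by fun_prop)).mul continuous_const
      have h2 := (this.tendsto 0).mono_left (nhdsWithin_le_nhds (s := Set.Ioi (0 : ℝ)))
      simpa using h2
  rw [integral_const_mul, integral_complex_ofReal, integral_univ_inv_one_add_sq, mul_comm] at h1
  refine h1.congr' ?_
  filter_upwards [self_mem_nhdsWithin] with ε hε
  have hε : 0 < ε := hε
  let F : ℝ → ℂ := fun s => h s / (((s - a) ^ 2 + ε ^ 2 : ℝ) : ℂ)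
  have e1 : ∫ s, F s = ∫ s, F (s + a) := (integral_add_right_eq_self F a).symm
  have e2 := Measure.integral_comp_mul_left (fun s => F (s + a)) ε
  have e3 : ∫ s, F (s + a) = (ε : ℂ) * ∫ t, F (ε * t + a) := by
    rw [e2, abs_of_pos (inv_pos.2 hε), Complex.real_smul, ← mul_assoc]
    have : (ε : ℂ) ≠ 0 := by exact_mod_cast hε.ne'
    push_cast
    rw [mul_inv_cancel₀ this, one_mul]
  change _ = (ε : ℂ) * ∫ s, F s
  rw [e1, e3, ← mul_assoc, ← integral_const_mul]
  refine integral_congr_ae (Eventually.of_forall fun t => ?_)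
  simp only [F]
  have h1 : (ε : ℂ) ≠ 0 := by exact_mod_cast hε.ne'
  have h2 : (1 + (t : ℂ) ^ 2) ≠ 0 := by
    have : (1 + t ^ 2 : ℝ) ≠ 0 := by positivity
    exact_mod_cast this
  have h3 : ((((ε * t + a - a) ^ 2 + ε ^ 2 : ℝ)) : ℂ) = ε ^ 2 * (1 + (t : ℂ) ^ 2) := by
    push_cast; ring
  rw [h3]
  push_cast
  field_simp

/-- For a Schwartz function `u` on `ℝ⁴` whose Fourier transform is supported in a compact
subset of `ℝ⁴ \ {0}`, the regularized spectral integrals converge, for every `λ > 0` and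
every `x`, to the spherical average `(λ²/4π²)∫_{S³} e^{iλω·x} 𝓕u(λω) dσ(ω)`. -/
theorem stmt_3 (u : SchwartzMap R4 ℂ)
    (hsupp : HasCompactSupport (FT u)) (h0 : (0 : R4) ∉ tsupport (FT u)) :
    ∀ lam : ℝ, 0 < lam → ∀ x : R4,
      Tendsto
        (fun ε : ℝ => ((ε / (2 * Real.pi ^ 3) : ℝ) : ℂ) *
          ∫ ξ : R4, Complex.exp (Complex.I * (⟪x, ξ⟫ : ℝ)) * FT u ξ /
            (((‖ξ‖ ^ 2 - lam ^ 2) ^ 2 + ε ^ 2 : ℝ) : ℂ))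
        (nhdsWithin (0 : ℝ) (Set.Ioi 0))
        (nhds (((lam ^ 2 / (4 * Real.pi ^ 2) : ℝ) : ℂ) *
          ∫ ω : Metric.sphere (0 : R4) 1,
            Complex.exp (Complex.I * (lam : ℂ) * ((⟪(ω : R4), x⟫ : ℝ) : ℂ)) *
              FT u (lam • (ω : R4)) ∂(Measure.toSphere (volume : Measure R4)))) := by
  intro lam hlam x
  have hFT := FT_continuous u
  let g : R4 → ℂ := fun ξ => Complex.exp (Complex.I * (⟪x, ξ⟫ : ℝ)) * FT u ξ
  have hgc : Continuous g := by fun_prop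
  have hgs : HasCompactSupport g := hsupp.mul_left
  let k : R4 → ℂ := fun ξ => ((‖ξ‖ ^ 2 / 2 : ℝ) : ℂ) * g ξ
  have hkc : Continuous k := by fun_prop
  have hks : HasCompactSupport k := hgs.mul_left
  obtain ⟨C, hC⟩ := hkc.bounded_above_of_compact_support hks
  let σ : Measure (Metric.sphere (0 : R4) 1) := (volume : Measure R4).toSphere
  have : IsFiniteMeasure σ := inferInstanceAs (IsFiniteMeasure (volume : Measure R4).toSphere)
  let h : ℝ → ℂ := fun s => ∫ ω : Metric.sphere (0 : R4) 1, k (√s • (ω : R4)) ∂σ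
  have hhc : Continuous h := by
    refine continuous_of_dominated (bound := fun _ => C) (fun s => ?_) (fun s => ?_)
      (integrable_const _) ?_
    · exact Continuous.aestronglyMeasurable (by fun_prop)
    · exact Eventually.of_forall fun ω => hC _
    · exact Eventually.of_forall fun ω => by fun_prop
  have hhb : ∀ s, ‖h s‖ ≤ C * σ.real Set.univ := fun s =>
    norm_integral_le_of_norm_le_const (Eventually.of_forall fun ω => hC _)
  have hh0 : ∀ s, s ≤ 0 → h s = 0 := by
    intro s hs
    simp [h, Real.sqrt_eq_zero_of_nonpos hs, k]
  have hhr : ∀ r : ℝ, 0 ≤ r → h (r ^ 2) = ((r ^ 2 / 2 : ℝ) : ℂ) * ∫ ω, g (r • (ω : R4)) ∂σ := by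
    intro r hr
    simp only [h, k, Real.sqrt_sq hr]
    rw [← integral_const_mul]
    refine integral_congr_ae (Eventually.of_forall fun ω => ?_)
    have : ‖r • (ω : R4)‖ = r := by
      rw [norm_smul, norm_eq_of_mem_sphere, mul_one, Real.norm_of_nonneg hr]
    simp only [this]
  have key := (poisson_limit hhc hhb (lam ^ 2)).const_mul (((1 / (2 * Real.pi ^ 3) : ℝ)) : ℂ)
  have hlim : (((1 / (2 * Real.pi ^ 3) : ℝ)) : ℂ) * ((Real.pi : ℂ) * h (lam ^ 2)) =
      (((lam ^ 2 / (4 * Real.pi ^ 2) : ℝ) : ℂ) *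
          ∫ ω : Metric.sphere (0 : R4) 1,
            Complex.exp (Complex.I * (lam : ℂ) * ((⟪(ω : R4), x⟫ : ℝ) : ℂ)) *
              FT u (lam • (ω : R4)) ∂(Measure.toSphere (volume : Measure R4))) := by
    rw [hhr lam hlam.le]
    have : ∫ ω, g (lam • (ω : R4)) ∂σ = ∫ ω : Metric.sphere (0 : R4) 1,
            Complex.exp (Complex.I * (lam : ℂ) * ((⟪(ω : R4), x⟫ : ℝ) : ℂ)) *
              FT u (lam • (ω : R4)) ∂(Measure.toSphere (volume : Measure R4)) := by
      refine integral_congr_ae (Eventually.of_forall fun ω => ?_)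
      simp only [g]
      rw [real_inner_smul_right, real_inner_comm]
      push_cast
      rw [mul_assoc]
    rw [this, ← mul_assoc, ← mul_assoc]
    congr 1
    have hpi : (Real.pi : ℂ) ≠ 0 := by exact_mod_cast Real.pi_ne_zero
    push_cast
    field_simp
    ring
  rw [hlim] at key
  refine key.congr' ?_
  filter_upwards [self_mem_nhdsWithin] with ε hε
  have hε : 0 < ε := hε
  have hden : ∀ a : ℝ, (((a - lam ^ 2) ^ 2 + ε ^ 2 : ℝ) : ℂ) ≠ 0 := by
    intro a
    have : ((a - lam ^ 2) ^ 2 + ε ^ 2 : ℝ) ≠ 0 := by positivity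
    exact_mod_cast this
  have hfint : Integrable fun ξ : R4 => g ξ / (((‖ξ‖ ^ 2 - lam ^ 2) ^ 2 + ε ^ 2 : ℝ) : ℂ) := by
    refine Continuous.integrable_of_hasCompactSupport ?_ ?_
    · exact hgc.div (by fun_prop) fun ξ => hden _
    · simp only [div_eq_mul_inv]
      exact hgs.mul_right
  have hpol := polar4 hfint
  let F : ℝ → ℂ := fun s => h s / (((s - lam ^ 2) ^ 2 + ε ^ 2 : ℝ) : ℂ)
  have hsub := integral_comp_rpow_Ioi_of_pos (g := F) (p := 2) two_pos
  have hF0 : ∫ s in Set.Ioi (0 : ℝ), F s = ∫ s, F s := by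
    refine setIntegral_eq_integral_of_forall_compl_eq_zero fun s hs => ?_
    simp [F, hh0 s (not_lt.1 hs)]
  have heq : ∫ ξ : R4, g ξ / (((‖ξ‖ ^ 2 - lam ^ 2) ^ 2 + ε ^ 2 : ℝ) : ℂ) = ∫ s, F s := by
    rw [hpol, ← hF0, ← hsub]
    refine setIntegral_congr_fun measurableSet_Ioi fun r hr => ?_
    have hr : (0 : ℝ) < r := hr
    have e1 : r ^ (2 - 1 : ℝ) = r := by norm_num
    have e2 : r ^ (2 : ℝ) = r ^ 2 := by norm_cast
    simp only [F]
    rw [e1, e2, hhr r hr.le]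
    have : ∀ ω : Metric.sphere (0 : R4) 1, ‖r • (ω : R4)‖ = r := by
      intro ω
      rw [norm_smul, norm_eq_of_mem_sphere, mul_one, Real.norm_of_nonneg hr.le]
    simp only [this]
    rw [integral_div, Complex.real_smul, Complex.real_smul]
    push_cast
    ring
  change _ = _ * ∫ ξ : R4, g ξ / (((‖ξ‖ ^ 2 - lam ^ 2) ^ 2 + ε ^ 2 : ℝ) : ℂ)
  rw [heq, ← mul_assoc]
  congr 1
  push_cast
  ring
end
end

section
/- There exist constants C₀, C₁ > 0 and, for every j ∈ ℕ, a constant C_{2+j} > 0 such that for all λ > 0 and all x ∈ ℝ⁴ ∖ {0} with λ|x| ≥ 1: |𝒢_λ(x)| ≤ C₀ λ², |∂_λ 𝒢_λ(x)| ≤ C₁ λ, and |∂_λ^{2+j} 𝒢_λ(x)| ≤ C_{2+j} λ^{1/2} |x|^{1/2+j}, where ∂_λ^{k} denotes the k-th derivative of the map λ ↦ 𝒢_λ(x) on (0,∞). -/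
open MeasureTheory Complex
open scoped ENNReal

noncomputable section

/-- The free Green function on `ℝ⁴`:
`𝒢_μ(x) = e^{iμ|x|}/(2(2π)^{3/2}Γ(3/2)|x|²) ∫₀^∞ e^{-t} t^{1/2} (t/2 - iμ|x|)^{1/2} dt`,
with the principal branch of the square root. -/
def G (μ : ℝ) (x : R4) : ℂ :=
  Complex.exp (Complex.I * (μ : ℂ) * (‖x‖ : ℂ)) /
    (((2 * (2 * Real.pi) ^ ((3 : ℝ) / 2) * Real.Gamma (3 / 2) * ‖x‖ ^ 2 : ℝ)) : ℂ) *
    ∫ t in Set.Ioi (0 : ℝ),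
      ((Real.exp (-t) : ℝ) : ℂ) * ((Real.sqrt t : ℝ) : ℂ) *
        (((t / 2 : ℝ) : ℂ) - Complex.I * (μ : ℂ) * (‖x‖ : ℂ)) ^ ((1 : ℂ) / 2)

/-- The integrand of `G`, with complex spectral variable. -/
def hInt (w : ℂ) (t : ℝ) : ℂ :=
  ((Real.exp (-t) : ℝ) : ℂ) * ((Real.sqrt t : ℝ) : ℂ) *
        (((t / 2 : ℝ) : ℂ) - w) ^ ((1 : ℂ) / 2)

/-- Dominating function. -/
def gB (t : ℝ) : ℝ := Real.exp (-t) * Real.sqrt t * (1 + t)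

lemma gB_nonneg {t : ℝ} (ht : 0 < t) : 0 ≤ gB t := by
  unfold gB; positivity

lemma int0 : IntegrableOn (fun t : ℝ => Real.exp (-t) * Real.sqrt t) (Set.Ioi 0) := by
  have h := Real.GammaIntegral_convergent (s := 3 / 2) (by norm_num)
  refine h.congr_fun (fun t ht => ?_) measurableSet_Ioi
  simp only
  rw [Real.sqrt_eq_rpow]; norm_num

lemma int1 : IntegrableOn gB (Set.Ioi 0) := by
  have h := Real.GammaIntegral_convergent (s := 5 / 2) (by norm_num)
  refine (int0.add h).congr_fun (fun t ht => ?_) measurableSet_Ioi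
  have ht' : (0 : ℝ) < t := ht
  simp only [gB, Pi.add_apply]
  have : t ^ ((5 : ℝ) / 2 - 1) = Real.sqrt t * t := by
    rw [Real.sqrt_eq_rpow, ← Real.rpow_add_one ht'.ne']; norm_num
  rw [this]; ring

lemma norm_cpow_half (z : ℂ) : ‖z ^ ((1 : ℂ) / 2)‖ = Real.sqrt ‖z‖ := by
  have h := Complex.norm_cpow_real z (1 / 2)
  rw [Real.sqrt_eq_rpow, ← h]; norm_num

lemma norm_cpow_neg_half (z : ℂ) : ‖z ^ ((1 : ℂ) / 2 - 1)‖ = ‖z‖ ^ (-(1 / 2) : ℝ) := by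
  have h := Complex.norm_cpow_real z (-(1 / 2))
  rw [← h]; norm_num

lemma norm_hInt {w : ℂ} {s : ℝ} (hs : 1 ≤ s) (hw : ‖w‖ ≤ 2 * s) {t : ℝ} (ht : 0 < t) :
    ‖hInt w t‖ ≤ Real.sqrt (2 * s) * gB t := by
  have h1 : ‖((t / 2 : ℝ) : ℂ) - w‖ ≤ (2 * s) * (1 + t) ^ 2 := by
    calc ‖((t / 2 : ℝ) : ℂ) - w‖ ≤ ‖((t / 2 : ℝ) : ℂ)‖ + ‖w‖ := norm_sub_le _ _
      _ ≤ t / 2 + 2 * s := by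
        rw [Complex.norm_real, Real.norm_of_nonneg (by positivity)]; linarith
      _ ≤ _ := by nlinarith [mul_pos (by linarith : (0 : ℝ) < s) ht, sq_nonneg t,
          mul_nonneg (by linarith : (0 : ℝ) ≤ s) (sq_nonneg t)]
  have h2 : Real.sqrt ‖((t / 2 : ℝ) : ℂ) - w‖ ≤ Real.sqrt (2 * s) * (1 + t) := by
    refine (Real.sqrt_le_sqrt h1).trans (le_of_eq ?_)
    rw [Real.sqrt_mul (by linarith), Real.sqrt_sq (by linarith)]
  unfold hInt gB
  rw [norm_mul, norm_mul, norm_cpow_half, Complex.norm_real, Complex.norm_real,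
    Real.norm_of_nonneg (Real.exp_pos _).le, Real.norm_of_nonneg (Real.sqrt_nonneg _)]
  calc _ ≤ Real.exp (-t) * Real.sqrt t * (Real.sqrt (2 * s) * (1 + t)) := by gcongr
    _ = _ := by ring

lemma hInt_meas (w : ℂ) : Measurable (hInt w) := by
  unfold hInt
  fun_prop

lemma hInt_integrable (w : ℂ) : IntegrableOn (hInt w) (Set.Ioi 0) := by
  refine (int1.const_mul (Real.sqrt (2 * (1 + ‖w‖)))).mono' (hInt_meas w).aestronglyMeasurable ?_
  refine (ae_restrict_iff' measurableSet_Ioi).2 (Filter.Eventually.of_forall fun t ht => ?_)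
  exact norm_hInt (by linarith [norm_nonneg w]) (by linarith [norm_nonneg w]) ht

lemma norm_H {w : ℂ} {s : ℝ} (hs : 1 ≤ s) (hw : ‖w‖ ≤ 2 * s) :
    ‖∫ t in Set.Ioi (0 : ℝ), hInt w t‖ ≤ Real.sqrt (2 * s) * ∫ t in Set.Ioi (0 : ℝ), gB t := by
  rw [← integral_const_mul]
  refine norm_integral_le_of_norm_le (int1.const_mul _) ?_
  refine (ae_restrict_iff' measurableSet_Ioi).2 (Filter.Eventually.of_forall fun t ht => ?_)
  exact norm_hInt hs hw ht

lemma H_diff {w : ℂ} (hw : 0 < w.im) :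
    DifferentiableAt ℂ (fun w => ∫ t in Set.Ioi (0 : ℝ), hInt w t) w := by
  have hopen : IsOpen {z : ℂ | w.im / 2 < z.im} := isOpen_lt continuous_const Complex.continuous_im
  have key := hasDerivAt_integral_of_dominated_loc_of_deriv_le
    (μ := volume.restrict (Set.Ioi (0 : ℝ))) (F := hInt) (x₀ := w)
    (s := {z : ℂ | w.im / 2 < z.im})
    (bound := fun t => (w.im / 2) ^ (-(1 / 2) : ℝ) * (Real.exp (-t) * Real.sqrt t))
    (F' := fun w t => ((Real.exp (-t) : ℝ) : ℂ) * ((Real.sqrt t : ℝ) : ℂ) *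
        ((1 : ℂ) / 2 * (((t / 2 : ℝ) : ℂ) - w) ^ ((1 : ℂ) / 2 - 1) * (-1)))
    (hopen.mem_nhds (by simp only [Set.mem_setOf_eq]; linarith))
    (Filter.Eventually.of_forall fun z => (hInt_meas z).aestronglyMeasurable)
    (hInt_integrable w) (by
      apply Measurable.aestronglyMeasurable
      fun_prop) ?_ (int0.const_mul _) ?_
  · exact key.2.differentiableAt
  · refine Filter.Eventually.of_forall fun t z hz => ?_
    simp only [Set.mem_setOf_eq] at hz
    have h1 : w.im / 2 ≤ ‖((t / 2 : ℝ) : ℂ) - z‖ := by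
      have := Complex.abs_im_le_norm (((t / 2 : ℝ) : ℂ) - z)
      simp only [Complex.sub_im, Complex.ofReal_im, zero_sub, abs_neg] at this
      linarith [le_abs_self z.im]
    have h2 : ‖((t / 2 : ℝ) : ℂ) - z‖ ^ (-(1 / 2) : ℝ) ≤ (w.im / 2) ^ (-(1 / 2) : ℝ) :=
      Real.rpow_le_rpow_of_nonpos (by linarith) h1 (by norm_num)
    rw [norm_mul, norm_mul, norm_mul, norm_mul, norm_cpow_neg_half, Complex.norm_real,
      Complex.norm_real,
      Real.norm_of_nonneg (Real.exp_pos _).le, Real.norm_of_nonneg (Real.sqrt_nonneg _)]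
    have h3 : ‖(1 : ℂ) / 2‖ = 1 / 2 := by simp
    rw [h3, norm_neg, norm_one, mul_one, mul_comm]
    have h0 : 0 ≤ ‖((t / 2 : ℝ) : ℂ) - z‖ ^ (-(1 / 2) : ℝ) := by positivity
    gcongr
    linarith
  · refine Filter.Eventually.of_forall fun t z hz => ?_
    simp only [Set.mem_setOf_eq] at hz
    unfold hInt
    refine HasDerivAt.const_mul _ (HasDerivAt.cpow_const ?_ ?_)
    · exact (hasDerivAt_id z).const_sub _
    · rw [Complex.mem_slitPlane_iff]
      right
      simp only [Complex.sub_im, Complex.ofReal_im, zero_sub, ne_eq, neg_eq_zero]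
      linarith

/-- The constant in the denominator. -/
def KK : ℝ := 2 * (2 * Real.pi) ^ ((3 : ℝ) / 2) * Real.Gamma (3 / 2)

lemma KK_pos : 0 < KK := by
  unfold KK
  have := Real.Gamma_pos_of_pos (s := 3 / 2) (by norm_num)
  positivity

/-- Complexified Green function. -/
def Gc (r : ℝ) (z : ℂ) : ℂ :=
  Complex.exp (Complex.I * z * (r : ℂ)) / (((KK * r ^ 2 : ℝ)) : ℂ) *
    ∫ t in Set.Ioi (0 : ℝ), hInt (Complex.I * z * (r : ℂ)) t

lemma G_eq (μ : ℝ) (x : R4) : G μ x = Gc ‖x‖ μ := rfl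

lemma Gc_diff {r : ℝ} (hr : 0 < r) {z : ℂ} (hz : 0 < z.re) : DifferentiableAt ℂ (Gc r) z := by
  unfold Gc
  refine DifferentiableAt.mul (by fun_prop) ?_
  have h := H_diff (w := Complex.I * z * (r : ℂ)) (by simp; positivity)
  exact h.comp z (f := fun z => Complex.I * z * (r : ℂ)) (by fun_prop)

lemma iter_real {f : ℂ → ℂ} (hf : AnalyticOnNhd ℂ f {z : ℂ | 0 < z.re}) (n : ℕ) :
    ∀ a : ℝ, 0 < a → iteratedDeriv n (fun y : ℝ => f y) a = iteratedDeriv n f a := by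
  induction n with
  | zero => intro a _; simp
  | succ n ih =>
    intro a ha
    have h1 : iteratedDeriv n (fun y : ℝ => f y) =ᶠ[nhds a] fun y : ℝ => iteratedDeriv n f y := by
      filter_upwards [lt_mem_nhds ha] with b hb using ih b hb
    rw [iteratedDeriv_succ, iteratedDeriv_succ, h1.deriv_eq]
    have h2 : DifferentiableAt ℂ (iteratedDeriv n f) a := by
      rw [iteratedDeriv_eq_iterate]
      exact (hf.iterated_deriv n a (by simpa using ha)).differentiableAt
    exact h2.hasDerivAt.comp_ofReal.deriv

/-- The overall constant. -/
def MM : ℝ := Real.exp 1 / KK * (Real.sqrt 2 * ∫ t in Set.Ioi (0 : ℝ), gB t)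

lemma MM_nonneg : 0 ≤ MM := by
  have h : 0 ≤ ∫ t in Set.Ioi (0 : ℝ), gB t :=
    setIntegral_nonneg measurableSet_Ioi fun t ht => gB_nonneg ht
  have := KK_pos
  unfold MM; positivity

lemma Gc_bound {r lam : ℝ} (hr : 0 < r) (h1 : 1 ≤ lam * r) {z : ℂ}
    (hz : ‖z - lam‖ ≤ 1 / (2 * r)) : ‖Gc r z‖ ≤ MM * Real.sqrt (lam * r) / r ^ 2 := by
  have hK := KK_pos
  have hzr : ‖z - lam‖ * r ≤ 1 / 2 := by
    calc _ ≤ 1 / (2 * r) * r := by gcongr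
      _ = 1 / 2 := by field_simp
  have hlam : 0 < lam := by
    by_contra h
    nlinarith
  have hn : ‖Complex.I * z * (r : ℂ)‖ ≤ 2 * (lam * r) := by
    rw [norm_mul, norm_mul, Complex.norm_I, one_mul, Complex.norm_real, Real.norm_of_nonneg hr.le]
    have : ‖z‖ ≤ ‖z - lam‖ + lam := by
      have := norm_add_le (z - lam) lam
      rw [sub_add_cancel, Complex.norm_real, Real.norm_of_nonneg hlam.le] at this
      exact this
    nlinarith
  have hH := norm_H h1 hn
  have he : ‖Complex.exp (Complex.I * z * (r : ℂ))‖ ≤ Real.exp 1 := by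
    rw [Complex.norm_exp]
    apply Real.exp_le_exp.2
    have := Complex.abs_im_le_norm (z - lam)
    simp only [Complex.sub_im, Complex.ofReal_im, sub_zero] at this
    have h4 := neg_le_abs z.im
    simp
    nlinarith
  unfold Gc
  rw [norm_mul, norm_div, Complex.norm_real, Real.norm_of_nonneg (by positivity)]
  calc _ ≤ Real.exp 1 / (KK * r ^ 2) *
        (Real.sqrt (2 * (lam * r)) * ∫ t in Set.Ioi (0 : ℝ), gB t) := by gcongr
    _ = _ := by
      rw [Real.sqrt_mul (by norm_num)]
      unfold MM
      field_simp

lemma main_bound (n : ℕ) {lam : ℝ} {x : R4} (hx : x ≠ 0) (h1 : 1 ≤ lam * ‖x‖) :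
    ‖iteratedDeriv n (fun μ : ℝ => G μ x) lam‖ ≤
      ((n.factorial : ℝ) * MM * 2 ^ n) * (Real.sqrt (lam * ‖x‖) * ‖x‖ ^ n / ‖x‖ ^ 2) := by
  have hr : 0 < ‖x‖ := norm_pos_iff.2 hx
  generalize hrr : ‖x‖ = r at *
  have hlam : 0 < lam := by
    by_contra h
    nlinarith
  have hopen : IsOpen {z : ℂ | 0 < z.re} := isOpen_lt continuous_const Complex.continuous_re
  have hd : DifferentiableOn ℂ (Gc r) {z : ℂ | 0 < z.re} :=
    fun z hz => (Gc_diff hr hz).differentiableWithinAt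
  have hG : (fun μ : ℝ => G μ x) = fun μ : ℝ => Gc r μ := by
    funext μ; rw [G_eq, hrr]
  rw [hG, iter_real (hd.analyticOnNhd hopen) n lam hlam]
  have hR : 0 < 1 / (2 * r) := by positivity
  have hRl : 1 / (2 * r) < lam := by
    rw [div_lt_iff₀ (by positivity)]; nlinarith
  have hsub : Metric.closedBall (lam : ℂ) (1 / (2 * r)) ⊆ {z : ℂ | 0 < z.re} := by
    intro z hz
    rw [Metric.mem_closedBall, dist_eq_norm] at hz
    have := (Complex.abs_re_le_norm (z - lam)).trans hz
    simp only [Complex.sub_re, Complex.ofReal_re] at this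
    have := (abs_le.1 this).1
    simp only [Set.mem_setOf_eq]
    linarith
  refine (Complex.norm_iteratedDeriv_le_of_forall_mem_sphere_norm_le
    (C := MM * Real.sqrt (lam * r) / r ^ 2) n hR ?_ ?_).trans (le_of_eq ?_)
  · refine DifferentiableOn.diffContOnCl (hd.mono ?_)
    rwa [closure_ball _ hR.ne']
  · intro z hz
    rw [Metric.mem_sphere, dist_eq_norm] at hz
    exact Gc_bound hr h1 hz.le
  · rw [one_div, inv_pow, div_inv_eq_mul, mul_pow]
    ring

/-- Bounds for the Green function and its `λ`-derivatives in the regime `λ|x| ≥ 1`. -/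
theorem stmt_4 :
    ∃ C₀ : ℝ, 0 < C₀ ∧ ∃ C₁ : ℝ, 0 < C₁ ∧
      ((∀ (lam : ℝ) (x : R4), 0 < lam → x ≠ 0 → 1 ≤ lam * ‖x‖ →
          ‖G lam x‖ ≤ C₀ * lam ^ 2 ∧
          ‖deriv (fun μ : ℝ => G μ x) lam‖ ≤ C₁ * lam) ∧
        ∀ j : ℕ, ∃ C : ℝ, 0 < C ∧
          ∀ (lam : ℝ) (x : R4), 0 < lam → x ≠ 0 → 1 ≤ lam * ‖x‖ →
            ‖iteratedDeriv (2 + j) (fun μ : ℝ => G μ x) lam‖ ≤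
              C * lam ^ ((1 : ℝ) / 2) * ‖x‖ ^ ((1 : ℝ) / 2 + j)) := by
  have hM := MM_nonneg
  refine ⟨MM + 1, by linarith, 2 * MM + 1, by linarith, ?_, ?_⟩
  · intro lam x hl hx h1
    have hr : 0 < ‖x‖ := norm_pos_iff.2 hx
    have hs : Real.sqrt (lam * ‖x‖) ≤ lam * ‖x‖ :=
      Real.sqrt_le_iff.2 ⟨by positivity, by nlinarith⟩
    constructor
    · have h := main_bound 0 hx h1
      simp only [iteratedDeriv_zero, Nat.factorial_zero, Nat.cast_one, pow_zero, mul_one,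
        one_mul] at h
      refine h.trans ?_
      have : Real.sqrt (lam * ‖x‖) / ‖x‖ ^ 2 ≤ lam ^ 2 := by
        rw [div_le_iff₀ (by positivity)]
        nlinarith
      nlinarith [sq_nonneg lam]
    · have h := main_bound 1 hx h1
      simp only [iteratedDeriv_one, Nat.factorial_one, Nat.cast_one, pow_one,
        one_mul] at h
      refine h.trans ?_
      have : Real.sqrt (lam * ‖x‖) * ‖x‖ / ‖x‖ ^ 2 ≤ lam := by
        rw [div_le_iff₀ (by positivity)]
        nlinarith
      nlinarith
  · intro j
    refine ⟨((2 + j).factorial : ℝ) * MM * 2 ^ (2 + j) + 1, by positivity, ?_⟩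
    intro lam x hl hx h1
    have hr : 0 < ‖x‖ := norm_pos_iff.2 hx
    refine (main_bound (2 + j) hx h1).trans ?_
    have : Real.sqrt (lam * ‖x‖) * ‖x‖ ^ (2 + j) / ‖x‖ ^ 2 =
        lam ^ ((1 : ℝ) / 2) * ‖x‖ ^ ((1 : ℝ) / 2 + j) := by
      rw [Real.rpow_add hr, Real.rpow_natCast, Real.sqrt_eq_rpow,
        Real.mul_rpow hl.le hr.le, pow_add]
      field_simp
    rw [this, mul_assoc (_ + 1)]
    gcongr
    linarith
end
end

section
/- Let Λ > 1. There exist a constant C > 0 and, for every j ∈ ℕ, a constant C_j > 0 such that for all λ ∈ (Λ^{-1}, Λ) and all x ∈ ℝ⁴ ∖ {0}: |𝒢_{−λ}(x)| ≤ C ⟨x⟩^{1/2} |x|^{-2}, |∂_λ 𝒢_{−λ}(x)| ≤ C ⟨x⟩^{1/2} |x|^{-1}, and |∂_λ^{2+j} 𝒢_{−λ}(x)| ≤ C_j (⟨x⟩^{1/2+j} + |log|x||), where ∂_λ^{k} denotes the k-th derivative of the map λ ↦ 𝒢_{−λ}(x). -/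
open MeasureTheory Complex
open scoped ENNReal

noncomputable section

/-- integrand with exponent 1/2 - l -/
def gI (l : ℕ) (s t : ℝ) : ℂ :=
  ((Real.exp (-t) : ℝ) : ℂ) * ((Real.sqrt t : ℝ) : ℂ) *
    (((t / 2 : ℝ) : ℂ) + Complex.I * (s : ℂ)) ^ (((1 / 2 - l : ℝ)) : ℂ)

def gF (l : ℕ) (s : ℝ) : ℂ := ∫ t in Set.Ioi (0 : ℝ), gI l s t

lemma gI_meas (l : ℕ) (s : ℝ) : Measurable (gI l s) := by
  unfold gI
  fun_prop

lemma base_low (s t : ℝ) (hs : 0 < s) (ht : 0 < t) :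
    (t + s) / 4 ≤ ‖(((t / 2 : ℝ) : ℂ) + Complex.I * (s : ℂ))‖ := by
  have h1 := Complex.abs_re_le_norm (((t / 2 : ℝ) : ℂ) + Complex.I * (s : ℂ))
  have h2 := Complex.abs_im_le_norm (((t / 2 : ℝ) : ℂ) + Complex.I * (s : ℂ))
  have e1 : (((t / 2 : ℝ) : ℂ) + Complex.I * (s : ℂ)).re = t / 2 := by simp
  have e2 : (((t / 2 : ℝ) : ℂ) + Complex.I * (s : ℂ)).im = s := by simp
  rw [e1] at h1
  rw [e2] at h2
  have := le_abs_self s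
  have := le_abs_self (t / 2)
  linarith

lemma base_up (s t : ℝ) (hs : 0 < s) (ht : 0 < t) :
    ‖(((t / 2 : ℝ) : ℂ) + Complex.I * (s : ℂ))‖ ≤ t + s := by
  refine (norm_add_le _ _).trans ?_
  rw [norm_mul, Complex.norm_I, Complex.norm_real, Complex.norm_real, Real.norm_eq_abs,
    Real.norm_eq_abs, abs_of_pos hs, abs_of_pos (by linarith : 0 < t / 2)]
  linarith

lemma gI_norm (l : ℕ) (s t : ℝ) :
    ‖gI l s t‖ = Real.exp (-t) * Real.sqrt t *
      ‖(((t / 2 : ℝ) : ℂ) + Complex.I * (s : ℂ))‖ ^ (1 / 2 - l : ℝ) := by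
  unfold gI
  rw [norm_mul, norm_mul, Complex.norm_cpow_real, Complex.norm_real, Complex.norm_real,
    Real.norm_eq_abs, Real.norm_eq_abs, abs_of_pos (Real.exp_pos _),
    abs_of_nonneg (Real.sqrt_nonneg _)]

lemma gI_bound0 (s t : ℝ) (hs : 0 < s) (ht : 0 < t) :
    ‖gI 0 s t‖ ≤ Real.sqrt (1 + s) * (Real.exp (-t) * (1 + t)) := by
  rw [gI_norm]
  have e : (1 / 2 - ((0 : ℕ) : ℝ) : ℝ) = 1 / 2 := by norm_num
  rw [e, ← Real.sqrt_eq_rpow]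
  have h1 := Real.sqrt_le_sqrt (base_up s t hs ht)
  have h2 : Real.sqrt (t + s) ≤ Real.sqrt (1 + t) * Real.sqrt (1 + s) := by
    rw [← Real.sqrt_mul (by linarith)]
    apply Real.sqrt_le_sqrt
    nlinarith
  have h3 : Real.sqrt t ≤ Real.sqrt (1 + t) := Real.sqrt_le_sqrt (by linarith)
  have h4 : Real.sqrt (1 + t) * Real.sqrt (1 + t) = 1 + t := Real.mul_self_sqrt (by linarith)
  calc _ ≤ Real.exp (-t) * Real.sqrt (1 + t) * (Real.sqrt (1 + t) * Real.sqrt (1 + s)) := by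
        gcongr
        exact h1.trans h2
    _ = Real.sqrt (1 + s) * (Real.exp (-t) * (Real.sqrt (1 + t) * Real.sqrt (1 + t))) := by ring
    _ = _ := by rw [h4]

lemma gI_bound (l : ℕ) (s t : ℝ) (hs : 0 < s) (ht : 0 < t) :
    ‖gI (l + 1) s t‖ ≤ 4 ^ (l + 1) * (Real.exp (-t) * ((t + s) ^ l)⁻¹) := by
  rw [gI_norm]
  have hp : 0 < (t + s) / 4 := by positivity
  have hts : 0 < t + s := by positivity
  have h1 : ‖(((t / 2 : ℝ) : ℂ) + Complex.I * (s : ℂ))‖ ^ (1 / 2 - (l + 1 : ℕ) : ℝ)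
      ≤ ((t + s) / 4) ^ (1 / 2 - (l + 1 : ℕ) : ℝ) := by
    apply Real.rpow_le_rpow_of_nonpos hp (base_low s t hs ht)
    push_cast
    have : (0 : ℝ) ≤ l := by positivity
    linarith
  have h2 : ((t + s) / 4) ^ (1 / 2 - (l + 1 : ℕ) : ℝ)
      = Real.sqrt ((t + s) / 4) * (4 ^ (l + 1) * ((t + s) ^ (l + 1))⁻¹) := by
    rw [Real.rpow_sub hp, Real.rpow_natCast, ← Real.sqrt_eq_rpow, div_pow]
    field_simp
  have h3 : Real.sqrt t ≤ Real.sqrt (t + s) := Real.sqrt_le_sqrt (by linarith)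
  have h4 : Real.sqrt ((t + s) / 4) ≤ Real.sqrt (t + s) := Real.sqrt_le_sqrt (by linarith)
  have h5 : Real.sqrt (t + s) * Real.sqrt (t + s) = t + s := Real.mul_self_sqrt hts.le
  calc _ ≤ Real.exp (-t) * Real.sqrt (t + s) *
        (Real.sqrt (t + s) * (4 ^ (l + 1) * ((t + s) ^ (l + 1))⁻¹)) := by
        rw [h2] at h1
        gcongr
        exact h1.trans (by gcongr)
    _ = Real.exp (-t) * (Real.sqrt (t + s) * Real.sqrt (t + s)) *
        (4 ^ (l + 1) * ((t + s) ^ (l + 1))⁻¹) := by ring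
    _ = _ := by
      rw [h5, pow_succ (t + s)]
      field_simp

lemma int_exp : IntegrableOn (fun t : ℝ => Real.exp (-t)) (Set.Ioi 0) := integrableOn_exp_neg_Ioi 0

lemma int_exp1 : IntegrableOn (fun t : ℝ => Real.exp (-t) * (1 + t)) (Set.Ioi 0) := by
  have h := Real.GammaIntegral_convergent (s := 2) (by norm_num)
  have h2 := int_exp.add h
  refine h2.congr_fun (fun t ht => ?_) measurableSet_Ioi
  simp only [Pi.add_apply]
  norm_num
  ring

lemma gI_boundc (l : ℕ) (s s' t : ℝ) (hs : 0 < s) (hs' : s ≤ s') (ht : 0 < t) :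
    ‖gI (l + 1) s' t‖ ≤ 4 ^ (l + 1) * (s ^ l)⁻¹ * Real.exp (-t) := by
  refine (gI_bound l s' t (by linarith) ht).trans ?_
  have : ((t + s') ^ l)⁻¹ ≤ (s ^ l)⁻¹ := by
    gcongr
    linarith
  calc _ ≤ 4 ^ (l + 1) * (Real.exp (-t) * (s ^ l)⁻¹) := by gcongr
    _ = _ := by ring

lemma gI_int (l : ℕ) (s : ℝ) (hs : 0 < s) : IntegrableOn (gI l s) (Set.Ioi 0) := by
  cases l with
  | zero =>
    refine Integrable.mono' (int_exp1.const_mul (Real.sqrt (1 + s)))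
      (gI_meas 0 s).aestronglyMeasurable ?_
    filter_upwards [ae_restrict_mem measurableSet_Ioi] with t ht
    exact gI_bound0 s t hs ht
  | succ l =>
    refine Integrable.mono' (int_exp.const_mul (4 ^ (l + 1) * (s ^ l)⁻¹))
      (gI_meas _ s).aestronglyMeasurable ?_
    filter_upwards [ae_restrict_mem measurableSet_Ioi] with t ht
    exact gI_boundc l s s t hs le_rfl ht

lemma gI_deriv (l : ℕ) (s t : ℝ) (ht : 0 < t) :
    HasDerivAt (fun s => gI l s t) (((1 / 2 - l : ℝ) : ℂ) * Complex.I * gI (l + 1) s t) s := by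
  have h0 : HasDerivAt (fun s : ℝ => (((t / 2 : ℝ) : ℂ) + Complex.I * (s : ℂ))) Complex.I s := by
    have := ((Complex.ofRealCLM.hasDerivAt (x := s)).const_mul Complex.I).const_add ((t / 2 : ℝ) : ℂ)
    simpa using this
  have hsl : (((t / 2 : ℝ) : ℂ) + Complex.I * (s : ℂ)) ∈ Complex.slitPlane := by
    left
    simp
    exact ht
  have h1 := (HasDerivAt.comp s (Complex.hasStrictDerivAt_cpow_const
    (c := ((1 / 2 - l : ℝ) : ℂ)) hsl).hasDerivAt h0).const_mul
    (((Real.exp (-t) : ℝ) : ℂ) * ((Real.sqrt t : ℝ) : ℂ))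
  unfold gI
  refine h1.congr_deriv ?_
  have : (((1 / 2 - l : ℝ)) : ℂ) - 1 = (((1 / 2 - (l + 1 : ℕ) : ℝ)) : ℂ) := by
    push_cast
    ring
  rw [this]
  ring

lemma gF_deriv (l : ℕ) (s : ℝ) (hs : 0 < s) :
    HasDerivAt (gF l) (((1 / 2 - l : ℝ) : ℂ) * Complex.I * gF (l + 1) s) s := by
  have key := hasDerivAt_integral_of_dominated_loc_of_deriv_le (𝕜 := ℝ)
    (μ := volume.restrict (Set.Ioi (0 : ℝ))) (F := fun s t => gI l s t)
    (F' := fun s t => ((1 / 2 - l : ℝ) : ℂ) * Complex.I * gI (l + 1) s t) (x₀ := s)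
    (s := Set.Ioi (s / 2))
    (bound := fun t => ‖((1 / 2 - l : ℝ) : ℂ) * Complex.I‖ *
      (4 ^ (l + 1) * ((s / 2) ^ l)⁻¹ * Real.exp (-t)))
    (Ioi_mem_nhds (by linarith))
    (Filter.Eventually.of_forall fun s => (gI_meas l s).aestronglyMeasurable)
    (gI_int l s hs)
    (((gI_meas (l + 1) s).const_mul _).aestronglyMeasurable)
    (by
      filter_upwards [ae_restrict_mem measurableSet_Ioi] with t ht s' hs'
      rw [norm_mul]
      gcongr
      exact gI_boundc l (s / 2) s' t (by linarith) (le_of_lt hs') ht)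
    ((int_exp.const_mul _).const_mul _)
    (by
      filter_upwards [ae_restrict_mem measurableSet_Ioi] with t ht s' hs'
      exact gI_deriv l s' t ht)
  refine key.2.congr_deriv ?_
  rw [gF, ← integral_const_mul]

lemma gF_norm0 : ∃ M : ℝ, 0 ≤ M ∧ ∀ s, 0 < s → ‖gF 0 s‖ ≤ M * Real.sqrt (1 + s) := by
  refine ⟨∫ t in Set.Ioi (0 : ℝ), Real.exp (-t) * (1 + t), ?_, fun s hs => ?_⟩
  · apply setIntegral_nonneg measurableSet_Ioi
    intro t ht
    have : (0 : ℝ) < t := ht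
    positivity
  · rw [mul_comm, ← integral_const_mul]
    refine norm_integral_le_of_norm_le (int_exp1.const_mul _) ?_
    filter_upwards [ae_restrict_mem measurableSet_Ioi] with t ht
    exact gI_bound0 s t hs ht

lemma gF_norm1 (s : ℝ) (hs : 0 < s) : ‖gF 1 s‖ ≤ 4 := by
  have : (4 : ℝ) = ∫ t in Set.Ioi (0 : ℝ), 4 * Real.exp (-t) := by
    rw [integral_const_mul, integral_exp_neg_Ioi_zero]
    norm_num
  rw [this]
  refine norm_integral_le_of_norm_le (int_exp.const_mul _) ?_
  filter_upwards [ae_restrict_mem measurableSet_Ioi] with t ht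
  simpa using gI_boundc 0 s s t hs le_rfl ht

lemma gF_norm2 (s : ℝ) (hs : 0 < s) : ‖gF 2 s‖ ≤ 48 * (1 + |Real.log s|) := by
  have hu : Set.Ioi (0 : ℝ) = Set.Ioc 0 1 ∪ Set.Ioi 1 := by simp
  have hI := gI_int 2 s hs
  have hi1 : IntegrableOn (gI 2 s) (Set.Ioc 0 1) := hI.mono_set (by rw [hu]; exact Set.subset_union_left)
  have hi2 : IntegrableOn (gI 2 s) (Set.Ioi 1) := hI.mono_set (by rw [hu]; exact Set.subset_union_right)
  have e : gF 2 s = (∫ t in Set.Ioc (0 : ℝ) 1, gI 2 s t) + ∫ t in Set.Ioi (1 : ℝ), gI 2 s t := by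
    unfold gF
    rw [hu, setIntegral_union (Set.Ioc_disjoint_Ioi le_rfl) measurableSet_Ioi hi1 hi2]
  have b2 : ‖∫ t in Set.Ioi (1 : ℝ), gI 2 s t‖ ≤ ∫ t in Set.Ioi (1 : ℝ), 16 * Real.exp (-t) := by
    refine norm_integral_le_of_norm_le ((integrableOn_exp_neg_Ioi 1).const_mul _) ?_
    filter_upwards [ae_restrict_mem measurableSet_Ioi] with t ht
    have ht : (1 : ℝ) < t := ht
    refine (gI_bound 1 s t hs (by linarith)).trans ?_
    have : ((t + s) ^ 1)⁻¹ ≤ 1 := by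
      rw [pow_one]
      apply inv_le_one_of_one_le₀
      linarith
    calc _ ≤ (4 : ℝ) ^ (1 + 1) * (Real.exp (-t) * 1) := by gcongr
      _ = _ := by ring
  have c2 : ∫ t in Set.Ioi (1 : ℝ), 16 * Real.exp (-t) ≤ 16 := by
    rw [integral_const_mul, integral_exp_neg_Ioi]
    have : Real.exp (-1) ≤ 1 := Real.exp_le_one_iff.2 (by norm_num)
    linarith
  have hc : IntervalIntegrable (fun t : ℝ => 16 * (t + s)⁻¹) volume 0 1 := by
    apply ContinuousOn.intervalIntegrable
    rw [Set.uIcc_of_le zero_le_one]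
    refine continuousOn_const.mul (ContinuousOn.inv₀ (by fun_prop) ?_)
    intro t ht
    have := ht.1
    positivity
  have b1 : ‖∫ t in Set.Ioc (0 : ℝ) 1, gI 2 s t‖ ≤ ∫ t in Set.Ioc (0 : ℝ) 1, 16 * (t + s)⁻¹ := by
    refine norm_integral_le_of_norm_le ((intervalIntegrable_iff_integrableOn_Ioc_of_le zero_le_one).1 hc) ?_
    filter_upwards [ae_restrict_mem measurableSet_Ioc] with t ht
    have ht0 : (0 : ℝ) < t := ht.1
    refine (gI_bound 1 s t hs ht0).trans ?_
    have h1 : Real.exp (-t) ≤ 1 := Real.exp_le_one_iff.2 (by linarith)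
    calc _ ≤ (4 : ℝ) ^ (1 + 1) * (1 * ((t + s) ^ 1)⁻¹) := by gcongr
      _ = _ := by ring
  have c1 : ∫ t in Set.Ioc (0 : ℝ) 1, 16 * (t + s)⁻¹ = 16 * Real.log ((1 + s) / s) := by
    rw [← intervalIntegral.integral_of_le zero_le_one, intervalIntegral.integral_const_mul,
      intervalIntegral.integral_comp_add_right (fun t => t⁻¹),
      integral_inv_of_pos (by linarith) (by linarith)]
    simp
  have d1 : Real.log ((1 + s) / s) ≤ 1 + |Real.log s| := by
    have l2 : Real.log 2 ≤ 1 := by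
      have := Real.log_two_lt_d9
      linarith
    rcases le_total s 1 with h | h
    · rw [Real.log_div (by positivity) (by positivity)]
      have : Real.log (1 + s) ≤ Real.log 2 := Real.log_le_log (by positivity) (by linarith)
      have := neg_abs_le (Real.log s)
      linarith
    · have : Real.log ((1 + s) / s) ≤ Real.log 2 := by
        apply Real.log_le_log (by positivity)
        rw [div_le_iff₀ hs]
        linarith
      have := abs_nonneg (Real.log s)
      linarith
  rw [e]
  refine (norm_add_le _ _).trans ?_
  have := abs_nonneg (Real.log s)
  linarith

lemma int_inv_sq (s : ℝ) (hs : 0 < s) : IntegrableOn (fun t : ℝ => ((t + s) ^ 2)⁻¹) (Set.Ioi 0) ∧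
    ∫ t in Set.Ioi (0 : ℝ), ((t + s) ^ 2)⁻¹ = s⁻¹ := by
  have hd : ∀ x ∈ Set.Ici (0 : ℝ), HasDerivAt (fun t : ℝ => -(t + s)⁻¹) (((x + s) ^ 2)⁻¹) x := by
    intro x hx
    have hx : 0 ≤ x := hx
    have := (((hasDerivAt_id x).add_const s).inv (by simp; positivity)).neg
    refine this.congr_deriv ?_
    simp [neg_div]
  have ht : Filter.Tendsto (fun t : ℝ => -(t + s)⁻¹) Filter.atTop (nhds 0) := by
    have := (tendsto_inv_atTop_zero.comp
      (Filter.tendsto_atTop_add_const_right Filter.atTop s (Filter.tendsto_id (α := ℝ)))).neg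
    simpa using this
  have hp : ∀ x ∈ Set.Ioi (0 : ℝ), 0 ≤ ((x + s) ^ 2)⁻¹ := fun x _ => by positivity
  refine ⟨integrableOn_Ioi_deriv_of_nonneg' hd hp ht, ?_⟩
  rw [integral_Ioi_of_hasDerivAt_of_nonneg' hd hp ht]
  simp

lemma gF_norm3 (l : ℕ) (s : ℝ) (hs : 0 < s) : ‖gF (l + 3) s‖ ≤ 4 ^ (l + 3) * (s ^ (l + 1))⁻¹ := by
  have : (4 : ℝ) ^ (l + 3) * (s ^ (l + 1))⁻¹ =
      ∫ t in Set.Ioi (0 : ℝ), 4 ^ (l + 3) * (s ^ l)⁻¹ * ((t + s) ^ 2)⁻¹ := by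
    rw [integral_const_mul, (int_inv_sq s hs).2, pow_succ s]
    field_simp
  rw [this]
  refine norm_integral_le_of_norm_le ((int_inv_sq s hs).1.const_mul _) ?_
  filter_upwards [ae_restrict_mem measurableSet_Ioi] with t ht
  have ht : 0 < t := ht
  refine (gI_bound (l + 2) s t hs ht).trans ?_
  have h1 : Real.exp (-t) ≤ 1 := Real.exp_le_one_iff.2 (by linarith)
  have h2 : (s ^ l * (t + s) ^ 2) ≤ (t + s) ^ (l + 2) := by
    rw [pow_add]
    gcongr
    linarith
  calc _ ≤ (4 : ℝ) ^ (l + 2 + 1) * (1 * ((s ^ l * (t + s) ^ 2))⁻¹) := by gcongr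
    _ = _ := by
      rw [mul_inv]
      ring

lemma iter_formula (k : ℕ) : ∃ a : ℕ → ℂ, ∀ (d : ℂ) (r lam : ℝ), 0 < r → 0 < lam →
    iteratedDeriv k (fun lam : ℝ => d * (Complex.exp (-Complex.I * (lam : ℂ) * (r : ℂ)) *
      gF 0 (lam * r))) lam =
    d * ((r : ℂ) ^ k * (Complex.exp (-Complex.I * (lam : ℂ) * (r : ℂ)) *
      ∑ l ∈ Finset.range (k + 1), a l * gF l (lam * r))) := by
  induction k with
  | zero => exact ⟨fun _ => 1, fun d r lam _ _ => by simp⟩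
  | succ k ih =>
    obtain ⟨a, ha⟩ := ih
    refine ⟨fun l => (if l < k + 1 then -Complex.I * a l else 0) +
      (if l = 0 then 0 else a (l - 1) * (((1 / 2 - (l - 1 : ℕ) : ℝ) : ℂ) * Complex.I)), ?_⟩
    intro d r lam hr hl
    rw [iteratedDeriv_succ]
    have hev : iteratedDeriv k (fun lam : ℝ => d * (Complex.exp (-Complex.I * (lam : ℂ) * (r : ℂ)) *
        gF 0 (lam * r))) =ᶠ[nhds lam] fun lam => d * ((r : ℂ) ^ k *
        (Complex.exp (-Complex.I * (lam : ℂ) * (r : ℂ)) *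
        ∑ l ∈ Finset.range (k + 1), a l * gF l (lam * r))) := by
      filter_upwards [Ioi_mem_nhds hl] with y hy
      exact ha d r y hr hy
    rw [hev.deriv_eq]
    have he : HasDerivAt (fun lam : ℝ => Complex.exp (-Complex.I * (lam : ℂ) * (r : ℂ)))
        (Complex.exp (-Complex.I * (lam : ℂ) * (r : ℂ)) * (-Complex.I * r)) lam := by
      have := (((Complex.ofRealCLM.hasDerivAt (x := lam)).const_mul (-Complex.I)).mul_const (r : ℂ)).cexp
      simpa using this
    have hg : ∀ l, HasDerivAt (fun lam : ℝ => gF l (lam * r))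
        ((r : ℂ) * (((1 / 2 - l : ℝ) : ℂ) * Complex.I * gF (l + 1) (lam * r))) lam := by
      intro l
      have h1 : HasDerivAt (fun lam : ℝ => lam * r) r lam := by
        simpa using (hasDerivAt_id lam).mul_const r
      have := HasDerivAt.scomp lam (gF_deriv l (lam * r) (by positivity)) h1
      simpa [Function.comp_def] using this
    have hs : HasDerivAt (fun lam : ℝ => ∑ l ∈ Finset.range (k + 1), a l * gF l (lam * r))
        (∑ l ∈ Finset.range (k + 1),
          a l * ((r : ℂ) * (((1 / 2 - l : ℝ) : ℂ) * Complex.I * gF (l + 1) (lam * r)))) lam :=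
      HasDerivAt.fun_sum fun l _ => (hg l).const_mul (a l)
    rw [(((he.fun_mul hs).const_mul ((r : ℂ) ^ k)).const_mul d).deriv]
    have s1 : ∑ l ∈ Finset.range (k + 1 + 1), (if l < k + 1 then -Complex.I * a l else 0) * gF l (lam * r)
        = -Complex.I * ∑ l ∈ Finset.range (k + 1), a l * gF l (lam * r) := by
      rw [Finset.sum_range_succ, Finset.mul_sum]
      simp only [lt_irrefl, if_false, zero_mul, add_zero]
      refine Finset.sum_congr rfl fun l hl => ?_
      rw [if_pos (Finset.mem_range.1 hl)]
      ring
    have s2 : (r : ℂ) * ∑ l ∈ Finset.range (k + 1 + 1), (if l = 0 then 0 else a (l - 1) *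
          (((1 / 2 - (l - 1 : ℕ) : ℝ) : ℂ) * Complex.I)) * gF l (lam * r)
        = ∑ l ∈ Finset.range (k + 1),
          a l * ((r : ℂ) * (((1 / 2 - l : ℝ) : ℂ) * Complex.I * gF (l + 1) (lam * r))) := by
      rw [Finset.sum_range_succ']
      simp only [if_true, zero_mul, mul_zero, add_zero]
      rw [Finset.mul_sum]
      refine Finset.sum_congr rfl fun l hl => ?_
      simp only [Nat.add_eq_zero_iff, one_ne_zero, and_false, if_false, Nat.add_sub_cancel]
      ring
    simp only [add_mul, Finset.sum_add_distrib]
    rw [s1, ← s2]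
    ring

lemma rp (r p q : ℝ) (hr : 0 < r) (hp : 0 ≤ p) (hq : p ≤ q) : r ^ p ≤ (1 + r ^ 2) ^ (q / 2) := by
  have h1 : r ^ p = (r ^ 2) ^ (p / 2) := by
    rw [← Real.rpow_natCast, ← Real.rpow_mul hr.le]
    congr 1
    push_cast
    ring
  rw [h1]
  calc (r ^ 2) ^ (p / 2) ≤ (1 + r ^ 2) ^ (p / 2) := by
        gcongr
        linarith
    _ ≤ _ := by
        apply Real.rpow_le_rpow_of_exponent_le
        · nlinarith
        · linarith

lemma rpn (r : ℝ) (j m : ℕ) (hr : 0 < r) (h : m ≤ j) :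
    r ^ m ≤ (1 + r ^ 2) ^ (((1 : ℝ) / 2 + j) / 2) := by
  rw [← Real.rpow_natCast]
  have : (m : ℝ) ≤ j := by exact_mod_cast h
  exact rp r m _ hr (by positivity) (by linarith)

lemma rps (r : ℝ) (j : ℕ) (hr : 0 < r) :
    r ^ j * Real.sqrt r ≤ (1 + r ^ 2) ^ (((1 : ℝ) / 2 + j) / 2) := by
  rw [Real.sqrt_eq_rpow, ← Real.rpow_natCast, ← Real.rpow_add hr]
  exact rp r _ _ hr (by positivity) (by linarith)

lemma gB01 (Λ : ℝ) (hΛ : 1 < Λ) (j l : ℕ) (hl : l ≤ 1) :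
    ∃ K : ℝ, 0 ≤ K ∧ ∀ lam r : ℝ, Λ⁻¹ < lam → lam < Λ → 0 < r →
      r ^ j * ‖gF l (lam * r)‖ ≤ K * (1 + r ^ 2) ^ (((1 : ℝ) / 2 + j) / 2) := by
  have hΛ0 : 0 < Λ⁻¹ := by positivity
  obtain rfl | rfl : l = 0 ∨ l = 1 := by omega
  · obtain ⟨M, hM, h⟩ := gF_norm0
    refine ⟨M * Real.sqrt Λ * 2, by positivity, fun lam r h1 h2 hr => ?_⟩
    have hl0 := hΛ0.trans h1
    have b1 : Real.sqrt (1 + lam * r) ≤ Real.sqrt Λ * (1 + Real.sqrt r) := by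
      rw [Real.sqrt_le_left (by positivity), mul_pow, Real.sq_sqrt (by positivity)]
      have e := Real.sq_sqrt hr.le
      have := Real.sqrt_nonneg r
      have : lam * r ≤ Λ * r := by gcongr
      have : 0 ≤ Λ * Real.sqrt r := by positivity
      have : Λ * (1 + Real.sqrt r) ^ 2 = Λ + 2 * (Λ * Real.sqrt r) + Λ * Real.sqrt r ^ 2 := by ring
      rw [e] at this
      linarith
    calc _ ≤ r ^ j * (M * (Real.sqrt Λ * (1 + Real.sqrt r))) := by
          gcongr
          exact (h _ (by positivity)).trans (by gcongr)
      _ = M * Real.sqrt Λ * (r ^ j + r ^ j * Real.sqrt r) := by ring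
      _ ≤ M * Real.sqrt Λ * ((1 + r ^ 2) ^ (((1 : ℝ) / 2 + j) / 2) +
          (1 + r ^ 2) ^ (((1 : ℝ) / 2 + j) / 2)) := by
          gcongr
          · exact rpn r j j hr le_rfl
          · exact rps r j hr
      _ = _ := by ring
  · refine ⟨4, by norm_num, fun lam r h1 h2 hr => ?_⟩
    have hl0 := hΛ0.trans h1
    have := gF_norm1 (lam * r) (by positivity)
    calc _ ≤ (1 + r ^ 2) ^ (((1 : ℝ) / 2 + j) / 2) * 4 := by
          gcongr
          exact rpn r j j hr le_rfl
      _ = _ := by ring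

lemma log_bd (r : ℝ) (j : ℕ) (hr : 0 < r) :
    r ^ j * |Real.log r| ≤ 2 * (1 + r ^ 2) ^ (((1 : ℝ) / 2 + j) / 2) + |Real.log r| := by
  rcases le_total r 1 with h | h
  · have : r ^ j ≤ 1 := pow_le_one₀ hr.le h
    have : r ^ j * |Real.log r| ≤ 1 * |Real.log r| := by gcongr
    have : 0 ≤ (1 + r ^ 2) ^ (((1 : ℝ) / 2 + j) / 2) := by positivity
    linarith
  · have h1 := Real.log_le_rpow_div hr.le (ε := 1 / 2) (by norm_num)
    rw [← Real.sqrt_eq_rpow] at h1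
    have h2 := rps r j hr
    have h3 := abs_nonneg (Real.log r)
    have h4 : |Real.log r| ≤ 2 * Real.sqrt r := by
      rw [abs_of_nonneg (Real.log_nonneg h)]
      linarith
    calc _ ≤ r ^ j * (2 * Real.sqrt r) := by gcongr
      _ = 2 * (r ^ j * Real.sqrt r) := by ring
      _ ≤ _ := by linarith

lemma gB_s5 (Λ : ℝ) (hΛ : 1 < Λ) (j l : ℕ) (hl : l ≤ j + 2) :
    ∃ K : ℝ, 0 ≤ K ∧ ∀ lam r : ℝ, Λ⁻¹ < lam → lam < Λ → 0 < r →
      r ^ j * ‖gF l (lam * r)‖ ≤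
        K * ((1 + r ^ 2) ^ (((1 : ℝ) / 2 + j) / 2) + |Real.log r|) := by
  have hΛ0 : 0 < Λ⁻¹ := by positivity
  by_cases h1 : l ≤ 1
  · obtain ⟨K, hK, h⟩ := gB01 Λ hΛ j l h1
    refine ⟨K, hK, fun lam r h1 h2 hr => (h lam r h1 h2 hr).trans ?_⟩
    gcongr
    linarith [abs_nonneg (Real.log r)]
  by_cases h2 : l = 2
  · subst h2
    have hlΛ : 0 < Real.log Λ := Real.log_pos hΛ
    refine ⟨48 * (3 + Real.log Λ), by positivity, fun lam r h1 h2 hr => ?_⟩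
    have hl0 := hΛ0.trans h1
    have b := gF_norm2 (lam * r) (by positivity)
    have c : |Real.log (lam * r)| ≤ Real.log Λ + |Real.log r| := by
      rw [Real.log_mul hl0.ne' hr.ne']
      refine (abs_add_le _ _).trans ?_
      gcongr
      rw [abs_le]
      constructor
      · rw [← Real.log_inv]
        exact Real.log_le_log hΛ0 h1.le
      · exact Real.log_le_log hl0 h2.le
    have d := log_bd r j hr
    have e := rpn r j j hr le_rfl
    set W := (1 + r ^ 2) ^ (((1 : ℝ) / 2 + j) / 2)
    have hL := abs_nonneg (Real.log r)
    calc _ ≤ r ^ j * (48 * (1 + (Real.log Λ + |Real.log r|))) := by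
          gcongr
          exact b.trans (by gcongr)
      _ = 48 * ((1 + Real.log Λ) * r ^ j + r ^ j * |Real.log r|) := by ring
      _ ≤ 48 * ((1 + Real.log Λ) * W + (2 * W + |Real.log r|)) := by gcongr
      _ ≤ _ := by nlinarith
  · obtain ⟨m, rfl⟩ : ∃ m, l = m + 3 := ⟨l - 3, by omega⟩
    refine ⟨4 ^ (m + 3) * Λ ^ (m + 1), by positivity, fun lam r h1 h2 hr => ?_⟩
    have hl0 := hΛ0.trans h1
    have b := gF_norm3 m (lam * r) (by positivity)
    obtain ⟨n, rfl⟩ : ∃ n, j = n + (m + 1) := ⟨j - (m + 1), by omega⟩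
    have e := rpn r (n + (m + 1)) n hr (by omega)
    have hi : (lam ^ (m + 1))⁻¹ ≤ Λ ^ (m + 1) := by
      rw [← inv_pow]
      gcongr
      exact inv_le_of_inv_le₀ (by linarith) h1.le
    calc _ ≤ r ^ (n + (m + 1)) * (4 ^ (m + 3) * ((lam * r) ^ (m + 1))⁻¹) := by gcongr
      _ = 4 ^ (m + 3) * (lam ^ (m + 1))⁻¹ * r ^ n := by
          rw [pow_add r, mul_pow]
          field_simp
      _ ≤ 4 ^ (m + 3) * Λ ^ (m + 1) * r ^ n := by gcongr
      _ ≤ _ := by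
          gcongr
          linarith [abs_nonneg (Real.log r)]

def gc : ℝ := 2 * (2 * Real.pi) ^ ((3 : ℝ) / 2) * Real.Gamma (3 / 2)

lemma gc_pos : 0 < gc := by
  unfold gc
  have := Real.Gamma_pos_of_pos (s := 3 / 2) (by norm_num)
  have := Real.pi_pos
  positivity

lemma G_eq_s5 (lam : ℝ) (x : R4) : G (-lam) x = ((gc * ‖x‖ ^ 2 : ℝ) : ℂ)⁻¹ *
    (Complex.exp (-Complex.I * (lam : ℂ) * (‖x‖ : ℂ)) * gF 0 (lam * ‖x‖)) := by
  unfold G gF gI gc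
  have h : ∀ t : ℝ, (((t / 2 : ℝ) : ℂ) - Complex.I * ((-lam : ℝ) : ℂ) * (‖x‖ : ℂ)) ^ ((1 : ℂ) / 2)
      = (((t / 2 : ℝ) : ℂ) + Complex.I * ((lam * ‖x‖ : ℝ) : ℂ)) ^
        (((1 / 2 - (0 : ℕ) : ℝ)) : ℂ) := by
    intro t
    congr 1
    · push_cast
      ring
    · simp
  simp only [h]
  have h2 : Complex.I * ((-lam : ℝ) : ℂ) * (‖x‖ : ℂ) = -Complex.I * (lam : ℂ) * (‖x‖ : ℂ) := by
    push_cast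
    ring
  rw [h2, div_eq_mul_inv]
  ring

lemma nexp (lam r : ℝ) : ‖Complex.exp (-Complex.I * (lam : ℂ) * (r : ℂ))‖ = 1 := by
  rw [Complex.norm_exp]
  simp

lemma nd (r : ℝ) : ‖((gc * r ^ 2 : ℝ) : ℂ)⁻¹‖ = gc⁻¹ * (r ^ 2)⁻¹ := by
  have := gc_pos
  rw [norm_inv, Complex.norm_real, Real.norm_eq_abs, abs_of_nonneg (by positivity), mul_inv]

/-- Bounds for `𝒢_{-λ}(x)` and its `λ`-derivatives for `λ ∈ (Λ⁻¹, Λ)`. -/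
theorem stmt_5 (Λ : ℝ) (hΛ : 1 < Λ) :
    ∃ C : ℝ, 0 < C ∧
      ((∀ (lam : ℝ) (x : R4), Λ⁻¹ < lam → lam < Λ → x ≠ 0 →
          ‖G (-lam) x‖ ≤ C * (1 + ‖x‖ ^ 2) ^ ((1 : ℝ) / 4) * (‖x‖ ^ 2)⁻¹ ∧
          ‖deriv (fun lam : ℝ => G (-lam) x) lam‖ ≤
            C * (1 + ‖x‖ ^ 2) ^ ((1 : ℝ) / 4) * ‖x‖⁻¹) ∧
        ∀ j : ℕ, ∃ Cj : ℝ, 0 < Cj ∧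
          ∀ (lam : ℝ) (x : R4), Λ⁻¹ < lam → lam < Λ → x ≠ 0 →
            ‖iteratedDeriv (2 + j) (fun lam : ℝ => G (-lam) x) lam‖ ≤
              Cj * ((1 + ‖x‖ ^ 2) ^ (((1 : ℝ) / 2 + j) / 2) + |Real.log ‖x‖|)) := by
  obtain ⟨K0, hK0, h0⟩ := gB01 Λ hΛ 0 0 (by norm_num)
  obtain ⟨K1, hK1, h1⟩ := gB01 Λ hΛ 0 1 (by norm_num)
  obtain ⟨a, ha⟩ := iter_formula 1
  have hΛ0 : 0 < Λ⁻¹ := by positivity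
  have hc : 0 < gc := gc_pos
  refine ⟨gc⁻¹ * (1 + K0 + (‖a 0‖ * K0 + ‖a 1‖ * K1)), by positivity, ?_, ?_⟩
  · intro lam x hl1 hl2 hx
    have hr : 0 < ‖x‖ := norm_pos_iff.2 hx
    have b0 := h0 lam ‖x‖ hl1 hl2 hr
    have b1 := h1 lam ‖x‖ hl1 hl2 hr
    have ee : (((1 : ℝ) / 2 + ((0 : ℕ) : ℝ)) / 2) = 1 / 4 := by norm_num
    rw [ee, pow_zero, one_mul] at b0 b1
    set W := (1 + ‖x‖ ^ 2) ^ ((1 : ℝ) / 4) with hW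
    have hWp : 0 < W := by positivity
    constructor
    · rw [G_eq_s5, norm_mul, norm_mul, nexp, one_mul, nd]
      calc _ ≤ gc⁻¹ * (‖x‖ ^ 2)⁻¹ * (K0 * W) := by gcongr
        _ = gc⁻¹ * K0 * W * (‖x‖ ^ 2)⁻¹ := by ring
        _ ≤ _ := by
          gcongr
          have : 0 ≤ ‖a 0‖ * K0 + ‖a 1‖ * K1 := by positivity
          linarith
    · simp only [G_eq_s5]
      have := ha (((gc * ‖x‖ ^ 2 : ℝ) : ℂ)⁻¹) ‖x‖ lam hr (hΛ0.trans hl1)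
      rw [iteratedDeriv_one] at this
      rw [this, norm_mul, norm_mul, norm_mul, nexp, one_mul, nd, pow_one, Complex.norm_real,
        norm_norm, Finset.sum_range_succ, Finset.sum_range_one]
      have hs : ‖a 0 * gF 0 (lam * ‖x‖) + a 1 * gF 1 (lam * ‖x‖)‖ ≤
          (‖a 0‖ * K0 + ‖a 1‖ * K1) * W := by
        refine (norm_add_le _ _).trans ?_
        rw [norm_mul, norm_mul]
        calc _ ≤ ‖a 0‖ * (K0 * W) + ‖a 1‖ * (K1 * W) := by gcongr
          _ = _ := by ring
      calc _ ≤ gc⁻¹ * (‖x‖ ^ 2)⁻¹ * (‖x‖ * ((‖a 0‖ * K0 + ‖a 1‖ * K1) * W)) := by gcongr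
        _ = gc⁻¹ * (‖a 0‖ * K0 + ‖a 1‖ * K1) * W * ‖x‖⁻¹ := by
          field_simp
        _ ≤ _ := by
          have : ‖a 0‖ * K0 + ‖a 1‖ * K1 ≤ 1 + K0 + (‖a 0‖ * K0 + ‖a 1‖ * K1) := by linarith
          exact mul_le_mul_of_nonneg_right (mul_le_mul_of_nonneg_right
            (mul_le_mul_of_nonneg_left this (by positivity)) hWp.le) (by positivity)
  · intro j
    obtain ⟨b, hb⟩ := iter_formula (2 + j)
    have hK : ∀ l : ℕ, ∃ K : ℝ, 0 ≤ K ∧ (l ≤ j + 2 → ∀ lam r : ℝ, Λ⁻¹ < lam → lam < Λ → 0 < r →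
        r ^ j * ‖gF l (lam * r)‖ ≤
          K * ((1 + r ^ 2) ^ (((1 : ℝ) / 2 + j) / 2) + |Real.log r|)) := by
      intro l
      by_cases hl : l ≤ j + 2
      · obtain ⟨K, hK, h⟩ := gB_s5 Λ hΛ j l hl
        exact ⟨K, hK, fun _ => h⟩
      · exact ⟨0, le_rfl, fun h => absurd h hl⟩
    choose K hKp hKb using hK
    refine ⟨gc⁻¹ * (1 + ∑ l ∈ Finset.range (2 + j + 1), ‖b l‖ * K l), ?_, ?_⟩
    · have : 0 ≤ ∑ l ∈ Finset.range (2 + j + 1), ‖b l‖ * K l :=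
        Finset.sum_nonneg fun l _ => mul_nonneg (norm_nonneg _) (hKp l)
      positivity
    · intro lam x hl1 hl2 hx
      have hr : 0 < ‖x‖ := norm_pos_iff.2 hx
      simp only [G_eq_s5]
      rw [hb _ ‖x‖ lam hr (hΛ0.trans hl1), norm_mul, norm_mul, norm_mul, nexp, one_mul, nd,
        norm_pow, Complex.norm_real, norm_norm]
      set W := (1 + ‖x‖ ^ 2) ^ (((1 : ℝ) / 2 + j) / 2) + |Real.log ‖x‖| with hW
      have hWp : 0 ≤ W := by positivity
      have hs : ‖x‖ ^ j * ‖∑ l ∈ Finset.range (2 + j + 1), b l * gF l (lam * ‖x‖)‖ ≤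
          (∑ l ∈ Finset.range (2 + j + 1), ‖b l‖ * K l) * W := by
        calc _ ≤ ‖x‖ ^ j * ∑ l ∈ Finset.range (2 + j + 1), ‖b l * gF l (lam * ‖x‖)‖ := by
              gcongr
              exact norm_sum_le _ _
          _ = ∑ l ∈ Finset.range (2 + j + 1), ‖b l‖ * (‖x‖ ^ j * ‖gF l (lam * ‖x‖)‖) := by
              rw [Finset.mul_sum]
              refine Finset.sum_congr rfl fun l _ => ?_
              rw [norm_mul]
              ring
          _ ≤ ∑ l ∈ Finset.range (2 + j + 1), ‖b l‖ * (K l * W) := by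
              refine Finset.sum_le_sum fun l hl => ?_
              have := Finset.mem_range.1 hl
              exact mul_le_mul_of_nonneg_left (hKb l (by omega) lam ‖x‖ hl1 hl2 hr) (norm_nonneg _)
          _ = _ := by
              rw [Finset.sum_mul]
              refine Finset.sum_congr rfl fun l _ => ?_
              ring
      calc _ = gc⁻¹ * (‖x‖ ^ j * ‖∑ l ∈ Finset.range (2 + j + 1), b l * gF l (lam * ‖x‖)‖) := by
            rw [pow_add]
            field_simp
        _ ≤ gc⁻¹ * ((∑ l ∈ Finset.range (2 + j + 1), ‖b l‖ * K l) * W) := by gcongr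
        _ ≤ gc⁻¹ * ((1 + ∑ l ∈ Finset.range (2 + j + 1), ‖b l‖ * K l) * W) := by
            gcongr
            linarith
        _ = _ := by ring
end
end

section
/- For every Λ > 0 there exists a constant C > 0 such that for all λ with 0 < λ ≤ Λ and all x ∈ ℝ⁴ ∖ {0}: |𝒢_λ(x) − (4π² |x|²)^{-1}| ≤ C λ² ⟨log λ⟩ (|x|^{1/2} + ⟨log |x|⟩). -/
open MeasureTheory Complex
open scoped ENNReal

noncomputable section

/-- `⟨s⟩ = (1+s²)^{1/2}` for a real number `s`. -/
def jb (s : ℝ) : ℝ := Real.sqrt (1 + s ^ 2)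

lemma aux_pt (s t : ℝ) (hs : 0 < s) (ht : 0 < t) :
    ‖((Real.sqrt t : ℝ) : ℂ) * (((t / 2 : ℝ) : ℂ) - Complex.I * (s : ℂ)) ^ ((1 : ℂ) / 2)
      - ((t : ℂ) - Complex.I * s) / ((Real.sqrt 2 : ℝ) : ℂ)‖ ≤ Real.sqrt 2 * s ^ 2 / (s + t) := by
  set W : ℂ := (((t / 2 : ℝ) : ℂ) - Complex.I * (s : ℂ)) ^ ((1 : ℂ) / 2) with hW
  have hW2 : W ^ 2 = ((t / 2 : ℝ) : ℂ) - Complex.I * (s : ℂ) := by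
    rw [hW, one_div]
    exact Complex.cpow_ofNat_inv_pow _ 2
  have hre : 0 ≤ W.re := by
    rw [hW, one_div, Complex.cpow_inv_two_re]
    positivity
  obtain ⟨p, hp⟩ : ∃ p, p = Real.sqrt 2 := ⟨_, rfl⟩
  obtain ⟨q, hq⟩ : ∃ q, q = Real.sqrt t := ⟨_, rfl⟩
  rw [← hp, ← hq]
  have hp0 : 0 < p := by rw [hp]; positivity
  have hq0 : 0 < q := by rw [hq]; positivity
  have hp2 : p ^ 2 = 2 := by rw [hp]; exact Real.sq_sqrt (by norm_num)
  have hq2 : q ^ 2 = t := by rw [hq]; exact Real.sq_sqrt ht.le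
  have hp2c : (p : ℂ) ^ 2 = 2 := by exact_mod_cast hp2
  have hq2c : (q : ℂ) ^ 2 = t := by exact_mod_cast hq2
  have hpc : (p : ℂ) ≠ 0 := by exact_mod_cast hp0.ne'
  obtain ⟨V, hV⟩ : ∃ V : ℂ, V = p * W := ⟨_, rfl⟩
  have hV2 : V ^ 2 = (t : ℂ) - 2 * Complex.I * s := by
    rw [hV, mul_pow, hp2c, hW2]; push_cast; ring
  have hVre : 0 ≤ V.re := by rw [hV, Complex.re_ofReal_mul]; positivity
  have hnV : 2 * s ≤ ‖V‖ ^ 2 := by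
    rw [← norm_pow, hV2]
    have := Complex.abs_im_le_norm ((t : ℂ) - 2 * Complex.I * s)
    simp [abs_of_pos hs] at this
    simpa using this
  have hsum : 2 * s + t ≤ ‖V + q‖ ^ 2 := by
    have e1 := Complex.sq_norm (V + q)
    have e2 := Complex.sq_norm V
    rw [Complex.normSq_apply] at e1 e2
    simp only [Complex.add_re, Complex.add_im, Complex.ofReal_re, Complex.ofReal_im] at e1
    nlinarith [mul_nonneg hVre hq0.le]
  have hne : V + q ≠ 0 := by
    intro h
    rw [h] at hsum
    simp at hsum
    linarith
  have key : (q : ℂ) * W - ((t : ℂ) - Complex.I * s) / p = 2 * s ^ 2 / (p * (V + q) ^ 2) := by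
    have h1 : (q : ℂ) * W - ((t : ℂ) - Complex.I * s) / p = - (V - q) ^ 2 / (2 * p) := by
      field_simp
      linear_combination (2 * q : ℂ) * (-hV) + hV2 + hq2c
    have h2 : (V - q) * (V + q) = - 2 * Complex.I * s := by
      linear_combination hV2 - hq2c
    rw [h1, div_eq_div_iff (by simpa using hpc) (mul_ne_zero hpc (pow_ne_zero 2 hne))]
    have h3 : ((V - q) * (V + q)) ^ 2 = - 4 * s ^ 2 := by
      rw [h2]; linear_combination (4 * s ^ 2 : ℂ) * Complex.I_sq
    linear_combination (- p : ℂ) * h3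
  rw [key]
  have hs2 : ‖(2 * (s : ℂ) ^ 2)‖ = 2 * s ^ 2 := by simp
  rw [norm_div, hs2, norm_mul, norm_pow, Complex.norm_real, Real.norm_of_nonneg hp0.le,
    div_le_div_iff₀ (by positivity) (by positivity)]
  have : p * s ^ 2 * (p * ‖V + q‖ ^ 2) = 2 * s ^ 2 * ‖V + q‖ ^ 2 := by
    rw [← hp2]; ring
  rw [this]
  gcongr
  linarith

lemma aux_meas (s : ℝ) : AEStronglyMeasurable (fun t : ℝ =>
      ((Real.exp (-t) : ℝ) : ℂ) * ((Real.sqrt t : ℝ) : ℂ) *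
        (((t / 2 : ℝ) : ℂ) - Complex.I * (s : ℂ)) ^ ((1 : ℂ) / 2))
      (volume.restrict (Set.Ioi (0 : ℝ))) := by
  apply Measurable.aestronglyMeasurable
  fun_prop

lemma aux_main (s : ℝ) :
    IntegrableOn (fun t : ℝ => ((Real.exp (-t) : ℝ) : ℂ) *
      (((t : ℂ) - Complex.I * s) / ((Real.sqrt 2 : ℝ) : ℂ))) (Set.Ioi 0) ∧
    ∫ t in Set.Ioi (0 : ℝ), ((Real.exp (-t) : ℝ) : ℂ) *
      (((t : ℂ) - Complex.I * s) / ((Real.sqrt 2 : ℝ) : ℂ)) =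
      (1 - Complex.I * s) / ((Real.sqrt 2 : ℝ) : ℂ) := by
  have i1 : IntegrableOn (fun t : ℝ => Real.exp (-t)) (Set.Ioi 0) := integrableOn_exp_neg_Ioi 0
  have i2 : IntegrableOn (fun t : ℝ => Real.exp (-t) * t) (Set.Ioi 0) := by
    have := Real.GammaIntegral_convergent (s := 2) (by norm_num)
    norm_num at this
    exact this
  have v1 : ∫ t in Set.Ioi (0 : ℝ), Real.exp (-t) = 1 := integral_exp_neg_Ioi_zero
  have v2 : ∫ t in Set.Ioi (0 : ℝ), Real.exp (-t) * t = 1 := by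
    have := Real.Gamma_eq_integral (s := 2) (by norm_num)
    rw [Real.Gamma_two] at this
    norm_num at this
    exact this.symm
  have e : (fun t : ℝ => ((Real.exp (-t) : ℝ) : ℂ) *
      (((t : ℂ) - Complex.I * s) / ((Real.sqrt 2 : ℝ) : ℂ))) = fun t : ℝ =>
      (((Real.exp (-t) * t : ℝ) : ℂ) - ((Real.exp (-t) : ℝ) : ℂ) * (Complex.I * s)) /
        ((Real.sqrt 2 : ℝ) : ℂ) := by
    ext t; push_cast; ring
  have j1 : IntegrableOn (fun t : ℝ => ((Real.exp (-t) : ℝ) : ℂ) * (Complex.I * s)) (Set.Ioi 0) :=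
    (Integrable.ofReal i1).mul_const _
  have j2 : IntegrableOn (fun t : ℝ => ((Real.exp (-t) * t : ℝ) : ℂ)) (Set.Ioi 0) :=
    Integrable.ofReal i2
  rw [e]
  refine ⟨(j2.sub j1).div_const _, ?_⟩
  rw [integral_div, integral_sub j2 j1, integral_mul_const, integral_complex_ofReal,
    integral_complex_ofReal, v1, v2]
  simp

lemma aux_log (s : ℝ) (hs : 0 < s) :
    IntegrableOn (fun t : ℝ => Real.exp (-t) / (s + t)) (Set.Ioi 0) ∧
    ∫ t in Set.Ioi (0 : ℝ), Real.exp (-t) / (s + t) ≤ 2 + |Real.log s| := by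
  have i1 : IntegrableOn (fun t : ℝ => Real.exp (-t)) (Set.Ioi 0) := integrableOn_exp_neg_Ioi 0
  have hi : IntegrableOn (fun t : ℝ => Real.exp (-t) / (s + t)) (Set.Ioi 0) := by
    refine Integrable.mono' (i1.div_const s) (Measurable.aestronglyMeasurable (by fun_prop)) ?_
    filter_upwards [ae_restrict_mem measurableSet_Ioi] with t ht
    have ht : 0 < t := ht
    rw [Real.norm_of_nonneg (by positivity)]
    gcongr
    linarith
  refine ⟨hi, ?_⟩
  have hsp : Set.Ioi (0 : ℝ) = Set.Ioc 0 1 ∪ Set.Ioi 1 := by simp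
  have ha : IntegrableOn (fun t : ℝ => Real.exp (-t) / (s + t)) (Set.Ioc 0 1) :=
    hi.mono_set Set.Ioc_subset_Ioi_self
  have hb : IntegrableOn (fun t : ℝ => Real.exp (-t) / (s + t)) (Set.Ioi 1) :=
    hi.mono_set (Set.Ioi_subset_Ioi zero_le_one)
  rw [hsp, setIntegral_union (Set.Ioc_disjoint_Ioi le_rfl) measurableSet_Ioi ha hb]
  have hB : ∫ t in Set.Ioi (1 : ℝ), Real.exp (-t) / (s + t) ≤ Real.exp (-1) := by
    rw [← integral_exp_neg_Ioi 1]
    refine setIntegral_mono_on hb (integrableOn_exp_neg_Ioi 1) measurableSet_Ioi ?_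
    intro t ht
    have ht : 1 < t := ht
    exact div_le_self (by positivity) (by linarith)
  have hc : IntervalIntegrable (fun t : ℝ => (s + t)⁻¹) volume 0 1 := by
    apply ContinuousOn.intervalIntegrable
    apply ContinuousOn.inv₀ (by fun_prop)
    intro t ht
    rw [Set.uIcc_of_le zero_le_one] at ht
    have := ht.1
    positivity
  have hA : ∫ t in Set.Ioc (0 : ℝ) 1, Real.exp (-t) / (s + t) ≤ Real.log ((s + 1) / s) := by
    have : ∫ t in (0 : ℝ)..1, (s + t)⁻¹ = Real.log ((s + 1) / s) := by
      rw [intervalIntegral.integral_comp_add_left (fun x : ℝ => x⁻¹) s]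
      rw [integral_inv_of_pos (by linarith) (by linarith), add_zero]
    rw [← this, intervalIntegral.integral_of_le zero_le_one]
    refine setIntegral_mono_on ha
      ((intervalIntegrable_iff_integrableOn_Ioc_of_le zero_le_one).1 hc) measurableSet_Ioc ?_
    intro t ht
    have ht1 := ht.1
    rw [div_eq_mul_inv]
    exact mul_le_of_le_one_left (by positivity) (Real.exp_le_one_iff.2 (by linarith))
  have hexp : Real.exp (-1) ≤ 1 := Real.exp_le_one_iff.2 (by norm_num)
  have hl : Real.log ((s + 1) / s) ≤ 1 + |Real.log s| := by
    have hl2 : Real.log 2 ≤ 1 := by linarith [Real.log_two_lt_d9]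
    rcases le_total s 1 with h | h
    · rw [Real.log_div (by positivity) hs.ne']
      have : Real.log (s + 1) ≤ Real.log 2 := Real.log_le_log (by positivity) (by linarith)
      linarith [neg_le_abs (Real.log s)]
    · have : Real.log ((s + 1) / s) ≤ Real.log 2 := by
        apply Real.log_le_log (by positivity)
        rw [div_le_iff₀ hs]; linarith
      linarith [abs_nonneg (Real.log s)]
  linarith

lemma aux_H (s : ℝ) (hs : 0 < s) :
    ‖(∫ t in Set.Ioi (0 : ℝ),
      ((Real.exp (-t) : ℝ) : ℂ) * ((Real.sqrt t : ℝ) : ℂ) *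
        (((t / 2 : ℝ) : ℂ) - Complex.I * (s : ℂ)) ^ ((1 : ℂ) / 2))
      - (1 - Complex.I * s) / ((Real.sqrt 2 : ℝ) : ℂ)‖ ≤
      Real.sqrt 2 * s ^ 2 * (2 + |Real.log s|) := by
  obtain ⟨im, vm⟩ := aux_main s
  obtain ⟨il, vl⟩ := aux_log s hs
  set f : ℝ → ℂ := fun t : ℝ =>
      ((Real.exp (-t) : ℝ) : ℂ) * ((Real.sqrt t : ℝ) : ℂ) *
        (((t / 2 : ℝ) : ℂ) - Complex.I * (s : ℂ)) ^ ((1 : ℂ) / 2) with hf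
  set m : ℝ → ℂ := fun t : ℝ => ((Real.exp (-t) : ℝ) : ℂ) *
      (((t : ℂ) - Complex.I * s) / ((Real.sqrt 2 : ℝ) : ℂ)) with hm
  have hb : ∀ᵐ t ∂(volume.restrict (Set.Ioi (0 : ℝ))),
      ‖f t - m t‖ ≤ Real.sqrt 2 * s ^ 2 * (Real.exp (-t) / (s + t)) := by
    filter_upwards [ae_restrict_mem measurableSet_Ioi] with t ht
    have h := aux_pt s t hs ht
    simp only [hf, hm]
    rw [mul_assoc, ← mul_sub, norm_mul, Complex.norm_real, Real.norm_of_nonneg (by positivity)]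
    calc _ ≤ Real.exp (-t) * (Real.sqrt 2 * s ^ 2 / (s + t)) := by gcongr
      _ = _ := by ring
  have hl2 := il.const_mul (Real.sqrt 2 * s ^ 2)
  have hd : IntegrableOn (fun t => f t - m t) (Set.Ioi 0) :=
    Integrable.mono' hl2 ((aux_meas s).sub im.aestronglyMeasurable) hb
  have hfi : IntegrableOn f (Set.Ioi 0) := by
    have := hd.add im
    refine this.congr (Filter.Eventually.of_forall fun t => ?_)
    simp
  rw [← vm, ← integral_sub hfi im]
  refine (norm_integral_le_of_norm_le hl2 hb).trans ?_
  rw [integral_const_mul]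
  gcongr

lemma aux_exp (s : ℝ) (hs : 0 < s) :
    ‖Complex.exp (Complex.I * s) * (1 - Complex.I * s) - 1‖ ≤ 3 * s ^ 2 := by
  have hn : ‖Complex.exp (Complex.I * s)‖ = 1 := by
    rw [mul_comm]; exact Complex.norm_exp_ofReal_mul_I s
  have hI : ‖Complex.I * (s : ℂ)‖ = s := by simp [abs_of_pos hs]
  rcases le_total s 1 with h | h
  · have e : Complex.exp (Complex.I * s) * (1 - Complex.I * s) - 1 =
        - (Complex.exp (Complex.I * s) *
          (Complex.exp (-(Complex.I * s)) - 1 - (-(Complex.I * s)))) := by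
      have : Complex.exp (Complex.I * s) * Complex.exp (-(Complex.I * s)) = 1 := by
        rw [← Complex.exp_add]; simp
      linear_combination this
    have := Complex.norm_exp_sub_one_sub_id_le (x := -(Complex.I * s)) (by rw [norm_neg, hI]; exact h)
    rw [norm_neg, hI] at this
    rw [e, norm_neg, norm_mul, hn]
    nlinarith
  · have h1 : ‖1 - Complex.I * (s : ℂ)‖ ≤ 1 + s := by
      refine (norm_sub_le _ _).trans ?_
      rw [hI, norm_one]
    have h2 := norm_sub_le (Complex.exp (Complex.I * s) * (1 - Complex.I * s)) 1
    rw [norm_mul, hn, norm_one] at h2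
    nlinarith

lemma aux_const : 2 * (2 * Real.pi) ^ ((3 : ℝ) / 2) * Real.Gamma (3 / 2) =
    2 * Real.sqrt 2 * Real.pi ^ 2 := by
  have hpi := Real.pi_pos
  have h1 : Real.Gamma (3 / 2) = Real.sqrt Real.pi / 2 := by
    have := Real.Gamma_add_one (s := 1 / 2) (by norm_num)
    rw [Real.Gamma_one_half_eq] at this
    norm_num at this
    rw [this]; ring
  have h2 : (2 * Real.pi) ^ ((3 : ℝ) / 2) = 2 * Real.pi * (Real.sqrt 2 * Real.sqrt Real.pi) := by
    rw [show (3 : ℝ) / 2 = 1 + 1 / 2 by norm_num, Real.rpow_add (by positivity), Real.rpow_one,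
      ← Real.sqrt_eq_rpow, Real.sqrt_mul (by norm_num)]
  rw [h1, h2]
  have := Real.sq_sqrt hpi.le
  linear_combination (2 * Real.pi * Real.sqrt 2) * this

lemma aux_jb (s : ℝ) : 1 + |s| ≤ Real.sqrt 2 * jb s := by
  unfold jb
  rw [← Real.sqrt_mul (by norm_num)]
  apply Real.le_sqrt_of_sq_le
  nlinarith [sq_nonneg (1 - |s|), sq_abs s]

/-- Low-energy expansion of the Green function:
`|𝒢_λ(x) − (4π²|x|²)⁻¹| ≤ C λ² ⟨log λ⟩ (|x|^{1/2} + ⟨log |x|⟩)` for `0 < λ ≤ Λ`. -/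
theorem stmt_6 (Λ : ℝ) (hΛ : 0 < Λ) :
    ∃ C : ℝ, 0 < C ∧
      ∀ (lam : ℝ) (x : R4), 0 < lam → lam ≤ Λ → x ≠ 0 →
        ‖G lam x - (((4 * Real.pi ^ 2 * ‖x‖ ^ 2 : ℝ))⁻¹ : ℂ)‖ ≤
          C * lam ^ 2 * jb (Real.log lam) *
            (‖x‖ ^ ((1 : ℝ) / 2) + jb (Real.log ‖x‖)) := by
  refine ⟨16, by norm_num, ?_⟩
  intro lam x hlam _ hx
  have hr : 0 < ‖x‖ := norm_pos_iff.2 hx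
  obtain ⟨r, hrr⟩ : ∃ r, r = ‖x‖ := ⟨_, rfl⟩
  unfold G
  rw [aux_const]
  rw [← hrr] at hr ⊢
  obtain ⟨s, hsd⟩ : ∃ s, s = lam * r := ⟨_, rfl⟩
  have hs : 0 < s := by rw [hsd]; positivity
  have hc : Complex.I * (lam : ℂ) * (r : ℂ) = Complex.I * s := by
    rw [hsd]; push_cast; ring
  simp only [hc]
  have hH := aux_H s hs
  set H := ∫ t in Set.Ioi (0 : ℝ),
      ((Real.exp (-t) : ℝ) : ℂ) * ((Real.sqrt t : ℝ) : ℂ) *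
        (((t / 2 : ℝ) : ℂ) - Complex.I * (s : ℂ)) ^ ((1 : ℂ) / 2)
  have hE := aux_exp s hs
  have hn : ‖Complex.exp (Complex.I * s)‖ = 1 := by
    rw [mul_comm]; exact Complex.norm_exp_ofReal_mul_I s
  obtain ⟨p, hp⟩ : ∃ p, p = Real.sqrt 2 := ⟨_, rfl⟩
  have hj1 := aux_jb (Real.log lam)
  have hj2 := aux_jb (Real.log r)
  rw [← hp] at hH hj1 hj2 ⊢
  have hp0 : 0 < p := by rw [hp]; positivity
  have hp2 : p ^ 2 = 2 := by rw [hp]; exact Real.sq_sqrt (by norm_num)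
  have hp2c : (p : ℂ) ^ 2 = 2 := by exact_mod_cast hp2
  have hpc : (p : ℂ) ≠ 0 := by exact_mod_cast hp0.ne'
  have hrc : (r : ℂ) ≠ 0 := by exact_mod_cast hr.ne'
  have hpic : (Real.pi : ℂ) ≠ 0 := by exact_mod_cast Real.pi_pos.ne'
  have e : Complex.exp (Complex.I * s) / ((2 * p * Real.pi ^ 2 * r ^ 2 : ℝ) : ℂ) * H
      - (((4 * Real.pi ^ 2 * r ^ 2 : ℝ))⁻¹ : ℂ) =
      (Complex.exp (Complex.I * s) * (H - (1 - Complex.I * s) / p) +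
        (Complex.exp (Complex.I * s) * (1 - Complex.I * s) - 1) / p) /
        ((2 * p * Real.pi ^ 2 * r ^ 2 : ℝ) : ℂ) := by
    rw [show (((4 * Real.pi ^ 2 * r ^ 2 : ℝ))⁻¹ : ℂ) =
      (1 / p) / ((2 * p * Real.pi ^ 2 * r ^ 2 : ℝ) : ℂ) by
        push_cast
        field_simp
        linear_combination 2 * hp2c]
    ring
  rw [e, norm_div, Complex.norm_real, Real.norm_of_nonneg (by positivity)]
  have hp1 : 1 ≤ p := by nlinarith
  have hp15 : p ≤ 3 / 2 := by nlinarith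
  have hnum : ‖Complex.exp (Complex.I * s) * (H - (1 - Complex.I * s) / p) +
        (Complex.exp (Complex.I * s) * (1 - Complex.I * s) - 1) / p‖ ≤
        8 * s ^ 2 * (1 + |Real.log s|) := by
    refine (norm_add_le _ _).trans ?_
    rw [norm_mul, hn, one_mul, norm_div, Complex.norm_real, Real.norm_of_nonneg hp0.le]
    have h1 : ‖Complex.exp (Complex.I * s) * (1 - Complex.I * s) - 1‖ / p ≤ 3 * s ^ 2 :=
      (div_le_self (norm_nonneg _) hp1).trans hE
    have h2 : p * s ^ 2 * (2 + |Real.log s|) ≤ 3 / 2 * s ^ 2 * (2 + |Real.log s|) := by gcongr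
    nlinarith [mul_nonneg (sq_nonneg s) (abs_nonneg (Real.log s)), sq_nonneg s]
  have hlog : 1 + |Real.log s| ≤ 2 * (jb (Real.log lam) * jb (Real.log r)) := by
    have h1 : |Real.log s| ≤ |Real.log lam| + |Real.log r| := by
      rw [hsd, Real.log_mul hlam.ne' hr.ne']; exact abs_add_le _ _
    have h2 := mul_le_mul hj1 hj2 (by positivity) (le_trans (by positivity) hj1)
    have h3 : p * jb (Real.log lam) * (p * jb (Real.log r)) =
      2 * (jb (Real.log lam) * jb (Real.log r)) := by rw [← hp2]; ring
    rw [h3] at h2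
    nlinarith [mul_nonneg (abs_nonneg (Real.log lam)) (abs_nonneg (Real.log r))]
  have hjn : 0 ≤ jb (Real.log lam) := Real.sqrt_nonneg _
  have hden : r ^ 2 ≤ 2 * p * Real.pi ^ 2 * r ^ 2 := by
    have : 1 ≤ 2 * p * Real.pi ^ 2 := by nlinarith [Real.pi_gt_three]
    nlinarith [sq_nonneg r]
  calc _ ≤ 8 * s ^ 2 * (1 + |Real.log s|) / r ^ 2 := by gcongr
    _ = 8 * lam ^ 2 * (1 + |Real.log s|) := by
      rw [hsd]; field_simp
    _ ≤ 8 * lam ^ 2 * (2 * (jb (Real.log lam) * jb (Real.log r))) := by gcongr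
    _ = 16 * lam ^ 2 * jb (Real.log lam) * (0 + jb (Real.log r)) := by ring
    _ ≤ _ := by gcongr; positivity
end
end

section
/- Fix χ ∈ C₀^∞(ℝ) with χ(t) = 1 for |t| ≤ 1 and χ(t) = 0 for |t| ≥ 2. Let j ∈ {0,1,2} and ℓ ∈ ℕ, and define ν(ξ) = |ξ|^{j−2} (log |ξ|)^ℓ χ(|ξ|) for ξ ∈ ℝ⁴ ∖ {0}; then ν ∈ L¹(ℝ⁴), and its Fourier transform F(y) = (2π)^{-2} ∫_{ℝ⁴} e^{−i y·ξ} ν(ξ) dξ satisfies: (i) F ∈ C^∞(ℝ⁴); (ii) for every multi-index α there is C_α > 0 such that |∂^α F(y)| ≤ C_α ⟨log ⟨y⟩⟩^ℓ ⟨y⟩^{−(2+j+|α|)} for all y ∈ ℝ⁴; (iii) if j ∈ {0,1}, there exist c > 0 and R > 0 such that |F(y)| ≥ c ⟨log ⟨y⟩⟩^ℓ ⟨y⟩^{−(2+j)} for all |y| ≥ R. -/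
open MeasureTheory Complex
open scoped ENNReal RealInnerProductSpace

noncomputable section

/-- `⟨y⟩ = (1+|y|²)^{1/2}`. -/
def jx (y : R4) : ℝ := Real.sqrt (1 + ‖y‖ ^ 2)


lemma jb_ge_one (s : ℝ) : 1 ≤ jb s := by
  unfold jb; rw [Real.one_le_sqrt]; nlinarith [sq_nonneg s]

lemma le_jb (s : ℝ) : s ≤ jb s := by
  unfold jb; apply Real.le_sqrt_of_sq_le; linarith

lemma jx_ge_one (y : R4) : 1 ≤ jx y := jb_ge_one ‖y‖

lemma numeric_sum (p ℓ : ℕ) (hp : 1 ≤ p) : ∃ C : ℝ, 0 < C ∧ ∀ r : ℝ, 0 ≤ r → ∀ a : ℕ → ℝ,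
    (∀ k, 0 ≤ a k) → (∀ k : ℕ, a k ≤ (1 + (k:ℝ)) ^ ℓ * ((2:ℝ) ^ k)⁻¹ ^ p) →
    (∀ k : ℕ, (((2:ℝ) ^ k)⁻¹ * r) ^ (p + 1) * a k ≤ (1 + (k:ℝ)) ^ ℓ * ((2:ℝ) ^ k)⁻¹ ^ p) →
    Summable a ∧ ∑' k, a k ≤ C * jb (Real.log (jb r)) ^ ℓ * (jb r ^ p)⁻¹ := by
  set w : ℕ → ℝ := fun i => (1 + (i:ℝ)) ^ ℓ * (1/2:ℝ) ^ i with hw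
  have hws : Summable w := by
    have h := summable_pow_mul_geometric_of_norm_lt_one (R := ℝ) ℓ (r := 1/2) (by norm_num)
    have h2 := (summable_nat_add_iff 1).2 h
    refine (h2.mul_left 2).congr ?_
    intro i
    simp only [hw]; push_cast; rw [pow_succ]; ring
  have hw0 : ∀ i, 0 ≤ w i := fun i => by positivity
  have hwi : ∀ i, (1/2:ℝ)^i ≤ w i := fun i => by
    have : (1:ℝ) ≤ (1 + (i:ℝ)) ^ ℓ := one_le_pow₀ (by linarith [(Nat.cast_nonneg i : (0:ℝ) ≤ i)])
    have h2 : (0:ℝ) < (1/2)^i := by positivity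
    simp only [hw]; nlinarith
  set S := ∑' i, w i with hS
  have hS1 : 1 ≤ S := by
    have := hws.le_tsum 0 (fun j _ => hw0 j)
    have e : w 0 = 1 := by simp [hw]
    rwa [e] at this
  have huw : ∀ k : ℕ, ((2:ℝ) ^ k)⁻¹ ^ p ≤ (1/2:ℝ)^k := fun k => by
    rw [one_div, inv_pow (2:ℝ) k]
    have h1 : ((2:ℝ)^k)⁻¹ ≤ 1 := inv_le_one_of_one_le₀ (one_le_pow₀ (by norm_num))
    calc ((2:ℝ) ^ k)⁻¹ ^ p ≤ ((2:ℝ) ^ k)⁻¹ ^ 1 := pow_le_pow_of_le_one (by positivity) h1 hp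
      _ = _ := by simp
  refine ⟨2 * S * 3 ^ ℓ * 4 ^ p, by positivity, ?_⟩
  intro r hr a ha ha1 ha2
  have haw : ∀ k, a k ≤ w k := fun k => (ha1 k).trans (mul_le_mul_of_nonneg_left (huw k) (by positivity))
  have has : Summable a := Summable.of_nonneg_of_le ha haw hws
  refine ⟨has, ?_⟩
  have hjr := jb_ge_one r
  have hjl := jb_ge_one (Real.log (jb r))
  rcases lt_or_ge r 1 with hr1 | hr1
  · have h1 : ∑' k, a k ≤ S := has.tsum_le_tsum haw hws
    have h2 : jb r ≤ 4 := by
      unfold jb; rw [Real.sqrt_le_left (by norm_num)]; nlinarith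
    have h3 : jb r ^ p ≤ 4 ^ p := pow_le_pow_left₀ (by linarith) h2 p
    have h4 : 1 ≤ 4 ^ p * (jb r ^ p)⁻¹ := by
      rw [← div_eq_mul_inv, one_le_div (by positivity)]; exact h3
    have h5 : 1 ≤ jb (Real.log (jb r)) ^ ℓ := one_le_pow₀ hjl
    have h6 : (1:ℝ) ≤ 3 ^ ℓ := one_le_pow₀ (by norm_num)
    calc ∑' k, a k ≤ S := h1
      _ ≤ (2 * S) * 1 * 1 * 1 := by linarith
      _ ≤ (2 * S) * 3 ^ ℓ * jb (Real.log (jb r)) ^ ℓ * (4 ^ p * (jb r ^ p)⁻¹) := by gcongr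
      _ = _ := by ring
  · obtain ⟨K, hK1, hK2⟩ := exists_nat_pow_near hr1 (by norm_num : (1:ℝ) < 2)
    set M : ℝ := (1 + (K:ℝ)) ^ ℓ * ((2:ℝ) ^ K)⁻¹ ^ p with hM
    have hM0 : 0 ≤ M := by positivity
    have hlow : ∑ k ∈ Finset.range K, a k ≤ M * S := by
      have : ∀ k ∈ Finset.range K, a k ≤ M * (1/2:ℝ) ^ (K - 1 - k) := by
        intro k hk
        obtain ⟨d, rfl⟩ : ∃ d, K = k + 1 + d := ⟨K - (k+1), by have := Finset.mem_range.1 hk; omega⟩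
        have e : k + 1 + d - 1 - k = d := by omega
        rw [e]
        have h1 : (2:ℝ) ^ (1 + d) ≤ (2 ^ k)⁻¹ * r := by
          rw [inv_mul_eq_div, le_div_iff₀ (by positivity)]
          calc (2:ℝ) ^ (1 + d) * 2 ^ k = 2 ^ (k + 1 + d) := by ring
            _ ≤ r := hK1
        have h2 := ha2 k
        have h3 : ((2:ℝ) ^ (1 + d)) ^ (p+1) * a k ≤ (1 + ((k + 1 + d : ℕ):ℝ)) ^ ℓ * ((2:ℝ) ^ k)⁻¹ ^ p := by
          calc _ ≤ ((2 ^ k)⁻¹ * r) ^ (p + 1) * a k := by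
                gcongr; exact ha k
            _ ≤ _ := h2
            _ ≤ _ := by gcongr; linarith [(Nat.cast_nonneg d : (0:ℝ) ≤ d)]
        rw [← le_div_iff₀' (by positivity)] at h3
        refine h3.trans ?_
        rw [hM, div_le_iff₀ (by positivity)]
        have : (1 + ((k + 1 + d : ℕ):ℝ)) ^ ℓ * ((2:ℝ) ^ (k+1+d))⁻¹ ^ p * (1/2) ^ d * ((2:ℝ) ^ (1 + d)) ^ (p+1)
            = (1 + ((k + 1 + d : ℕ):ℝ)) ^ ℓ * ((2:ℝ) ^ k)⁻¹ ^ p * 2 := by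
          have e1 : (2:ℝ)^(k+1+d) = 2^k * 2^(1+d) := by ring
          have e2 : ((2:ℝ)^(k+1+d))⁻¹ ^ p * (2 ^ (1+d))^(p+1) = (2^k)⁻¹^p * 2^(1+d) := by
            rw [e1, mul_inv, mul_pow, pow_succ]
            have : ((2:ℝ)^(1+d))⁻¹ ^ p * (2 ^ (1+d))^p = 1 := by
              rw [← mul_pow, inv_mul_cancel₀ (by positivity), one_pow]
            calc _ = ((2:ℝ)^k)⁻¹^p * (((2:ℝ)^(1+d))⁻¹ ^ p * (2 ^ (1+d))^p) * 2^(1+d) := by ring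
              _ = _ := by rw [this, mul_one]
          have e3 : (1/2:ℝ)^d * 2^(1+d) = 2 := by
            rw [pow_add, one_div, inv_pow]; field_simp
          calc _ = (1 + ((k + 1 + d : ℕ):ℝ)) ^ ℓ * (((2:ℝ)^(k+1+d))⁻¹ ^ p * (2 ^ (1+d))^(p+1)) * (1/2)^d := by ring
            _ = (1 + ((k + 1 + d : ℕ):ℝ)) ^ ℓ * ((2:ℝ) ^ k)⁻¹ ^ p * ((1/2:ℝ)^d * 2^(1+d)) := by rw [e2]; ring
            _ = _ := by rw [e3]
        rw [this]
        have : 0 ≤ (1 + ((k + 1 + d : ℕ):ℝ)) ^ ℓ * ((2:ℝ) ^ k)⁻¹ ^ p := by positivity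
        linarith
      calc _ ≤ ∑ k ∈ Finset.range K, M * (1/2:ℝ) ^ (K - 1 - k) := Finset.sum_le_sum this
        _ = M * ∑ k ∈ Finset.range K, (1/2:ℝ) ^ (K - 1 - k) := by rw [Finset.mul_sum]
        _ = M * ∑ k ∈ Finset.range K, (1/2:ℝ) ^ k := by
            rw [Finset.sum_range_reflect (fun i => (1/2:ℝ)^i) K]
        _ ≤ M * ∑ k ∈ Finset.range K, w k := by gcongr with i hi; exact hwi i
        _ ≤ M * S := by gcongr; exact hws.sum_le_tsum _ (fun i _ => hw0 i)
    have hhigh : ∑' i, a (i + K) ≤ M * S := by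
      have : ∀ i, a (i + K) ≤ M * w i := by
        intro i
        refine (ha1 (i+K)).trans ?_
        have h1 : (1 + ((i + K : ℕ):ℝ)) ≤ (1 + (K:ℝ)) * (1 + (i:ℝ)) := by
          push_cast; nlinarith [mul_nonneg (Nat.cast_nonneg i : (0:ℝ) ≤ i) (Nat.cast_nonneg K : (0:ℝ) ≤ K)]
        calc (1 + ((i + K : ℕ):ℝ)) ^ ℓ * ((2:ℝ) ^ (i+K))⁻¹ ^ p
            ≤ ((1 + (K:ℝ)) * (1 + (i:ℝ))) ^ ℓ * (((2:ℝ)^K)⁻¹ ^ p * ((2:ℝ)^i)⁻¹ ^ p) := by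
              rw [pow_add, mul_inv, mul_pow, mul_comm (((2:ℝ)^i)⁻¹ ^ p)]; gcongr
          _ ≤ ((1 + (K:ℝ)) * (1 + (i:ℝ))) ^ ℓ * (((2:ℝ)^K)⁻¹ ^ p * (1/2)^i) := by
              gcongr; exact huw i
          _ = _ := by rw [hM, hw, mul_pow]; ring
      rw [hS, ← tsum_mul_left]
      exact ((summable_nat_add_iff K).2 has).tsum_le_tsum this (hws.mul_left M)
    have htot : ∑' k, a k ≤ 2 * S * M := by
      rw [← has.sum_add_tsum_nat_add K]; linarith
    have hjr4 : jb r ≤ 4 * 2 ^ K := by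
      have : jb r ≤ 2 * r := by
        unfold jb; rw [Real.sqrt_le_left (by linarith)]; nlinarith
      rw [pow_succ] at hK2; linarith
    have hinv : ((2:ℝ)^K)⁻¹ ≤ 4 * (jb r)⁻¹ := by
      rw [← div_eq_mul_inv, le_div_iff₀ (by linarith), inv_mul_le_iff₀ (by positivity)]; linarith
    have hKj : 1 + (K:ℝ) ≤ 3 * jb (Real.log (jb r)) := by
      have h1 : (K:ℝ) * Real.log 2 ≤ Real.log (jb r) := by
        rw [← Real.log_pow]
        exact Real.log_le_log (by positivity) (hK1.trans (le_jb r))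
      have h2 := le_jb (Real.log (jb r))
      have h3 := Real.log_two_gt_d9
      have h4 : (K:ℝ) * 0.5 ≤ K * Real.log 2 := by gcongr; linarith
      linarith
    calc ∑' k, a k ≤ 2 * S * M := htot
      _ ≤ 2 * S * ((3 * jb (Real.log (jb r))) ^ ℓ * (4 * (jb r)⁻¹) ^ p) := by
          rw [hM]; gcongr
      _ = _ := by rw [mul_pow, mul_pow, inv_pow]; ring

lemma series_bound (ℓ s : ℕ) (hs : 1 ≤ s) (H : ℕ → R4 → ℂ) (hH : ∀ k, ContDiff ℝ (⊤ : ℕ∞) (H k))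
    (hdec : ∀ N n : ℕ, ∃ A : ℝ, 0 < A ∧ ∀ (k : ℕ) (x : R4),
      ‖x‖ ^ N * ‖iteratedFDeriv ℝ n (H k) x‖ ≤ A * (1 + (k:ℝ)) ^ ℓ) :
    ContDiff ℝ (⊤ : ℕ∞) (fun y : R4 => ∑' k : ℕ, (((2:ℝ) ^ k)⁻¹ ^ s) • H k (((2:ℝ) ^ k)⁻¹ • y)) ∧
    ∀ n : ℕ, ∃ C : ℝ, 0 < C ∧ ∀ y : R4,
      ‖iteratedFDeriv ℝ n (fun y : R4 => ∑' k : ℕ, (((2:ℝ) ^ k)⁻¹ ^ s) • H k (((2:ℝ) ^ k)⁻¹ • y)) y‖ ≤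
        C * jb (Real.log (jx y)) ^ ℓ * (jx y ^ (s + n))⁻¹ := by
  set f : ℕ → R4 → ℂ := fun k y => (((2:ℝ) ^ k)⁻¹ ^ s) • H k (((2:ℝ) ^ k)⁻¹ • y) with hf
  have hcd0 : ∀ k, ContDiff ℝ (⊤ : ℕ∞) (fun y => H k (((2:ℝ) ^ k)⁻¹ • y)) := fun k =>
    (hH k).comp (contDiff_const_smul _)
  have hcd : ∀ k, ContDiff ℝ (⊤ : ℕ∞) (f k) := fun k => (hcd0 k).const_smul _
  have hnorm : ∀ (n k : ℕ) (y : R4), ‖iteratedFDeriv ℝ n (f k) y‖ =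
      ((2:ℝ) ^ k)⁻¹ ^ (s + n) * ‖iteratedFDeriv ℝ n (H k) (((2:ℝ) ^ k)⁻¹ • y)‖ := by
    intro n k y
    have hle : ((n:ℕ∞) : WithTop ℕ∞) ≤ ((⊤ : ℕ∞) : WithTop ℕ∞) := by exact_mod_cast le_top
    simp only [hf]
    rw [iteratedFDeriv_const_smul_apply' (((hcd0 k).of_le hle).contDiffAt),
      iteratedFDeriv_comp_const_smul _ ((hH k).of_le hle)]
    rw [norm_smul, norm_smul, Real.norm_of_nonneg (by positivity), Real.norm_of_nonneg (by positivity), pow_add]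
    ring
  choose A hA0 hA using hdec
  -- choose the bounding sequence
  set v : ℕ → ℕ → ℝ := fun n k => A 0 n * ((1 + (k:ℝ)) ^ ℓ * ((2:ℝ) ^ k)⁻¹ ^ (s + n)) with hv
  have hvb : ∀ n k y, ‖iteratedFDeriv ℝ n (f k) y‖ ≤ v n k := by
    intro n k y
    rw [hnorm]
    have := hA 0 n k (((2:ℝ) ^ k)⁻¹ • y)
    rw [pow_zero, one_mul] at this
    calc _ ≤ ((2:ℝ) ^ k)⁻¹ ^ (s + n) * (A 0 n * (1 + (k:ℝ)) ^ ℓ) := by gcongr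
      _ = _ := by simp only [hv]; ring
  have hvs : ∀ n, Summable (v n) := by
    intro n
    obtain ⟨C, -, hC⟩ := numeric_sum (s+n) ℓ (by omega)
    refine Summable.mul_left _ (hC 0 le_rfl _ (fun k => by positivity) (fun k => le_rfl) (fun k => ?_)).1
    have : (0:ℝ) ≤ (1 + (k:ℝ)) ^ ℓ * ((2:ℝ) ^ k)⁻¹ ^ (s + n) := by positivity
    simpa using this
  refine ⟨contDiff_tsum (N := ⊤) hcd (fun n _ => hvs n) (fun n k y _ => hvb n k y), ?_⟩
  intro n
  obtain ⟨C, hC0, hC⟩ := numeric_sum (s+n) ℓ (by omega)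
  set D := A 0 n + A (s + n + 1) n with hD
  have hDpos : 0 < D := add_pos (hA0 _ _) (hA0 _ _)
  refine ⟨D * C, by positivity, ?_⟩
  intro y
  rw [iteratedFDeriv_tsum_apply (N := ⊤) hcd (fun n _ => hvs n) (fun n k y _ => hvb n k y) (by exact_mod_cast le_top)]
  have key := hC ‖y‖ (norm_nonneg _) (fun k => D⁻¹ * ‖iteratedFDeriv ℝ n (f k) y‖) (fun k => by positivity)
    (fun k => by
      rw [inv_mul_le_iff₀ hDpos]
      refine (hvb n k y).trans ?_
      simp only [hv]; gcongr; rw [hD]; linarith [hA0 (s+n+1) n])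
    (fun k => by
      have h1 := hA (s + n + 1) n k (((2:ℝ) ^ k)⁻¹ • y)
      rw [norm_smul, Real.norm_of_nonneg (by positivity)] at h1
      rw [hnorm]
      calc _ = D⁻¹ * (((2:ℝ) ^ k)⁻¹ ^ (s + n) * (((((2:ℝ) ^ k)⁻¹ * ‖y‖) ^ (s + n + 1)) *
              ‖iteratedFDeriv ℝ n (H k) (((2:ℝ) ^ k)⁻¹ • y)‖)) := by ring
        _ ≤ D⁻¹ * (((2:ℝ) ^ k)⁻¹ ^ (s + n) * (A (s+n+1) n * (1 + (k:ℝ)) ^ ℓ)) := by gcongr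
        _ ≤ D⁻¹ * (((2:ℝ) ^ k)⁻¹ ^ (s + n) * (D * (1 + (k:ℝ)) ^ ℓ)) := by
            gcongr; rw [hD]; linarith [hA0 0 n]
        _ = _ := by field_simp)
  obtain ⟨hsum, hle⟩ := key
  have hsum' : Summable (fun k => ‖iteratedFDeriv ℝ n (f k) y‖) := by
    have := hsum.mul_left D
    refine this.congr (fun k => ?_)
    field_simp
  calc ‖∑' k, iteratedFDeriv ℝ n (f k) y‖ ≤ ∑' k, ‖iteratedFDeriv ℝ n (f k) y‖ := norm_tsum_le_tsum_norm hsum'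
    _ = D * ∑' k, D⁻¹ * ‖iteratedFDeriv ℝ n (f k) y‖ := by rw [tsum_mul_left]; field_simp
    _ ≤ D * (C * jb (Real.log (jb ‖y‖)) ^ ℓ * (jb ‖y‖ ^ (s+n))⁻¹) := by gcongr
    _ = _ := by simp only [jx, jb]; ring

open scoped SchwartzMap FourierTransform in
lemma radial_schwartz (a : ℤ) (m : ℕ) (φ : ℝ → ℝ) (hφ : ContDiff ℝ (⊤ : ℕ∞) φ)
    (h0 : ∀ t : ℝ, |t| ≤ 1/2 → φ t = 0) (h2 : ∀ t : ℝ, 2 ≤ |t| → φ t = 0) :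
    ∃ g : 𝓢(R4, ℂ), ∀ ξ, g ξ = ((‖ξ‖ ^ a * Real.log ‖ξ‖ ^ m * φ ‖ξ‖ : ℝ) : ℂ) := by
  have hcs : HasCompactSupport (fun ξ : R4 => ((‖ξ‖ ^ a * Real.log ‖ξ‖ ^ m * φ ‖ξ‖ : ℝ) : ℂ)) := by
    refine HasCompactSupport.intro (isCompact_closedBall (0:R4) 2) ?_
    intro x hx
    rw [Metric.mem_closedBall, dist_zero_right, not_le] at hx
    rw [h2 ‖x‖ (by rw [abs_of_nonneg (norm_nonneg _)]; exact hx.le)]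
    simp
  have hcd : ContDiff ℝ (⊤ : ℕ∞) (fun ξ : R4 => ((‖ξ‖ ^ a * Real.log ‖ξ‖ ^ m * φ ‖ξ‖ : ℝ) : ℂ)) := by
    refine Complex.ofRealCLM.contDiff.comp ?_
    rw [contDiff_iff_contDiffAt]
    intro x
    by_cases hx : x = 0
    · subst hx
      have : (fun ξ : R4 => ‖ξ‖ ^ a * Real.log ‖ξ‖ ^ m * φ ‖ξ‖) =ᶠ[nhds 0] fun _ => 0 := by
        filter_upwards [Metric.ball_mem_nhds (0:R4) (by norm_num : (0:ℝ) < 1/2)] with ξ hξ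
        rw [Metric.mem_ball, dist_zero_right] at hξ
        rw [h0 ‖ξ‖ (by rw [abs_of_nonneg (norm_nonneg _)]; exact hξ.le)]; simp
      exact contDiffAt_const.congr_of_eventuallyEq this
    · have hn : ContDiffAt ℝ (⊤ : ℕ∞) (fun ξ : R4 => ‖ξ‖) x := contDiffAt_norm ℝ hx
      have hx' : ‖x‖ ≠ 0 := norm_ne_zero_iff.2 hx
      have hz : ContDiffAt ℝ (⊤ : ℕ∞) (fun ξ : R4 => ‖ξ‖ ^ a) x := by
        have : ContDiffAt ℝ (⊤ : ℕ∞) (fun t : ℝ => t ^ a) ‖x‖ := by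
          cases a with
          | ofNat n => simpa using contDiffAt_id.pow n
          | negSucc n => 
            simp only [zpow_negSucc]
            exact (contDiffAt_id.pow (n+1)).inv (by simpa using hx)
        exact this.comp x hn
      exact (hz.mul ((hn.log hx').pow m)).mul (hφ.contDiffAt.comp x hn)
  exact ⟨hcs.toSchwartzMap hcd, fun ξ => rfl⟩

def T (h : ℝ → ℝ) (y : R4) : ℂ := ∫ ξ : R4, Complex.exp (-Complex.I * (⟪y, ξ⟫ : ℝ)) * ((h ‖ξ‖ : ℝ) : ℂ)

open scoped SchwartzMap FourierTransform in
lemma four_eq (g : R4 → ℂ) (y : R4) :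
    ∫ ξ : R4, Complex.exp (-Complex.I * (⟪y, ξ⟫ : ℝ)) * g ξ = 𝓕 g ((2 * Real.pi)⁻¹ • y) := by
  rw [Real.fourier_eq']
  congr 1
  ext ξ
  rw [smul_eq_mul, inner_smul_right, real_inner_comm]
  congr 2
  have : (Real.pi : ℂ) ≠ 0 := by exact_mod_cast Real.pi_ne_zero
  push_cast
  field_simp

open scoped SchwartzMap FourierTransform in
lemma four_schwartz (g : 𝓢(R4, ℂ)) : ∃ G : 𝓢(R4, ℂ), ∀ y,
    G y = ∫ ξ : R4, Complex.exp (-Complex.I * (⟪y, ξ⟫ : ℝ)) * g ξ := by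
  refine ⟨SchwartzMap.compCLMOfContinuousLinearEquiv ℝ
    (ContinuousLinearEquiv.smulLeft (Units.mk0 ((2 * Real.pi)⁻¹ : ℝ) (by positivity))) (𝓕 g), ?_⟩
  intro y
  rw [four_eq]
  rfl

lemma exp_norm (y ξ : R4) : ‖Complex.exp (-Complex.I * (⟪y, ξ⟫ : ℝ))‖ = 1 := by
  rw [Complex.norm_exp]; simp

lemma exp_cont (y : R4) : Continuous fun ξ : R4 => Complex.exp (-Complex.I * (⟪y, ξ⟫ : ℝ)) := by
  fun_prop

lemma exp_mul_integrable (y : R4) {g : R4 → ℂ} (hg : Integrable g) :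
    Integrable fun ξ : R4 => Complex.exp (-Complex.I * (⟪y, ξ⟫ : ℝ)) * g ξ := by
  refine hg.bdd_mul (c := 1) (exp_cont y).aestronglyMeasurable ?_
  exact Filter.Eventually.of_forall fun ξ => (exp_norm y ξ).le

open scoped SchwartzMap FourierTransform in
lemma dyadic (χ : ℝ → ℝ) (hχ : ContDiff ℝ (⊤ : ℕ∞) χ)
    (hχ1 : ∀ t : ℝ, |t| ≤ 1 → χ t = 1) (hχ0 : ∀ t : ℝ, 2 ≤ |t| → χ t = 0)
    (j ℓ : ℕ) : ∃ H : ℕ → R4 → ℂ, (∀ k, ContDiff ℝ (⊤ : ℕ∞) (H k)) ∧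
    (∀ N n : ℕ, ∃ A : ℝ, 0 < A ∧ ∀ (k : ℕ) (x : R4),
      ‖x‖ ^ N * ‖iteratedFDeriv ℝ n (H k) x‖ ≤ A * (1 + (k:ℝ)) ^ ℓ) ∧
    ∀ y, T (fun t => t ^ ((j:ℤ) - 2) * Real.log t ^ ℓ * χ t) y =
      ∑' k : ℕ, (((2:ℝ) ^ k)⁻¹ ^ (2 + j)) • H k (((2:ℝ) ^ k)⁻¹ • y) := by
  set φ : ℝ → ℝ := fun t => χ t - χ (2 * t) with hφ
  have hφs : ContDiff ℝ (⊤ : ℕ∞) φ := hχ.sub (hχ.comp (contDiff_const.mul contDiff_id))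
  have hφ0 : ∀ t : ℝ, |t| ≤ 1/2 → φ t = 0 := fun t ht => by
    simp only [hφ]
    rw [hχ1 t (by linarith), hχ1 (2*t) (by rw [abs_mul, abs_two]; linarith), sub_self]
  have hφ2 : ∀ t : ℝ, 2 ≤ |t| → φ t = 0 := fun t ht => by
    simp only [hφ]
    rw [hχ0 t ht, hχ0 (2*t) (by rw [abs_mul, abs_two]; linarith), sub_self]
  choose g hg using fun m => radial_schwartz ((j:ℤ) - 2) m φ hφs hφ0 hφ2
  choose G hG using fun m => four_schwartz (g m)
  set c : ℕ → ℕ → ℝ := fun k m => (k * Real.log 2) ^ (ℓ - m) * (-1) ^ (ℓ - m) * (ℓ.choose m) with hc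
  have hcb : ∀ k m, |c k m| ≤ (ℓ.choose m) * (1 + (k:ℝ)) ^ ℓ := by
    intro k m
    have h2 : 0 ≤ Real.log 2 := Real.log_nonneg (by norm_num)
    have h3 : Real.log 2 ≤ 1 := by linarith [Real.log_two_lt_d9]
    have hk : (0:ℝ) ≤ k := Nat.cast_nonneg k
    simp only [hc]
    rw [abs_mul, abs_mul, abs_pow, abs_pow, abs_neg, abs_one, one_pow, mul_one, Nat.abs_cast,
      abs_of_nonneg (by positivity), mul_comm]
    gcongr
    calc (k * Real.log 2) ^ (ℓ - m) ≤ (1 + (k:ℝ)) ^ (ℓ - m) := by gcongr; nlinarith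
      _ ≤ _ := pow_le_pow_right₀ (by linarith) (Nat.sub_le _ _)
  set Gk : ℕ → 𝓢(R4, ℂ) := fun k => ∑ m ∈ Finset.range (ℓ + 1), c k m • G m with hGk
  set gk : ℕ → 𝓢(R4, ℂ) := fun k => ∑ m ∈ Finset.range (ℓ + 1), c k m • g m with hgk
  have hgka : ∀ k ξ, gk k ξ = ∑ m ∈ Finset.range (ℓ + 1), c k m • g m ξ := by
    intro k ξ; simp [hgk]
  have hGka : ∀ k ξ, Gk k ξ = ∑ m ∈ Finset.range (ℓ + 1), c k m • G m ξ := by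
    intro k ξ; simp [hGk]
  have hGint : ∀ k y, Gk k y = ∫ ξ : R4, Complex.exp (-Complex.I * (⟪y, ξ⟫ : ℝ)) * gk k ξ := by
    intro k y
    rw [hGka]
    simp_rw [hgka, Finset.mul_sum]
    rw [integral_finsetSum]
    · refine Finset.sum_congr rfl fun m _ => ?_
      rw [hG]
      simp_rw [mul_smul_comm]
      rw [integral_smul]
    · intro m _
      exact exp_mul_integrable y ((g m).integrable.smul (c k m))
  have hgk1 : ∃ A : ℝ, ∀ k, ∫ ξ, ‖gk k ξ‖ ≤ A * (1 + (k:ℝ)) ^ ℓ := by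
    refine ⟨∑ m ∈ Finset.range (ℓ + 1), (ℓ.choose m) * ∫ ξ, ‖g m ξ‖, fun k => ?_⟩
    calc ∫ ξ, ‖gk k ξ‖ ≤ ∫ ξ, ∑ m ∈ Finset.range (ℓ + 1), |c k m| * ‖g m ξ‖ := by
          refine integral_mono (gk k).integrable.norm
            (integrable_finsetSum _ fun m _ => (g m).integrable.norm.const_mul _) fun ξ => ?_
          simp only [hgka]
          refine (norm_sum_le _ _).trans (Finset.sum_le_sum fun m _ => ?_)
          rw [norm_smul, Real.norm_eq_abs]
      _ = ∑ m ∈ Finset.range (ℓ + 1), |c k m| * ∫ ξ, ‖g m ξ‖ := by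
          rw [integral_finsetSum _ fun m _ => (g m).integrable.norm.const_mul _]
          simp_rw [integral_const_mul]
      _ ≤ ∑ m ∈ Finset.range (ℓ + 1), (ℓ.choose m) * (1 + (k:ℝ)) ^ ℓ * ∫ ξ, ‖g m ξ‖ := by
          refine Finset.sum_le_sum fun m _ => ?_
          exact mul_le_mul_of_nonneg_right (hcb k m) (integral_nonneg fun _ => norm_nonneg _)
      _ = _ := by rw [Finset.sum_mul]; refine Finset.sum_congr rfl fun m _ => by ring
  obtain ⟨A1, hA1⟩ := hgk1
  have hA1' : 0 ≤ A1 := by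
    have := (integral_nonneg fun _ => norm_nonneg _).trans (hA1 0)
    simpa using this
  refine ⟨fun k => Gk k, fun k => (Gk k).smooth ⊤, ?_, ?_⟩
  · intro N n
    refine ⟨1 + ∑ m ∈ Finset.range (ℓ + 1), (ℓ.choose m) * SchwartzMap.seminorm ℝ N n (G m), ?_, ?_⟩
    · have : 0 ≤ ∑ m ∈ Finset.range (ℓ + 1), (ℓ.choose m) * SchwartzMap.seminorm ℝ N n (G m) :=
        Finset.sum_nonneg fun m _ => mul_nonneg (Nat.cast_nonneg _) (apply_nonneg _ _)
      linarith
    · intro k x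
      calc _ ≤ SchwartzMap.seminorm ℝ N n (Gk k) := SchwartzMap.le_seminorm ℝ N n (Gk k) x
        _ ≤ ∑ m ∈ Finset.range (ℓ + 1), SchwartzMap.seminorm ℝ N n (c k m • G m) := Finset.le_sum_of_subadditive _ (map_zero _).le (fun a b => map_add_le_add _ a b) _ _
        _ ≤ ∑ m ∈ Finset.range (ℓ + 1), (ℓ.choose m) * SchwartzMap.seminorm ℝ N n (G m) * (1 + (k:ℝ)) ^ ℓ := by
            refine Finset.sum_le_sum fun m _ => ?_
            rw [map_smul_eq_mul, Real.norm_eq_abs]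
            have := mul_le_mul_of_nonneg_right (hcb k m) (apply_nonneg (SchwartzMap.seminorm ℝ N n) (G m))
            linarith
        _ ≤ _ := by
            rw [← Finset.sum_mul]; gcongr; linarith
  · intro y
    set Fk : ℕ → R4 → ℂ := fun k ξ => ((((2:ℝ) ^ k) ^ (2 - (j:ℤ)) : ℝ) : ℂ) *
      (Complex.exp (-Complex.I * (⟪y, ξ⟫ : ℝ)) * gk k ((2:ℝ) ^ k • ξ)) with hFk
    have e2 : ∀ k : ℕ, ((2:ℝ) ^ k) ^ (2 - (j:ℤ)) * (((2:ℝ)^k) ^ 4)⁻¹ = ((2:ℝ) ^ k)⁻¹ ^ (2 + j) := by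
      intro k
      have h0 : ((2:ℝ)^k) ≠ 0 := by positivity
      rw [← zpow_natCast _ 4, ← zpow_natCast _ (2+j), inv_zpow, ← zpow_neg, ← zpow_neg, ← zpow_add₀ h0]
      congr 1; push_cast; ring
    have hscale : ∀ k, (∫ ξ, Fk k ξ) = (((2:ℝ) ^ k)⁻¹ ^ (2 + j)) • Gk k (((2:ℝ) ^ k)⁻¹ • y) := by
      intro k
      have h0 : ((2:ℝ)^k) ≠ 0 := by positivity
      simp only [hFk]
      rw [integral_const_mul, hGint]
      have := Measure.integral_comp_smul (volume : Measure R4)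
        (fun ξ => Complex.exp (-Complex.I * (⟪((2:ℝ) ^ k)⁻¹ • y, ξ⟫ : ℝ)) * gk k ξ) ((2:ℝ)^k)
      have e : ∀ ξ : R4, (⟪((2:ℝ) ^ k)⁻¹ • y, (2:ℝ)^k • ξ⟫ : ℝ) = ⟪y, ξ⟫ := by
        intro ξ; rw [inner_smul_left, inner_smul_right]; simp
      simp_rw [e] at this
      rw [this, finrank_euclideanSpace_fin, abs_of_nonneg (by positivity), ← e2, Complex.real_smul, Complex.real_smul]
      push_cast; ring
    have hint : ∀ k, Integrable (Fk k) := by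
      intro k
      have h0 : ((2:ℝ)^k) ≠ 0 := by positivity
      exact (exp_mul_integrable y ((gk k).integrable.comp_smul h0)).const_mul _
    have hnorm : ∀ k, ∫ ξ, ‖Fk k ξ‖ = ((2:ℝ) ^ k)⁻¹ ^ (2 + j) * ∫ ξ, ‖gk k ξ‖ := by
      intro k
      simp only [hFk, norm_mul, exp_norm, one_mul, Complex.norm_real]
      rw [integral_const_mul, Real.norm_of_nonneg (by positivity)]
      have := Measure.integral_comp_smul (volume : Measure R4) (fun ξ => ‖gk k ξ‖) ((2:ℝ)^k)
      rw [this, finrank_euclideanSpace_fin, abs_of_nonneg (by positivity), ← e2, smul_eq_mul, mul_assoc]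
    have hsummable : Summable fun k => ∫ ξ, ‖Fk k ξ‖ := by
      obtain ⟨C, -, hC⟩ := numeric_sum (2+j) ℓ (by omega)
      have hs := (hC 0 le_rfl (fun k => (1 + (k:ℝ)) ^ ℓ * ((2:ℝ) ^ k)⁻¹ ^ (2 + j)) (fun k => by positivity)
        (fun k => le_rfl) (fun k => by
          have : (0:ℝ) ≤ (1 + (k:ℝ)) ^ ℓ * ((2:ℝ) ^ k)⁻¹ ^ (2 + j) := by positivity
          simpa using this)).1
      refine Summable.of_nonneg_of_le (fun k => integral_nonneg fun _ => norm_nonneg _) (fun k => ?_) (hs.mul_left A1)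
      rw [hnorm]
      calc _ ≤ ((2:ℝ) ^ k)⁻¹ ^ (2 + j) * (A1 * (1 + (k:ℝ)) ^ ℓ) := by gcongr; exact hA1 k
        _ = _ := by ring
    have hmain := hasSum_integral_of_summable_integral_norm hint hsummable
    have hpt : ∀ ξ : R4, ξ ≠ 0 → ∑' k, Fk k ξ = Complex.exp (-Complex.I * (⟪y, ξ⟫ : ℝ)) *
        ((‖ξ‖ ^ ((j:ℤ) - 2) * Real.log ‖ξ‖ ^ ℓ * χ ‖ξ‖ : ℝ) : ℂ) := by
      intro ξ hξ
      have ht : 0 < ‖ξ‖ := norm_pos_iff.2 hξ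
      set t := ‖ξ‖ with htdef
      have h1 : ∀ k, Fk k ξ = Complex.exp (-Complex.I * (⟪y, ξ⟫ : ℝ)) *
        ((t ^ ((j:ℤ) - 2) * Real.log t ^ ℓ * φ (2 ^ k * t) : ℝ) : ℂ) := by
        intro k
        have h0 : ((2:ℝ)^k) ≠ 0 := by positivity
        have hnrm : ‖(2:ℝ)^k • ξ‖ = 2 ^ k * t := by
          rw [norm_smul, Real.norm_of_nonneg (by positivity)]
        have h3 : gk k ((2:ℝ)^k • ξ) = (((2 ^ k * t) ^ ((j:ℤ) - 2) * Real.log t ^ ℓ * φ (2 ^ k * t) : ℝ) : ℂ) := by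
          rw [hgka]
          simp_rw [hg, hnrm]
          have h4 : Real.log t = Real.log (2 ^ k * t) + -(k * Real.log 2) := by
            rw [Real.log_mul h0 ht.ne', Real.log_pow]; ring
          rw [h4, add_pow]
          simp_rw [Complex.real_smul, ← Complex.ofReal_mul, ← Complex.ofReal_sum]
          congr 1
          rw [Finset.mul_sum, Finset.sum_mul]
          refine Finset.sum_congr rfl fun m _ => ?_
          simp only [hc]
          rw [neg_pow]
          ring
        simp only [hFk]
        rw [h3, mul_left_comm, ← Complex.ofReal_mul]
        congr 2
        rw [mul_zpow, ← neg_sub (j:ℤ) 2, zpow_neg]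
        have : ((2:ℝ)^k) ^ ((j:ℤ) - 2) ≠ 0 := zpow_ne_zero _ h0
        field_simp
      obtain ⟨n, hn⟩ := pow_unbounded_of_one_lt (2 / t) (by norm_num : (1:ℝ) < 2)
      rw [div_lt_iff₀ ht] at hn
      have hbig : ∀ k, n ≤ k → χ (2 ^ k * t) = 0 := by
        intro k hk
        apply hχ0
        rw [abs_of_pos (by positivity)]
        refine hn.le.trans ?_
        gcongr; norm_num
      have hφk : ∀ k, φ (2 ^ k * t) = χ (2 ^ k * t) - χ (2 ^ (k+1) * t) := by
        intro k; simp only [hφ]; rw [pow_succ]; ring_nf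
      rw [tsum_eq_sum (s := Finset.range n)]
      · simp_rw [h1]
        rw [← Finset.mul_sum, ← Complex.ofReal_sum, ← Finset.mul_sum]
        congr 3
        simp_rw [hφk]
        rw [Finset.sum_range_sub', hbig n le_rfl]; simp
      · intro k hk
        rw [Finset.mem_range, not_lt] at hk
        rw [h1, hφk, hbig k hk, hbig (k+1) (by omega)]; simp
    simp_rw [← hscale]
    rw [hmain.tsum_eq]
    unfold T
    apply integral_congr_ae
    filter_upwards [Measure.ae_ne volume (0:R4)] with ξ hξ
    rw [hpt ξ hξ]

lemma log_pow_bound (m : ℕ) (R : ℝ) (hR : 1 ≤ R) : ∃ M : ℝ, 0 ≤ M ∧ ∀ x : ℝ, 0 < x → x ≤ R →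
    x * |Real.log x| ^ m ≤ M := by
  refine ⟨(m:ℝ) ^ m + R ^ (m+1), by positivity, ?_⟩
  intro x hx hxR
  rcases le_or_gt x 1 with h1 | h1
  · have hRm : 0 ≤ R ^ (m+1) := by positivity
    rcases Nat.eq_zero_or_pos m with rfl | hm
    · simp; linarith
    · have hm' : (0:ℝ) < m := by exact_mod_cast hm
      have h := Real.abs_log_mul_self_rpow_lt x (1/m) hx h1 (by positivity)
      have h2 : |Real.log x * x ^ (1/(m:ℝ))| ^ m ≤ (m:ℝ)^m := by
        apply pow_le_pow_left₀ (abs_nonneg _)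
        simpa using h.le
      rw [abs_mul, mul_pow, abs_of_nonneg (Real.rpow_nonneg hx.le _), one_div, Real.rpow_inv_natCast_pow hx.le hm.ne'] at h2
      linarith
  · have hl : |Real.log x| ≤ R := by
      rw [abs_of_nonneg (Real.log_nonneg h1.le)]
      linarith [Real.log_le_sub_one_of_pos hx]
    have : x * |Real.log x| ^ m ≤ R * R ^ m := by gcongr
    have h3 : 0 ≤ (m:ℝ)^m := by positivity
    rw [pow_succ']; linarith

lemma rad_integrable (a : ℤ) (ha : -2 ≤ a) (m : ℕ) (ψ : ℝ → ℝ) (hψ : Continuous ψ) (R : ℝ)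
    (h0 : ∀ t, R ≤ |t| → ψ t = 0) :
    Integrable (fun ξ : R4 => ‖ξ‖ ^ a * Real.log ‖ξ‖ ^ m * ψ ‖ξ‖) := by
  have hr := integrable_fun_norm_addHaar (volume : Measure R4) (f := fun t : ℝ => t ^ a * Real.log t ^ m * ψ t)
  rw [hr, finrank_euclideanSpace_fin]
  set R' := max R 1
  obtain ⟨M, hM0, hM⟩ := log_pow_bound m R' (le_max_right _ _)
  obtain ⟨B, hB⟩ := (isCompact_Icc (a := (0:ℝ)) (b := R')).exists_bound_of_continuousOn hψ.continuousOn
  obtain ⟨n, hn⟩ : ∃ n : ℕ, a + 3 = n + 1 := ⟨(a+2).toNat, by omega⟩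
  have hmeas : Measurable (fun y : ℝ => y ^ (4 - 1) • (y ^ a * Real.log y ^ m * ψ y)) := by
    have h1 : Measurable fun y : ℝ => y ^ a := by
      cases a with
      | ofNat n => simpa using measurable_id.pow_const n
      | negSucc n =>
        simp only [zpow_negSucc]
        exact (measurable_id.pow_const (n+1)).inv
    exact (measurable_id.pow_const 3).smul ((h1.mul (Real.measurable_log.pow_const m)).mul hψ.measurable)
  have hI : Integrable (Set.indicator (Set.Icc 0 R') (fun _ : ℝ => R' ^ n * M * B)) (volume.restrict (Set.Ioi (0:ℝ))) := by
    refine Integrable.restrict ?_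
    rw [integrable_indicator_iff measurableSet_Icc]
    exact integrableOn_const (by simp)
  refine hI.mono' hmeas.aestronglyMeasurable ?_
  rw [ae_restrict_iff' measurableSet_Ioi]
  refine Filter.Eventually.of_forall fun y hy => ?_
  have hy : 0 < y := hy
  by_cases hyR : y ≤ R'
  · rw [Set.indicator_of_mem (Set.mem_Icc.2 ⟨hy.le, hyR⟩)]
    have e : y ^ (4 - 1) • (y ^ a * Real.log y ^ m * ψ y) = y ^ n * (y * Real.log y ^ m) * ψ y := by
      have : y ^ 3 * y ^ a = y ^ n * y := by
        rw [← zpow_natCast, ← zpow_add₀ hy.ne', ← pow_succ, ← zpow_natCast]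
        congr 1; push_cast; linarith
      rw [smul_eq_mul]
      calc _ = (y ^ 3 * y ^ a) * Real.log y ^ m * ψ y := by ring
        _ = _ := by rw [this]; ring
    rw [e, norm_mul, norm_mul, norm_mul, norm_pow, norm_pow, Real.norm_of_nonneg hy.le, Real.norm_eq_abs (Real.log y)]
    have := hM y hy hyR
    have h2 := hB y ⟨hy.le, hyR⟩
    gcongr
  · rw [not_le] at hyR
    rw [h0 y (by rw [abs_of_pos hy]; exact (le_max_left _ _).trans hyR.le)]
    rw [Set.indicator_of_notMem (by simp [hyR])]; simp

lemma T_radial (h : ℝ → ℝ) (y z : R4) (hyz : ‖y‖ = ‖z‖) : T h y = T h z := by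
  have hA := Submodule.reflection_sub hyz
  set A := (Submodule.span ℝ {y - z})ᗮ.reflection
  unfold T
  have hmp := A.measurePreserving
  rw [← hmp.integral_comp A.toHomeomorph.measurableEmbedding
    (fun ξ => Complex.exp (-Complex.I * (⟪z, ξ⟫ : ℝ)) * ((h ‖ξ‖ : ℝ) : ℂ))]
  congr 1
  ext ξ
  rw [A.norm_map, ← hA, A.inner_map_map]

lemma T_scale (h : ℝ → ℝ) (y : R4) (r : ℝ) (hr : 0 < r) :
    T h (r • y) = ((r ^ 4)⁻¹ : ℝ) • T (fun t => h (t / r)) y := by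
  unfold T
  have := Measure.integral_comp_smul (volume : Measure R4)
    (fun ξ => Complex.exp (-Complex.I * (⟪y, ξ⟫ : ℝ)) * ((h (‖ξ‖ / r) : ℝ) : ℂ)) r
  rw [finrank_euclideanSpace_fin, abs_of_nonneg (by positivity)] at this
  rw [← this]
  congr 1
  ext ξ
  rw [inner_smul_left, inner_smul_right, norm_smul, Real.norm_of_nonneg hr.le, mul_div_cancel_left₀ _ hr.ne']
  simp

lemma T_norm_le (h : ℝ → ℝ) (y : R4) : ‖T h y‖ ≤ ∫ ξ : R4, ‖((h ‖ξ‖ : ℝ) : ℂ)‖ := by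
  unfold T
  refine (norm_integral_le_integral_norm _).trans_eq ?_
  simp only [norm_mul, exp_norm, one_mul]

lemma limit_of_deriv (f : ℝ → ℂ) (hf : ∀ r, 1 ≤ r → DifferentiableAt ℝ f r) (K : ℝ)
    (hK : ∀ r, 1 ≤ r → ‖deriv f r‖ ≤ K * r ^ (-4 : ℝ)) :
    ∃ L : ℂ, Filter.Tendsto f Filter.atTop (nhds L) ∧ ∀ r, 1 ≤ r → ‖f r - L‖ ≤ K * (r ^ 3)⁻¹ := by
  have hK0 : 0 ≤ K := by simpa using (norm_nonneg _).trans (hK 1 le_rfl)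
  have hint0 : ∀ r : ℝ, 1 ≤ r → IntegrableOn (fun t : ℝ => K * t ^ (-4:ℝ)) (Set.Ioi r) := fun r hr =>
    (integrableOn_Ioi_rpow_of_lt (by norm_num) (by linarith)).const_mul K
  have hint : ∀ r : ℝ, 1 ≤ r → IntegrableOn (deriv f) (Set.Ioi r) := by
    intro r hr
    refine (hint0 r hr).mono' (measurable_deriv f).aestronglyMeasurable ?_
    rw [ae_restrict_iff' measurableSet_Ioi]
    exact Filter.Eventually.of_forall fun t ht => hK t (hr.trans (le_of_lt ht))
  have hlim := tendsto_limUnder_of_hasDerivAt_of_integrableOn_Ioi (f := f) (f' := deriv f) (a := 1)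
    (fun r hr => (hf r (le_of_lt hr)).hasDerivAt) (hint 1 le_rfl)
  refine ⟨_, hlim, ?_⟩
  intro r hr
  have h1 := integral_Ioi_of_hasDerivAt_of_tendsto' (f := f) (f' := deriv f) (a := r)
    (fun t ht => (hf t (hr.trans ht)).hasDerivAt) (hint r hr) hlim
  rw [norm_sub_rev, ← h1]
  calc ‖∫ t in Set.Ioi r, deriv f t‖ ≤ ∫ t in Set.Ioi r, K * t ^ (-4:ℝ) := by
        refine norm_integral_le_of_norm_le (hint0 r hr) ?_
        rw [ae_restrict_iff' measurableSet_Ioi]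
        exact Filter.Eventually.of_forall fun t ht => hK t (hr.trans (le_of_lt ht))
    _ = K * (r ^ (-3:ℝ) / 3) := by
        rw [integral_const_mul, integral_Ioi_rpow_of_lt (by norm_num) (by linarith)]
        norm_num
    _ ≤ K * (r ^ 3)⁻¹ := by
        have : r ^ (-3:ℝ) = (r^3)⁻¹ := by
          rw [Real.rpow_neg (by linarith)]; norm_cast
        rw [this]
        have h2 : 0 ≤ (r^3)⁻¹ := by positivity
        gcongr; linarith

lemma deriv_zero_inner (χ : ℝ → ℝ) (hχ1 : ∀ t : ℝ, |t| ≤ 1 → χ t = 1) (t : ℝ) (ht : |t| ≤ 1/2) :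
    deriv χ t = 0 := by
  have : χ =ᶠ[nhds t] fun _ => 1 := by
    filter_upwards [Metric.ball_mem_nhds t (by norm_num : (0:ℝ) < 1/2)] with x hx
    rw [Metric.mem_ball, Real.dist_eq] at hx
    apply hχ1
    have := abs_add_le (x - t) t
    rw [sub_add_cancel] at this
    linarith
  rw [this.deriv_eq]; simp

lemma deriv_zero_outer (χ : ℝ → ℝ) (hχ : Differentiable ℝ χ) (hχ0 : ∀ t : ℝ, 2 ≤ |t| → χ t = 0)
    (t : ℝ) (ht : 2 ≤ |t|) : deriv χ t = 0 := by
  rcases le_abs.1 ht with h | h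
  · have h1 := (hχ t).hasDerivAt.hasDerivWithinAt (s := Set.Ici t)
    have h2 : HasDerivWithinAt χ 0 (Set.Ici t) t :=
      (hasDerivWithinAt_const t (Set.Ici t) (0:ℝ)).congr
        (fun x hx => hχ0 x (le_abs.2 (Or.inl (h.trans hx)))) (hχ0 t ht)
    exact (uniqueDiffWithinAt_Ici t).eq_deriv _ h1 h2
  · have h1 := (hχ t).hasDerivAt.hasDerivWithinAt (s := Set.Iic t)
    have h2 : HasDerivWithinAt χ 0 (Set.Iic t) t :=
      (hasDerivWithinAt_const t (Set.Iic t) (0:ℝ)).congr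
        (fun x hx => hχ0 x (le_abs.2 (Or.inr (by have : x ≤ t := hx; linarith)))) (hχ0 t ht)
    exact (uniqueDiffWithinAt_Iic t).eq_deriv _ h1 h2

lemma f_deriv (χ : ℝ → ℝ) (hχ : ContDiff ℝ (⊤ : ℕ∞) χ) 
    (hχ0 : ∀ t : ℝ, 2 ≤ |t| → χ t = 0) (a : ℤ) (ha : -2 ≤ a) (m : ℕ) (e : R4) (r₀ : ℝ) (hr₀ : 0 < r₀) :
    HasDerivAt (fun r => T (fun t => t ^ a * Real.log t ^ m * χ (t / r)) e)
      (T (fun t => t ^ a * Real.log t ^ m * (deriv χ (t / r₀) * (-(t / r₀ ^ 2)))) e) r₀ := by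
  have hdiff : Differentiable ℝ χ := hχ.differentiable (by simp)
  have hdc : Continuous (deriv χ) := hχ.continuous_deriv (by exact_mod_cast le_top)
  obtain ⟨B, hB⟩ := (isCompact_Icc (a := (-2:ℝ)) (b := 2)).exists_bound_of_continuousOn hdc.continuousOn
  have hB0 : 0 ≤ B := (norm_nonneg _).trans (hB 0 (by norm_num))
  have hBall : ∀ t, |deriv χ t| ≤ B := by
    intro t
    by_cases ht : 2 ≤ |t|
    · rw [deriv_zero_outer χ hdiff hχ0 t ht]; simpa using hB0
    · rw [not_le, abs_lt] at ht
      exact hB t ⟨ht.1.le, ht.2.le⟩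
  set D : ℝ := B * (3 * r₀ * (4 / r₀ ^ 2)) / r₀ with hD
  have hD0 : 0 ≤ D := by positivity
  set ψ : ℝ → ℝ := fun t => D * max 0 (4 * r₀ - |t|) with hψ
  have hψc : Continuous ψ := by fun_prop
  have hψ0 : ∀ t, 4 * r₀ ≤ |t| → ψ t = 0 := fun t ht => by
    simp only [hψ]; rw [max_eq_left (by linarith), mul_zero]
  have hmz : ∀ r : ℝ, r ≠ 0 → Integrable fun ξ : R4 => ((‖ξ‖ ^ a * Real.log ‖ξ‖ ^ m * χ (‖ξ‖ / r) : ℝ) : ℂ) := by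
    intro r hr
    refine (rad_integrable a ha m (fun t => χ (t / r)) (hχ.continuous.comp (continuous_id.div_const r)) (2 * |r|) ?_).ofReal
    intro t ht
    apply hχ0
    rw [abs_div, le_div_iff₀ (abs_pos.2 hr)]; exact ht
  have hmd : Integrable fun ξ : R4 => ((‖ξ‖ ^ a * Real.log ‖ξ‖ ^ m * (deriv χ (‖ξ‖ / r₀) * (-(‖ξ‖ / r₀ ^ 2))) : ℝ) : ℂ) := by
    refine (rad_integrable a ha m (fun t => deriv χ (t / r₀) * (-(t / r₀ ^ 2))) (by fun_prop) (2 * r₀) ?_).ofReal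
    intro t ht
    rw [deriv_zero_outer χ hdiff hχ0 (t / r₀) (by rw [abs_div, abs_of_pos hr₀, le_div_iff₀ hr₀]; exact ht), zero_mul]
  unfold T
  refine (hasDerivAt_integral_of_dominated_loc_of_deriv_le (s := Metric.ball r₀ (r₀ / 2))
    (bound := fun ξ : R4 => ‖‖ξ‖ ^ a * Real.log ‖ξ‖ ^ m * ψ ‖ξ‖‖)
    (F := fun r (ξ : R4) => Complex.exp (-Complex.I * (⟪e, ξ⟫ : ℝ)) *
      ((‖ξ‖ ^ a * Real.log ‖ξ‖ ^ m * χ (‖ξ‖ / r) : ℝ) : ℂ))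
    (F' := fun r (ξ : R4) => Complex.exp (-Complex.I * (⟪e, ξ⟫ : ℝ)) *
      ((‖ξ‖ ^ a * Real.log ‖ξ‖ ^ m * (deriv χ (‖ξ‖ / r) * (-(‖ξ‖ / r ^ 2))) : ℝ) : ℂ))
    (Metric.ball_mem_nhds _ (by positivity)) ?_ ?_ ?_ ?_ ?_ ?_).2
  · filter_upwards [lt_mem_nhds hr₀] with r hr
    exact (exp_mul_integrable e (hmz r hr.ne')).aestronglyMeasurable
  · exact exp_mul_integrable e (hmz r₀ hr₀.ne')
  · exact (exp_mul_integrable e hmd).aestronglyMeasurable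
  · refine Filter.Eventually.of_forall fun ξ r hr => ?_
    rw [Metric.mem_ball, Real.dist_eq, abs_lt] at hr
    have hr1 : r₀ / 2 < r := by linarith
    have hr2 : r < 3 / 2 * r₀ := by linarith
    have hrp : 0 < r := by linarith
    rw [norm_mul, exp_norm, one_mul, Complex.norm_real, norm_mul, norm_mul (‖ξ‖ ^ a * Real.log ‖ξ‖ ^ m)]
    gcongr
    by_cases h : 2 ≤ |‖ξ‖ / r|
    · rw [deriv_zero_outer χ hdiff hχ0 _ h]; simp
    · rw [not_le, abs_of_nonneg (by positivity), div_lt_iff₀ hrp] at h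
      have hξ : ‖ξ‖ ≤ 3 * r₀ := by linarith
      have h1 : ‖ξ‖ / r ^ 2 ≤ 3 * r₀ * (4 / r₀ ^ 2) := by
        have h2 : r₀ ^ 2 / 4 ≤ r ^ 2 := by nlinarith
        rw [← mul_div_assoc, div_le_div_iff₀ (by positivity) (by positivity)]
        nlinarith [norm_nonneg ξ]
      have h3 : B * (3 * r₀ * (4 / r₀ ^ 2)) = D * r₀ := by rw [hD]; field_simp
      have h4 : r₀ ≤ max 0 (4 * r₀ - |‖ξ‖|) := by
        apply le_max_of_le_right; rw [abs_of_nonneg (norm_nonneg _)]; linarith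
      calc ‖deriv χ (‖ξ‖ / r) * (-(‖ξ‖ / r ^ 2))‖ = |deriv χ (‖ξ‖ / r)| * (‖ξ‖ / r ^ 2) := by
            rw [norm_mul, norm_neg, Real.norm_eq_abs, Real.norm_of_nonneg (by positivity)]
        _ ≤ B * (3 * r₀ * (4 / r₀ ^ 2)) := by gcongr; exact hBall _
        _ = D * r₀ := h3
        _ ≤ ψ ‖ξ‖ := by simp only [hψ]; gcongr
        _ ≤ _ := le_abs_self _
  · exact (rad_integrable a ha m ψ hψc (4 * r₀) hψ0).norm
  · refine Filter.Eventually.of_forall fun ξ r hr => ?_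
    rw [Metric.mem_ball, Real.dist_eq, abs_lt] at hr
    have hrp : 0 < r := by linarith
    have h1 : HasDerivAt (fun r : ℝ => ‖ξ‖ / r) (-(‖ξ‖ / r ^ 2)) r := by
      have := (hasDerivAt_inv hrp.ne').const_mul ‖ξ‖
      simp only [div_eq_mul_inv]
      exact this.congr_deriv (by ring)
    have h2 := (hdiff (‖ξ‖ / r)).hasDerivAt.comp r h1
    exact ((h2.const_mul (‖ξ‖ ^ a * Real.log ‖ξ‖ ^ m)).ofReal_comp).const_mul _

open scoped SchwartzMap in
lemma f_deriv_decay (χ : ℝ → ℝ) (hχ : ContDiff ℝ (⊤ : ℕ∞) χ) (hχ1 : ∀ t : ℝ, |t| ≤ 1 → χ t = 1)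
    (hχ0 : ∀ t : ℝ, 2 ≤ |t| → χ t = 0) (a : ℤ) (ha' : a ≤ 0) (m : ℕ) (e : R4) (he : ‖e‖ = 1) :
    ∃ K : ℝ, ∀ r : ℝ, 1 ≤ r →
      ‖T (fun t => t ^ a * Real.log t ^ m * (deriv χ (t / r) * (-(t / r ^ 2)))) e‖ ≤ K * r ^ (-4 : ℝ) := by
  have hdiff : Differentiable ℝ χ := hχ.differentiable (by simp)
  have hdc : ContDiff ℝ (⊤ : ℕ∞) (deriv χ) := ((contDiff_infty_iff_deriv).1 hχ).2
  set φ : ℝ → ℝ := fun t => t * deriv χ t with hφ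
  have hφs : ContDiff ℝ (⊤ : ℕ∞) φ := contDiff_id.mul hdc
  have hφ0 : ∀ t : ℝ, |t| ≤ 1/2 → φ t = 0 := fun t ht => by
    simp only [hφ]; rw [deriv_zero_inner χ hχ1 t ht, mul_zero]
  have hφ2 : ∀ t : ℝ, 2 ≤ |t| → φ t = 0 := fun t ht => by
    simp only [hφ]; rw [deriv_zero_outer χ hdiff hχ0 t ht, mul_zero]
  choose g hg using fun i => radial_schwartz a i φ hφs hφ0 hφ2
  choose G hG using fun i => four_schwartz (g i)
  choose A hA0 hA using fun i => (G i).decay (m + 8) 0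
  have hGd : ∀ i (r : ℝ), 1 ≤ r → ‖G i (r • e)‖ ≤ A i * (r ^ (m+8))⁻¹ := by
    intro i r hr
    have := hA i (r • e)
    rw [norm_smul, he, mul_one, Real.norm_of_nonneg (by linarith), norm_iteratedFDeriv_zero] at this
    rw [← div_eq_mul_inv, le_div_iff₀ (by positivity)]; linarith
  refine ⟨∑ i ∈ Finset.range (m+1), (m.choose i) * A i, ?_⟩
  intro r hr
  have hr0 : 0 < r := by linarith
  have hT : T (fun t => t ^ a * Real.log t ^ m * (deriv χ (t / r) * (-(t / r ^ 2)))) e =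
      ∑ i ∈ Finset.range (m+1), (r ^ 4 * (-(r ^ a / r) * Real.log r ^ (m - i) * (m.choose i)) : ℝ) • G i (r • e) := by
    have hs := T_scale (fun t => (r * t) ^ a * Real.log (r * t) ^ m * (-(1 / r) * φ t)) e r hr0
    have e1 : (fun t => (fun t => (r * t) ^ a * Real.log (r * t) ^ m * (-(1 / r) * φ t)) (t / r)) =
        (fun t => t ^ a * Real.log t ^ m * (deriv χ (t / r) * (-(t / r ^ 2)))) := by
      ext t
      simp only [hφ]
      rw [mul_div_cancel₀ _ hr0.ne']
      field_simp
    rw [e1] at hs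
    have hs2 : T (fun t => t ^ a * Real.log t ^ m * (deriv χ (t / r) * (-(t / r ^ 2)))) e =
        (r ^ 4 : ℝ) • T (fun t => (r * t) ^ a * Real.log (r * t) ^ m * (-(1 / r) * φ t)) (r • e) := by
      rw [hs, smul_smul, mul_inv_cancel₀ (by positivity), one_smul]
    rw [hs2]
    have hTG : T (fun t => (r * t) ^ a * Real.log (r * t) ^ m * (-(1 / r) * φ t)) (r • e) =
        ∑ i ∈ Finset.range (m+1), (-(r ^ a / r) * Real.log r ^ (m - i) * (m.choose i) : ℝ) • G i (r • e) := by
      simp_rw [hG, ← integral_smul]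
      rw [← integral_finsetSum]
      · unfold T
        congr 1
        ext ξ
        have : ((r * ‖ξ‖) ^ a * Real.log (r * ‖ξ‖) ^ m * (-(1 / r) * φ ‖ξ‖)) =
            ∑ i ∈ Finset.range (m+1), (-(r ^ a / r) * Real.log r ^ (m - i) * (m.choose i)) *
              (‖ξ‖ ^ a * Real.log ‖ξ‖ ^ i * φ ‖ξ‖) := by
          by_cases hξ : ‖ξ‖ = 0
          · simp [hξ, hφ]
          · rw [Real.log_mul hr0.ne' hξ, add_comm, add_pow, mul_zpow, Finset.mul_sum, Finset.sum_mul]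
            refine Finset.sum_congr rfl fun i _ => ?_
            ring
        beta_reduce
        rw [this, Complex.ofReal_sum, Finset.mul_sum]
        refine Finset.sum_congr rfl fun i _ => ?_
        rw [hg, Complex.real_smul, Complex.ofReal_mul]
        ring
      · intro i _
        exact (exp_mul_integrable _ (g i).integrable).smul (-(r ^ a / r) * Real.log r ^ (m - i) * (m.choose i) : ℝ)
    rw [hTG, Finset.smul_sum]
    refine Finset.sum_congr rfl fun i _ => ?_
    rw [smul_smul]
  rw [hT, Finset.sum_mul]
  refine (norm_sum_le _ _).trans (Finset.sum_le_sum fun i _ => ?_)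
  have hra : r ^ a / r ≤ 1 := by
    rw [div_le_one hr0]
    exact (zpow_le_one_of_nonpos₀ hr ha').trans hr
  have hra0 : 0 ≤ r ^ a / r := by positivity
  have hlog0 : 0 ≤ Real.log r := Real.log_nonneg hr
  have hlog : Real.log r ^ (m - i) ≤ r ^ m := by
    calc Real.log r ^ (m - i) ≤ r ^ (m - i) := by
          gcongr; linarith [Real.log_le_sub_one_of_pos hr0]
      _ ≤ r ^ m := pow_le_pow_right₀ hr (Nat.sub_le _ _)
  have hrp : r ^ (-4:ℝ) = (r^4)⁻¹ := by
    rw [Real.rpow_neg hr0.le]; norm_cast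
  rw [norm_smul]
  have hn : ‖(r ^ 4 * (-(r ^ a / r) * Real.log r ^ (m - i) * (m.choose i)) : ℝ)‖ ≤ r ^ 4 * (1 * r ^ m * (m.choose i)) := by
    rw [neg_mul, neg_mul, mul_neg, norm_neg, Real.norm_of_nonneg (by positivity)]
    gcongr
  calc _ ≤ (r ^ 4 * (1 * r ^ m * (m.choose i))) * (A i * (r ^ (m+8))⁻¹) := by
        gcongr
        exact hGd i r hr
    _ = (m.choose i) * A i * (r ^ 4)⁻¹ := by
        have : r ^ (m+8) = r^4 * r^m * r^4 := by ring
        rw [this]; field_simp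
    _ = _ := by rw [hrp]

lemma f_limit (χ : ℝ → ℝ) (hχ : ContDiff ℝ (⊤ : ℕ∞) χ) (hχ1 : ∀ t : ℝ, |t| ≤ 1 → χ t = 1)
    (hχ0 : ∀ t : ℝ, 2 ≤ |t| → χ t = 0) (a : ℤ) (ha : -2 ≤ a) (ha' : a ≤ 0) (m : ℕ) (e : R4) (he : ‖e‖ = 1) :
    ∃ (L : ℂ) (K : ℝ), Filter.Tendsto (fun r => T (fun t => t ^ a * Real.log t ^ m * χ (t / r)) e)
      Filter.atTop (nhds L) ∧
      ∀ r : ℝ, 1 ≤ r → ‖T (fun t => t ^ a * Real.log t ^ m * χ (t / r)) e - L‖ ≤ K * (r ^ 3)⁻¹ := by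
  obtain ⟨K, hK⟩ := f_deriv_decay χ hχ hχ1 hχ0 a ha' m e he
  have hd := fun r (hr : (1:ℝ) ≤ r) => f_deriv χ hχ hχ0 a ha m e r (by linarith)
  obtain ⟨L, h1, h2⟩ := limit_of_deriv (fun r => T (fun t => t ^ a * Real.log t ^ m * χ (t / r)) e)
    (fun r hr => (hd r hr).differentiableAt) K (fun r hr => by rw [(hd r hr).deriv]; exact hK r hr)
  exact ⟨L, K, h1, h2⟩

lemma T_expand (χ : ℝ → ℝ) (hχ : Continuous χ) 
    (hχ0 : ∀ t : ℝ, 2 ≤ |t| → χ t = 0) (a : ℤ) (ha : -2 ≤ a) (ha' : a ≤ -1) (ℓ : ℕ) (e : R4)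
    (r : ℝ) (hr : 0 < r) :
    T (fun t => t ^ a * Real.log t ^ ℓ * χ t) (r • e) = ((r ^ 4)⁻¹ * r ^ (-a) : ℝ) •
      ∑ m ∈ Finset.range (ℓ + 1), ((ℓ.choose m) * (-1) ^ (ℓ - m) * Real.log r ^ (ℓ - m) : ℝ) •
        T (fun t => t ^ a * Real.log t ^ m * χ (t / r)) e := by
  rw [T_scale _ _ _ hr, mul_smul]
  congr 1
  have hint : ∀ m, Integrable fun ξ : R4 => ((‖ξ‖ ^ a * Real.log ‖ξ‖ ^ m * χ (‖ξ‖ / r) : ℝ) : ℂ) := by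
    intro m
    refine (rad_integrable a ha m (fun t => χ (t / r)) (hχ.comp (continuous_id.div_const r)) (2 * r) ?_).ofReal
    intro t ht
    apply hχ0
    rw [abs_div, abs_of_pos hr, le_div_iff₀ hr]; exact ht
  unfold T
  simp_rw [← integral_smul]
  rw [← integral_finsetSum]
  · rw [← integral_smul]
    congr 1
    ext ξ
    beta_reduce
    have : (‖ξ‖ / r) ^ a * Real.log (‖ξ‖ / r) ^ ℓ * χ (‖ξ‖ / r) = r ^ (-a) *
       ∑ m ∈ Finset.range (ℓ + 1), ((ℓ.choose m) * (-1) ^ (ℓ - m) * Real.log r ^ (ℓ - m)) *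
         (‖ξ‖ ^ a * Real.log ‖ξ‖ ^ m * χ (‖ξ‖ / r)) := by
      by_cases hξ : ‖ξ‖ = 0
      · rw [hξ, zero_div, zero_zpow _ (by omega)]; simp
      · rw [Real.log_div hξ hr.ne', sub_eq_add_neg, add_pow, div_zpow, Finset.mul_sum, Finset.sum_mul, Finset.mul_sum]
        refine Finset.sum_congr rfl fun i _ => ?_
        rw [neg_pow, zpow_neg]; ring
    rw [this, Complex.ofReal_mul, Complex.ofReal_sum, Complex.real_smul, Finset.mul_sum, Finset.mul_sum, Finset.mul_sum]
    refine Finset.sum_congr rfl fun i _ => ?_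
    rw [Complex.real_smul, Complex.ofReal_mul]
    ring
  · intro m _
    exact (exp_mul_integrable e (hint m)).smul ((ℓ.choose m) * (-1) ^ (ℓ - m) * Real.log r ^ (ℓ - m) : ℝ)

open scoped FourierTransform in
lemma L_ne_zero (χ : ℝ → ℝ) (hχ : ContDiff ℝ (⊤ : ℕ∞) χ) (hχ1 : ∀ t : ℝ, |t| ≤ 1 → χ t = 1)
    (hχ0 : ∀ t : ℝ, 2 ≤ |t| → χ t = 0) (a : ℤ) (ha : -2 ≤ a) (ha' : a ≤ -1) (e : R4) (he : ‖e‖ = 1)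
    (K : ℝ) (hK : ∀ r : ℝ, 1 ≤ r → ‖T (fun t => t ^ a * Real.log t ^ 0 * χ (t / r)) e‖ ≤ K * (r ^ 3)⁻¹) :
    False := by
  have hK0 : 0 ≤ K := by simpa using (norm_nonneg _).trans (hK 1 le_rfl)
  set h : ℝ → ℝ := fun t => t ^ a * Real.log t ^ 0 * χ t with hh
  have hint : Integrable fun ξ : R4 => ((h ‖ξ‖ : ℝ) : ℂ) :=
    (rad_integrable a ha 0 χ hχ.continuous 2 hχ0).ofReal
  set I := ∫ ξ : R4, ‖((h ‖ξ‖ : ℝ) : ℂ)‖ with hI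
  have hI0 : 0 ≤ I := integral_nonneg fun _ => norm_nonneg _
  have hfar : ∀ y : R4, 1 ≤ ‖y‖ → ‖T h y‖ ≤ K * (‖y‖ ^ 5)⁻¹ := by
    intro y hy
    have hy0 : 0 < ‖y‖ := by linarith
    rw [T_radial h y (‖y‖ • e) (by rw [norm_smul, he]; simp)]
    rw [hh, T_expand χ hχ.continuous hχ0 a ha ha' 0 e ‖y‖ hy0]
    simp only [zero_add, Finset.sum_range_one, Nat.choose_self, Nat.sub_zero, pow_zero, Nat.cast_one, mul_one, one_smul]
    have h1 := hK ‖y‖ hy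
    simp only [pow_zero, mul_one] at h1
    have h2 : ‖y‖ ^ (-a) ≤ ‖y‖ ^ 2 := by
      rw [← zpow_natCast]; exact zpow_le_zpow_right₀ hy (by push_cast; omega)
    rw [norm_smul, Real.norm_of_nonneg (by positivity)]
    calc _ ≤ ((‖y‖ ^ 4)⁻¹ * ‖y‖ ^ 2) * (K * (‖y‖ ^ 3)⁻¹) := by gcongr
      _ = _ := by field_simp
  have hbd : ∀ y : R4, ‖T h y‖ ≤ ((K + I) * 32) * (1 + ‖y‖) ^ (-(5:ℝ)) := by
    intro y
    have e5 : (1 + ‖y‖) ^ (-(5:ℝ)) = ((1 + ‖y‖) ^ 5)⁻¹ := by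
      rw [Real.rpow_neg (by positivity)]; norm_cast
    rw [e5, ← div_eq_mul_inv, le_div_iff₀ (by positivity)]
    rcases le_or_gt 1 ‖y‖ with hy | hy
    · have hy0 : 0 < ‖y‖ := by linarith
      calc ‖T h y‖ * (1 + ‖y‖) ^ 5 ≤ (K * (‖y‖ ^ 5)⁻¹) * (2 * ‖y‖) ^ 5 := by
            gcongr
            · exact hfar y hy
            · linarith
        _ = K * 32 := by field_simp; norm_num
        _ ≤ _ := by linarith
    · calc ‖T h y‖ * (1 + ‖y‖) ^ 5 ≤ I * 2 ^ 5 := by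
            gcongr
            · exact T_norm_le h y
            · linarith
        _ ≤ _ := by linarith
  have hTF : ∀ w : R4, 𝓕 (fun ξ : R4 => ((h ‖ξ‖ : ℝ) : ℂ)) w = T h ((2 * Real.pi) • w) := by
    intro w
    unfold T
    rw [four_eq (fun ξ : R4 => ((h ‖ξ‖ : ℝ) : ℂ)), smul_smul, inv_mul_cancel₀ (by positivity), one_smul]
  have hcont : Continuous (𝓕 (fun ξ : R4 => ((h ‖ξ‖ : ℝ) : ℂ))) :=
    VectorFourier.fourierIntegral_continuous Real.continuous_fourierChar
      (by exact continuous_inner) hint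
  have hTcont : Continuous (T h) := by
    have : T h = fun y => 𝓕 (fun ξ : R4 => ((h ‖ξ‖ : ℝ) : ℂ)) ((2 * Real.pi)⁻¹ • y) := by
      ext y; exact four_eq (fun ξ : R4 => ((h ‖ξ‖ : ℝ) : ℂ)) y
    rw [this]
    exact hcont.comp (continuous_const_smul _)
  have hTint : Integrable (T h) := by
    refine ((integrable_one_add_norm (E := R4) (μ := volume) (r := 5) ?_).const_mul ((K + I) * 32)).mono'
      hTcont.aestronglyMeasurable (Filter.Eventually.of_forall hbd)
    rw [finrank_euclideanSpace_fin]; norm_num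
  have hFint : Integrable (𝓕 (fun ξ : R4 => ((h ‖ξ‖ : ℝ) : ℂ))) := by
    have := hTint.comp_smul (R := 2 * Real.pi) (by positivity)
    exact this.congr (Filter.Eventually.of_forall fun w => (hTF w).symm)
  set Q := ∫ w, ‖𝓕 (fun ξ : R4 => ((h ‖ξ‖ : ℝ) : ℂ)) w‖ with hQ
  have hQ0 : 0 ≤ Q := integral_nonneg fun _ => norm_nonneg _
  set t : ℝ := (Q + 2)⁻¹ with ht
  have ht0 : 0 < t := by positivity
  have ht1 : t ≤ 1 := inv_le_one_of_one_le₀ (by linarith)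
  have hte : ‖t • e‖ = t := by rw [norm_smul, he, Real.norm_of_nonneg ht0.le, mul_one]
  have hne : t • e ≠ 0 := by rw [← norm_pos_iff, hte]; exact ht0
  have hca : ContinuousAt (fun ξ : R4 => ((h ‖ξ‖ : ℝ) : ℂ)) (t • e) := by
    have h1 : ContinuousAt h ‖t • e‖ := by
      rw [hte]
      have : ContinuousAt (fun x : ℝ => x ^ a) t := continuousAt_zpow₀ t a (Or.inl ht0.ne')
      simp only [hh, pow_zero, mul_one]
      exact this.mul hχ.continuous.continuousAt
    exact Complex.continuous_ofReal.continuousAt.comp (h1.comp (x := t • e) continuous_norm.continuousAt)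
  have hinv := hint.fourierInv_fourier_eq hFint hca
  have hle : ‖((h ‖t • e‖ : ℝ) : ℂ)‖ ≤ Q := by
    rw [← hinv]
    exact VectorFourier.norm_fourierIntegral_le_integral_norm _ _ _ _ _
  rw [hte, Complex.norm_real, Real.norm_eq_abs] at hle
  have hval : h t = t ^ a := by
    simp only [hh]; rw [hχ1 t (by rw [abs_of_pos ht0]; exact ht1)]; simp
  rw [hval, abs_of_pos (by positivity)] at hle
  have : t ^ (-1:ℤ) ≤ t ^ a := zpow_le_zpow_right_of_le_one₀ ht0 ht1 ha'
  rw [zpow_neg_one, ht, inv_inv] at this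
  linarith

lemma lower_aux (χ : ℝ → ℝ) (hχ : ContDiff ℝ (⊤ : ℕ∞) χ) (hχ1 : ∀ t : ℝ, |t| ≤ 1 → χ t = 1)
    (hχ0 : ∀ t : ℝ, 2 ≤ |t| → χ t = 0) (a : ℤ) (ha : -2 ≤ a) (ha' : a ≤ -1) (ℓ : ℕ) :
    ∃ c : ℝ, 0 < c ∧ ∃ R : ℝ, 3 ≤ R ∧ ∀ y : R4, R ≤ ‖y‖ →
      ((‖y‖ ^ 4)⁻¹ * ‖y‖ ^ (-a)) * (Real.log ‖y‖ ^ ℓ * c) ≤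
        ‖T (fun t => t ^ a * Real.log t ^ ℓ * χ t) y‖ := by
  obtain ⟨e, he⟩ : ∃ e : R4, ‖e‖ = 1 := ⟨EuclideanSpace.single 0 1, by simp⟩
  choose Lm Km hlim hK using fun m => f_limit χ hχ hχ1 hχ0 a ha (by omega) m e he
  have hL0 : Lm 0 ≠ 0 := by
    intro h0
    refine L_ne_zero χ hχ hχ1 hχ0 a ha ha' e he (Km 0) (fun r hr => ?_)
    have := hK 0 r hr
    rwa [h0, sub_zero] at this
  set Q : ℝ → ℂ := fun r => ∑ m ∈ Finset.range (ℓ + 1),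
    ((ℓ.choose m) * (-1) ^ (ℓ - m) * ((Real.log r)⁻¹) ^ m : ℝ) •
        T (fun t => t ^ a * Real.log t ^ m * χ (t / r)) e with hQ
  have hinv : Filter.Tendsto (fun r : ℝ => (Real.log r)⁻¹) Filter.atTop (nhds 0) :=
    Real.tendsto_log_atTop.inv_tendsto_atTop
  have hQlim : Filter.Tendsto Q Filter.atTop (nhds (∑ m ∈ Finset.range (ℓ + 1),
      ((ℓ.choose m) * (-1) ^ (ℓ - m) * (0:ℝ) ^ m : ℝ) • Lm m)) := by
    refine tendsto_finsetSum _ (fun m _ => ?_)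
    exact ((hinv.pow m).const_mul _).smul (hlim m)
  have hsum : (∑ m ∈ Finset.range (ℓ + 1),
      ((ℓ.choose m) * (-1) ^ (ℓ - m) * (0:ℝ) ^ m : ℝ) • Lm m) = ((-1) ^ ℓ : ℝ) • Lm 0 := by
    rw [Finset.sum_eq_single 0]
    · simp
    · intro m _ hm
      simp [hm]
    · simp
  rw [hsum] at hQlim
  have hn := hQlim.norm
  have hval : ‖((-1) ^ ℓ : ℝ) • Lm 0‖ = ‖Lm 0‖ := by
    rw [norm_smul]; simp
  rw [hval] at hn
  have hpos : 0 < ‖Lm 0‖ := norm_pos_iff.mpr hL0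
  have hev := hn.eventually (eventually_ge_nhds (half_lt_self hpos))
  obtain ⟨R, hR⟩ := Filter.eventually_atTop.1 hev
  refine ⟨‖Lm 0‖ / 2, by positivity, max R 3, le_max_right _ _, fun y hy => ?_⟩
  set r := ‖y‖ with hr
  have hr3 : 3 ≤ r := (le_max_right _ _).trans hy
  have hrR : R ≤ r := (le_max_left _ _).trans hy
  have hr0 : 0 < r := by linarith
  have hlog : 0 < Real.log r := Real.log_pos (by linarith)
  have hTy : T (fun t => t ^ a * Real.log t ^ ℓ * χ t) y =
      T (fun t => t ^ a * Real.log t ^ ℓ * χ t) (r • e) :=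
    T_radial _ _ _ (by rw [norm_smul, he, mul_one, Real.norm_of_nonneg hr0.le])
  have hS : (∑ m ∈ Finset.range (ℓ + 1),
      ((ℓ.choose m) * (-1) ^ (ℓ - m) * Real.log r ^ (ℓ - m) : ℝ) •
        T (fun t => t ^ a * Real.log t ^ m * χ (t / r)) e) = (Real.log r ^ ℓ : ℝ) • Q r := by
    rw [hQ]
    simp only [Finset.smul_sum]
    refine Finset.sum_congr rfl (fun m hm => ?_)
    rw [smul_smul]
    congr 1
    have hm' : m ≤ ℓ := by have := Finset.mem_range.1 hm; omega
    have : Real.log r ^ ℓ = Real.log r ^ (ℓ - m) * Real.log r ^ m := by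
      rw [← pow_add]; congr 1; omega
    rw [this, inv_pow]
    field_simp
  rw [hTy, T_expand χ hχ.continuous hχ0 a ha ha' ℓ e r hr0, hS, norm_smul, norm_smul,
    Real.norm_of_nonneg (by positivity), Real.norm_of_nonneg (by positivity)]
  have := hR r hrR
  gcongr

lemma jx_compare (y : R4) (hy : 3 ≤ ‖y‖) :
    ‖y‖ ≤ jx y ∧ jb (Real.log (jx y)) ≤ 3 * Real.log ‖y‖ := by
  have h1 : ‖y‖ ≤ jx y := Real.le_sqrt_of_sq_le (by linarith)
  have h2 : jx y ≤ 2 * ‖y‖ := by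
    unfold jx
    rw [Real.sqrt_le_left (by linarith)]
    nlinarith
  have hlog1 : 1 ≤ Real.log ‖y‖ := by
    rw [Real.le_log_iff_exp_le (by linarith)]
    have := Real.exp_one_lt_d9
    linarith
  have hl0 : 0 ≤ Real.log (jx y) := Real.log_nonneg (jx_ge_one y)
  have hl : Real.log (jx y) ≤ Real.log 2 + Real.log ‖y‖ := by
    rw [← Real.log_mul (by norm_num) (by linarith)]
    exact Real.log_le_log (by linarith) h2
  have hlog2 : Real.log 2 ≤ 1 := by
    have := Real.log_two_lt_d9
    linarith
  refine ⟨h1, ?_⟩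
  have : jb (Real.log (jx y)) ≤ 1 + Real.log (jx y) := by
    unfold jb
    rw [Real.sqrt_le_left (by linarith)]
    nlinarith
  linarith

lemma lower_bound (χ : ℝ → ℝ) (hχ : ContDiff ℝ (⊤ : ℕ∞) χ) (hχ1 : ∀ t : ℝ, |t| ≤ 1 → χ t = 1)
    (hχ0 : ∀ t : ℝ, 2 ≤ |t| → χ t = 0) (j : ℕ) (hj : j ≤ 1) (ℓ : ℕ) :
    ∃ c : ℝ, 0 < c ∧ ∃ R : ℝ, 0 < R ∧ ∀ y : R4, R ≤ ‖y‖ →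
      c * jb (Real.log (jx y)) ^ ℓ * (jx y ^ (2 + j))⁻¹ ≤
        ‖T (fun t => t ^ ((j : ℤ) - 2) * Real.log t ^ ℓ * χ t) y‖ := by
  obtain ⟨c, hc, R, hR, h⟩ := lower_aux χ hχ hχ1 hχ0 ((j : ℤ) - 2) (by omega) (by omega) ℓ
  refine ⟨c / 3 ^ ℓ, by positivity, R, by linarith, fun y hy => ?_⟩
  refine le_trans ?_ (h y hy)
  obtain ⟨h1, h2⟩ := jx_compare y (hR.trans hy)
  have hy0 : 0 < ‖y‖ := by linarith
  have he : (‖y‖ ^ 4)⁻¹ * ‖y‖ ^ (-((j : ℤ) - 2)) = (‖y‖ ^ (2 + j))⁻¹ := by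
    rw [← zpow_natCast, ← zpow_natCast, ← zpow_neg, ← zpow_neg, ← zpow_add₀ hy0.ne']
    congr 1
    push_cast
    ring
  rw [he]
  have hjb : 0 ≤ jb (Real.log (jx y)) := Real.sqrt_nonneg _
  calc c / 3 ^ ℓ * jb (Real.log (jx y)) ^ ℓ * (jx y ^ (2 + j))⁻¹
      ≤ c / 3 ^ ℓ * (3 * Real.log ‖y‖) ^ ℓ * (‖y‖ ^ (2 + j))⁻¹ := by
        have : 0 ≤ Real.log ‖y‖ := Real.log_nonneg (by linarith)
        have hj0 : 0 < jx y := hy0.trans_le h1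
        have hj1 : 0 ≤ (jx y ^ (2 + j))⁻¹ := by positivity
        gcongr
    _ = (‖y‖ ^ (2 + j))⁻¹ * (Real.log ‖y‖ ^ ℓ * c) := by
        rw [mul_pow]
        field_simp

lemma jx_rpow (y : R4) (s : ℝ) (N : ℕ) (hs : s = N) : jx y ^ (-s) = (jx y ^ N)⁻¹ := by
  rw [Real.rpow_neg (by linarith [jx_ge_one y]), hs, Real.rpow_natCast]

/-- The low-energy symbol `ν(ξ) = |ξ|^{j-2}(log|ξ|)^ℓ χ(|ξ|)` is integrable, and its
Fourier transform `F` is smooth with derivative bounds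
`|∂^α F(y)| ≤ C ⟨log⟨y⟩⟩^ℓ ⟨y⟩^{-(2+j+|α|)}`, together with a matching lower bound for
`j ∈ {0,1}`. -/
theorem stmt_8 (χ : ℝ → ℝ) (hχ : ContDiff ℝ (⊤ : ℕ∞) χ) (hχc : HasCompactSupport χ)
    (hχ1 : ∀ t : ℝ, |t| ≤ 1 → χ t = 1) (hχ0 : ∀ t : ℝ, 2 ≤ |t| → χ t = 0)
    (j : ℕ) (hj : j ≤ 2) (ℓ : ℕ) :
    Integrable (fun ξ : R4 => ‖ξ‖ ^ ((j : ℤ) - 2) * Real.log ‖ξ‖ ^ ℓ * χ ‖ξ‖)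
      (volume : Measure R4) ∧
    ContDiff ℝ (⊤ : ℕ∞) (fun y : R4 => (((2 * Real.pi) ^ 2)⁻¹ : ℝ) *
      ∫ ξ : R4, Complex.exp (-Complex.I * (⟪y, ξ⟫ : ℝ)) *
        ((‖ξ‖ ^ ((j : ℤ) - 2) * Real.log ‖ξ‖ ^ ℓ * χ ‖ξ‖ : ℝ) : ℂ)) ∧
    (∀ n : ℕ, ∃ C : ℝ, 0 < C ∧ ∀ y : R4,
      ‖iteratedFDeriv ℝ n (fun y : R4 => (((2 * Real.pi) ^ 2)⁻¹ : ℝ) *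
          ∫ ξ : R4, Complex.exp (-Complex.I * (⟪y, ξ⟫ : ℝ)) *
            ((‖ξ‖ ^ ((j : ℤ) - 2) * Real.log ‖ξ‖ ^ ℓ * χ ‖ξ‖ : ℝ) : ℂ)) y‖ ≤
        C * jb (Real.log (jx y)) ^ ℓ * jx y ^ (-(2 + (j : ℝ) + n))) ∧
    (j ≤ 1 → ∃ c : ℝ, 0 < c ∧ ∃ R : ℝ, 0 < R ∧ ∀ y : R4, R ≤ ‖y‖ →
      c * jb (Real.log (jx y)) ^ ℓ * jx y ^ (-(2 + (j : ℝ))) ≤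
        ‖(((2 * Real.pi) ^ 2)⁻¹ : ℝ) *
          ∫ ξ : R4, Complex.exp (-Complex.I * (⟪y, ξ⟫ : ℝ)) *
            ((‖ξ‖ ^ ((j : ℤ) - 2) * Real.log ‖ξ‖ ^ ℓ * χ ‖ξ‖ : ℝ) : ℂ)‖) := by

  have hint := rad_integrable ((j : ℤ) - 2) (by omega) ℓ χ hχ.continuous 2 hχ0
  obtain ⟨H, hH, hdec, hser⟩ := dyadic χ hχ hχ1 hχ0 j ℓ
  obtain ⟨hsm, hbd⟩ := series_bound ℓ (2 + j) (by omega) H hH hdec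
  set S : R4 → ℂ := fun y : R4 => ∑' k : ℕ, (((2:ℝ)^k)⁻¹^(2 + j)) • H k (((2:ℝ)^k)⁻¹ • y) with hS
  have hπ : 0 < ((2 * Real.pi) ^ 2)⁻¹ := by positivity
  have hF : (fun y : R4 => (((2 * Real.pi) ^ 2)⁻¹ : ℝ) *
      ∫ ξ : R4, Complex.exp (-Complex.I * (⟪y, ξ⟫ : ℝ)) *
        ((‖ξ‖ ^ ((j : ℤ) - 2) * Real.log ‖ξ‖ ^ ℓ * χ ‖ξ‖ : ℝ) : ℂ)) =
      (((2 * Real.pi) ^ 2)⁻¹ : ℝ) • S := by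
    funext y
    rw [Pi.smul_apply, Complex.real_smul]
    congr 1
    exact hser y
  refine ⟨hint, ?_, ?_, ?_⟩
  · rw [hF]
    exact contDiff_const.smul hsm
  · intro n
    rw [hF]
    obtain ⟨C, hC, h⟩ := hbd n
    refine ⟨((2 * Real.pi) ^ 2)⁻¹ * C, by positivity, fun y => ?_⟩
    rw [iteratedFDeriv_const_smul_apply (hsm.contDiffAt.of_le (by exact_mod_cast le_top)),
      norm_smul, Real.norm_of_nonneg hπ.le,
      jx_rpow y _ (2 + j + n) (by push_cast; ring), mul_assoc, mul_assoc, ← mul_assoc C]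
    exact mul_le_mul_of_nonneg_left (h y) hπ.le
  · intro hj1
    obtain ⟨c, hc, R, hR, h⟩ := lower_bound χ hχ hχ1 hχ0 j hj1 ℓ
    refine ⟨((2 * Real.pi) ^ 2)⁻¹ * c, by positivity, R, hR, fun y hy => ?_⟩
    rw [norm_mul, Complex.norm_real, Real.norm_of_nonneg hπ.le,
      jx_rpow y _ (2 + j) (by push_cast; ring), mul_assoc, mul_assoc, ← mul_assoc c]
    exact mul_le_mul_of_nonneg_left (h y hy) hπ.le
end
end

section
/- (Jensen–Nenciu lemma, bounded case.) Let H be a complex Hilbert space, A a bounded linear operator on H, and S a bounded self-adjoint idempotent on H (S² = S = S*). Suppose A + S is boundedly invertible, and set B := S − S (A+S)^{-1} S. Then A is boundedly invertible if and only if there exists a bounded operator B† on H with B† = S B† S and B† B = B B† = S; and in that case A^{-1} = (A+S)^{-1} + (A+S)^{-1} B† (A+S)^{-1}. -/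
noncomputable section

theorem jn_fwd {R : Type*} [Ring R] (A S K D : R)
    (h1 : (A + S) * K = 1) (h2 : K * (A + S) = 1) (hS2 : S * S = S)
    (hD : D = S * (D * S)) (hl : D * (S - S * (K * S)) = S)
    (hr : (S - S * (K * S)) * D = S) :
    A * (K + K * (D * K)) = 1 ∧ (K + K * (D * K)) * A = 1 := by
  have hSD : S * D = D := by
    rw [hD, ← mul_assoc, hS2]
  have hDS : D * S = D := by
    rw [hD, mul_assoc, mul_assoc, hS2]
  have e1 : D - D * (K * S) = S := by
    rw [mul_sub, ← mul_assoc D S, hDS] at hl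
    exact hl
  have e2 : D - S * (K * D) = S := by
    rw [sub_mul, hSD, mul_assoc, mul_assoc, hSD] at hr
    exact hr
  constructor
  · calc A * (K + K * (D * K))
        = (A + S) * K + ((A + S) * K) * (D * K) - S * K - S * (K * D) * K := by noncomm_ring
      _ = 1 + (D - S * (K * D) - S) * K := by rw [h1]; noncomm_ring
      _ = 1 := by rw [e2]; simp
  · calc (K + K * (D * K)) * A
        = K * (A + S) + K * D * (K * (A + S)) - K * S - K * (D * (K * S)) := by noncomm_ring
      _ = 1 + K * (D - D * (K * S) - S) := by rw [h2]; noncomm_ring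
      _ = 1 := by rw [e1]; simp

theorem jn_bwd {R : Type*} [Ring R] (A S K J : R)
    (h1 : (A + S) * K = 1) (h2 : K * (A + S) = 1) (hS2 : S * S = S)
    (h3 : A * J = 1) (h4 : J * A = 1) :
    S + S * (J * S) = S * ((S + S * (J * S)) * S) ∧
    (S + S * (J * S)) * (S - S * (K * S)) = S ∧
    (S - S * (K * S)) * (S + S * (J * S)) = S := by
  have hS3 (x : R) : S * (S * x) = S * x := by rw [← mul_assoc, hS2]
  have a1 : J * (S * K) = J - K := by
    calc J * (S * K) = J * ((A + S) * K) - J * A * K := by noncomm_ring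
      _ = _ := by rw [h1, h4]; simp
  have a2 : K * (S * J) = J - K := by
    calc K * (S * J) = (K * (A + S)) * J - K * (A * J) := by noncomm_ring
      _ = _ := by rw [h2, h3]; simp
  have a3 (x : R) : J * (S * (K * x)) = (J - K) * x := by rw [← a1]; noncomm_ring
  have a4 (x : R) : K * (S * (J * x)) = (J - K) * x := by rw [← a2]; noncomm_ring
  refine ⟨?_, ?_, ?_⟩
  · simp only [mul_add, add_mul, mul_assoc, hS2, hS3]
  · simp only [mul_add, add_mul, mul_sub, sub_mul, mul_assoc, hS2, hS3, a3]
    abel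
  · simp only [mul_add, add_mul, mul_sub, sub_mul, mul_assoc, hS2, hS3, a4]
    abel

/-- The Jensen–Nenciu lemma (bounded case): if `A + S` is invertible, with `S` a
self-adjoint idempotent, then `A` is invertible iff
`B = S - S(A+S)⁻¹S` has a pseudo-inverse `B†` on the range of `S`, and then
`A⁻¹ = (A+S)⁻¹ + (A+S)⁻¹ B† (A+S)⁻¹`. -/
theorem stmt_16 (H : Type*) [NormedAddCommGroup H] [InnerProductSpace ℂ H]
    [CompleteSpace H]
    (A S : H →L[ℂ] H) (hS : IsSelfAdjoint S) (hS2 : S.comp S = S)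
    (K : H →L[ℂ] H)
    (hK1 : (A + S).comp K = ContinuousLinearMap.id ℂ H)
    (hK2 : K.comp (A + S) = ContinuousLinearMap.id ℂ H) :
    (IsUnit A ↔ ∃ Bd : H →L[ℂ] H,
        Bd = S.comp (Bd.comp S) ∧
        Bd.comp (S - S.comp (K.comp S)) = S ∧
        (S - S.comp (K.comp S)).comp Bd = S) ∧
    ∀ Ainv : H →L[ℂ] H,
      A.comp Ainv = ContinuousLinearMap.id ℂ H →
      Ainv.comp A = ContinuousLinearMap.id ℂ H →
      ∀ Bd : H →L[ℂ] H,
        Bd = S.comp (Bd.comp S) →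
        Bd.comp (S - S.comp (K.comp S)) = S →
        (S - S.comp (K.comp S)).comp Bd = S →
        Ainv = K + K.comp (Bd.comp K) := by
  refine ⟨⟨?_, ?_⟩, ?_⟩
  · rintro ⟨u, rfl⟩
    exact ⟨_, jn_bwd (u : H →L[ℂ] H) S K (↑u⁻¹) hK1 hK2 hS2 u.mul_inv u.inv_mul⟩
  · rintro ⟨D, hD, hl, hr⟩
    obtain ⟨p, q⟩ := jn_fwd A S K D hK1 hK2 hS2 hD hl hr
    exact ⟨⟨A, _, p, q⟩, rfl⟩
  · intro J h3 h4 D hD hl hr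
    obtain ⟨p, q⟩ := jn_fwd A S K D hK1 hK2 hS2 hD hl hr
    exact left_inv_eq_right_inv (M := H →L[ℂ] H) h4 p
end
end
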